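/- Let n ≥ 1 and 1 < p < ∞. There exists C > 0 (depending only on n, p) such that for every Schwartz function f on ℝ^{n+1}: ‖D_t^{1/2}f‖_{Lᵖ} + Σ_{k=1}^{n} ‖∂_{X_k}f‖_{Lᵖ} + Σ_{k=1}^{n} ‖D_t^{1/2}∂_{X_k}f‖_{Lᵖ} ≤ C·( ‖f‖_{Lᵖ} + ‖∂_t f‖_{Lᵖ} + Σ_{k,l=1}^{n} ‖∂_{X_k}∂_{X_l}f‖_{Lᵖ} ). -/

import Mathlib

noncomputable section

open MeasureTheory Real Complex
open scoped ENNReal NNReal Real BigOperators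

/-- Euclidean space `ℝⁿ`. -/
abbrev Rn (n : ℕ) : Type := EuclideanSpace ℝ (Fin n)

/-- The space `ℝ^{n+1} = ℝⁿ × ℝ`, points written `(X, t)`. -/
abbrev Rn1 (n : ℕ) : Type := EuclideanSpace ℝ (Fin n) × ℝ

/-- Fourier transform on `ℝ^{n+1}`:
`𝓕f(ξ,τ) = ∫ e^{−2πi(X·ξ + tτ)} f(X,t) dX dt`. -/
def FT1 {n : ℕ} (f : Rn1 n → ℂ) (q : Rn1 n) : ℂ :=
  ∫ p : Rn1 n,
    Complex.exp (-(2 * (π : ℂ) * Complex.I) *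
      (((∑ k, p.1 k * q.1 k) + p.2 * q.2 : ℝ) : ℂ)) * f p

/-- Inverse Fourier transform on `ℝ^{n+1}`. -/
def IFT1 {n : ℕ} (f : Rn1 n → ℂ) (x : Rn1 n) : ℂ :=
  ∫ q : Rn1 n,
    Complex.exp ((2 * (π : ℂ) * Complex.I) *
      (((∑ k, q.1 k * x.1 k) + q.2 * x.2 : ℝ) : ℂ)) * f q

/-- The Fourier multiplier operator `f ↦ 𝓕⁻¹(m · 𝓕 f)` on `ℝ^{n+1}`. -/
def MOp {n : ℕ} (m : Rn1 n → ℂ) (f : Rn1 n → ℂ) : Rn1 n → ℂ :=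
  IFT1 (fun q => m q * FT1 f q)

/-- The symbol `m_α(ξ,τ) = (1 + 4π²|ξ|² + iτ)^{α/2}` (principal branch). -/
def mSym {n : ℕ} (α : ℝ) (q : Rn1 n) : ℂ :=
  (1 + 4 * (π : ℂ) ^ 2 * (‖q.1‖ : ℂ) ^ 2 + Complex.I * (q.2 : ℂ)) ^ ((α : ℂ) / 2)

/-- Partial derivative `∂_{X_k}`. -/
def dX {n : ℕ} (k : Fin n) (f : Rn1 n → ℂ) : Rn1 n → ℂ :=
  fun x => fderiv ℝ f x (EuclideanSpace.single k 1, 0)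

/-- Partial derivative `∂_t`. -/
def dT {n : ℕ} (f : Rn1 n → ℂ) : Rn1 n → ℂ :=
  fun x => fderiv ℝ f x (0, 1)

/-- Iterated spatial derivative `D_X^β` for a multi-index `β`. -/
def dXmulti {n : ℕ} (β : Fin n → ℕ) (f : Rn1 n → ℂ) : Rn1 n → ℂ :=
  (List.finRange n).foldr (fun k g => (dX k)^[β k] g) f

/-- The half time-derivative `D_t^{1/2} f = 𝓕⁻¹(|τ|^{1/2}·𝓕f)`. -/
def halfDt {n : ℕ} (f : Rn1 n → ℂ) : Rn1 n → ℂ :=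
  MOp (fun q => ((|q.2| ^ ((1 : ℝ) / 2) : ℝ) : ℂ)) f

/-- The `Lᵖ(ℝ^{n+1})` norm (as a value in `ℝ≥0∞`), `p` a real exponent. -/
def pNorm {n : ℕ} (p : ℝ) (f : Rn1 n → ℂ) : ℝ≥0∞ :=
  eLpNorm f (ENNReal.ofReal p) volume

/-- Multi-indices `β ∈ ℕⁿ` with `|β| = N`. -/
def multiIdx (n N : ℕ) : Finset (Fin n → ℕ) :=
  (Fintype.piFinset fun _ : Fin n => Finset.range (N + 1)).filter fun β => (∑ k, β k) = N

/-- Convolution on `ℝ^{n+1}`. -/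
def conv1 {n : ℕ} (g f : Rn1 n → ℂ) : Rn1 n → ℂ :=
  fun x => ∫ y : Rn1 n, g (x - y) * f y

/-- A parabolic Littlewood–Paley family on `ℝ^{n+1}`. -/
structure ParabolicLP (n : ℕ) where
  φ : SchwartzMap (Rn1 n) ℂ
  ψ : SchwartzMap (Rn1 n) ℂ
  ft_pos : ∀ q : Rn1 n,
    1 / 2 < ‖q.1‖ + |q.2| ^ ((1 : ℝ) / 2) → ‖q.1‖ + |q.2| ^ ((1 : ℝ) / 2) < 2 →
      0 < (FT1 (⇑φ) q).re ∧ (FT1 (⇑φ) q).im = 0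
  ft_supp : ∀ q : Rn1 n,
    ¬(1 / 2 < ‖q.1‖ + |q.2| ^ ((1 : ℝ) / 2) ∧ ‖q.1‖ + |q.2| ^ ((1 : ℝ) / 2) < 2) →
      FT1 (⇑φ) q = 0
  ft_sum : ∀ q : Rn1 n, q ≠ 0 →
    ∑' i : ℤ, FT1 (⇑φ) (((2 : ℝ) ^ (-i)) • q.1, ((2 : ℝ) ^ (-(2 * i))) * q.2) = 1
  ft_psi : ∀ q : Rn1 n,
    FT1 (⇑ψ) q =
      1 - ∑' i : ℕ,
        FT1 (⇑φ) (((2 : ℝ) ^ (-((i : ℤ) + 1))) • q.1, ((2 : ℝ) ^ (-(2 * ((i : ℤ) + 1)))) * q.2)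

/-- The dilate `φ_i`, whose Fourier transform is `𝓕φ(2^{−i}ξ, 2^{−2i}τ)`. -/
def lpPhi {n : ℕ} (P : ParabolicLP n) (i : ℕ) : Rn1 n → ℂ :=
  fun x => (((2 : ℝ) ^ (i * (n + 2)) : ℝ) : ℂ) *
    P.φ (((2 : ℝ) ^ i) • x.1, ((2 : ℝ) ^ (2 * i)) * x.2)

/-- Parabolic Besov norm `N_{s,p}(f)` on `ℝ^{n+1}`, `1 ≤ p < ∞`. -/
def pBesov {n : ℕ} (P : ParabolicLP n) (s p : ℝ) (f : Rn1 n → ℂ) : ℝ≥0∞ :=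
  eLpNorm (conv1 (⇑P.ψ) f) (ENNReal.ofReal p) volume +
  (∑' i : ℕ,
    (ENNReal.ofReal ((2 : ℝ) ^ (s * ((i : ℝ) + 1))) *
      eLpNorm (conv1 (lpPhi P (i + 1)) f) (ENNReal.ofReal p) volume) ^ p) ^ (1 / p)

/-- Parabolic Besov norm `N_{s,∞}(f)` on `ℝ^{n+1}`. -/
def pBesovInf {n : ℕ} (P : ParabolicLP n) (s : ℝ) (f : Rn1 n → ℂ) : ℝ≥0∞ :=
  max (eLpNorm (conv1 (⇑P.ψ) f) ⊤ volume)
    (⨆ i : ℕ, ENNReal.ofReal ((2 : ℝ) ^ (s * ((i : ℝ) + 1))) *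
      eLpNorm (conv1 (lpPhi P (i + 1)) f) ⊤ volume)

/-- The time interval `(0, T)` for `0 < T ≤ ∞`. -/
def tSet (T : ℝ≥0∞) : Set ℝ := {t : ℝ | 0 < t ∧ ENNReal.ofReal t < T}

/-- Lebesgue measure restricted to the strip `ℝⁿ × (0,T)`. -/
def stripMeasure (n : ℕ) (T : ℝ≥0∞) : Measure (Rn1 n) :=
  volume.restrict {x : Rn1 n | x.2 ∈ tSet T}

/-- The parabolic Sobolev norm `‖g‖_{W^{2i,i}_p(ℝⁿ_T)}`. -/
def wNorm {n : ℕ} (i : ℕ) (p : ℝ) (T : ℝ≥0∞) (g : Rn1 n → ℂ) : ℝ≥0∞ :=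
  ∑ l ∈ Finset.range (i + 1),
    ∑ β ∈ (Fintype.piFinset fun _ : Fin n => Finset.range (2 * i + 1)).filter
        (fun β => (∑ k, β k) + 2 * l ≤ 2 * i),
      eLpNorm (dXmulti β (dT^[l] g)) (ENNReal.ofReal p) (stripMeasure n T)

/-- Time-regularity seminorm `[g]_{t,β,p,T}`. -/
def semT {n : ℕ} (b p : ℝ) (T : ℝ≥0∞) (g : Rn1 n → ℂ) : ℝ≥0∞ :=
  (∫⁻ X : Rn n, ∫⁻ t in tSet T, ∫⁻ s in tSet T,
      ENNReal.ofReal (‖g (X, t) - g (X, s)‖ ^ p / |t - s| ^ (1 + p * b / 2))) ^ (1 / p)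

/-- Space-regularity seminorm `[g]_{x,β,p,T}`. -/
def semX {n : ℕ} (b p : ℝ) (T : ℝ≥0∞) (g : Rn1 n → ℂ) : ℝ≥0∞ :=
  (∫⁻ t in tSet T, ∫⁻ X : Rn n, ∫⁻ Y : Rn n,
      ENNReal.ofReal (‖g (X + Y, t) - 2 * g (X, t) + g (X - Y, t)‖ ^ p /
        ‖Y‖ ^ ((n : ℝ) + p * b))) ^ (1 / p)

/-- The parabolic Besov norm `‖g‖_{B^{α,α/2}_p(ℝⁿ_T)}`, formed with index `i` where
`2i < α < 2i+2`. -/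
def pbNorm {n : ℕ} (i : ℕ) (α p : ℝ) (T : ℝ≥0∞) (g : Rn1 n → ℂ) : ℝ≥0∞ :=
  wNorm i p T g +
  ∑ l ∈ Finset.range (i + 1),
    ∑ β ∈ (Fintype.piFinset fun _ : Fin n => Finset.range (2 * i + 1)).filter
        (fun β => (∑ k, β k) + 2 * l = 2 * i),
      (semT (α - 2 * i) p T (dXmulti β (dT^[l] g)) +
        semX (α - 2 * i) p T (dXmulti β (dT^[l] g)))

/-- Fourier transform on `ℝⁿ`. -/
def FTn {n : ℕ} (f : Rn n → ℂ) (ξ : Rn n) : ℂ :=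
  ∫ x : Rn n, Complex.exp (-(2 * (π : ℂ) * Complex.I) * (((∑ k, x k * ξ k : ℝ)) : ℂ)) * f x

/-- Inverse Fourier transform on `ℝⁿ`. -/
def IFTn {n : ℕ} (f : Rn n → ℂ) (x : Rn n) : ℂ :=
  ∫ ξ : Rn n, Complex.exp ((2 * (π : ℂ) * Complex.I) * (((∑ k, ξ k * x k : ℝ)) : ℂ)) * f ξ

/-- Convolution on `ℝⁿ`. -/
def convn {n : ℕ} (g f : Rn n → ℂ) : Rn n → ℂ := fun x => ∫ y : Rn n, g (x - y) * f y

/-- A Littlewood–Paley family on `ℝⁿ`. -/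
structure LPFamily (n : ℕ) where
  φ : SchwartzMap (Rn n) ℂ
  ψ : SchwartzMap (Rn n) ℂ
  ft_pos : ∀ ξ : Rn n, 1 / 2 < ‖ξ‖ → ‖ξ‖ < 2 →
    0 < (FTn (⇑φ) ξ).re ∧ (FTn (⇑φ) ξ).im = 0
  ft_supp : ∀ ξ : Rn n, ¬(1 / 2 < ‖ξ‖ ∧ ‖ξ‖ < 2) → FTn (⇑φ) ξ = 0
  ft_sum : ∀ ξ : Rn n, ξ ≠ 0 → ∑' i : ℤ, FTn (⇑φ) (((2 : ℝ) ^ (-i)) • ξ) = 1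
  ft_psi : ∀ ξ : Rn n,
    FTn (⇑ψ) ξ = 1 - ∑' i : ℕ, FTn (⇑φ) (((2 : ℝ) ^ (-((i : ℤ) + 1))) • ξ)

/-- The dilate `φ′_i(x) = 2^{in} φ′(2^i x)`. -/
def lpPhin {n : ℕ} (P : LPFamily n) (i : ℕ) : Rn n → ℂ :=
  fun x => (((2 : ℝ) ^ (i * n) : ℝ) : ℂ) * P.φ (((2 : ℝ) ^ i) • x)

/-- Besov norm `B_{s,p}(f)` on `ℝⁿ`, `1 ≤ p < ∞`. -/
def besovN {n : ℕ} (P : LPFamily n) (s p : ℝ) (f : Rn n → ℂ) : ℝ≥0∞ :=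
  eLpNorm (convn (⇑P.ψ) f) (ENNReal.ofReal p) volume +
  (∑' i : ℕ,
    (ENNReal.ofReal ((2 : ℝ) ^ (s * ((i : ℝ) + 1))) *
      eLpNorm (convn (lpPhin P (i + 1)) f) (ENNReal.ofReal p) volume) ^ p) ^ (1 / p)

/-- The heat kernel `Γ(X,t)` on `ℝⁿ` (zero for `t ≤ 0`). -/
def heatKer (n : ℕ) (X : Rn n) (t : ℝ) : ℝ :=
  if 0 < t then (4 * π * t) ^ (-(n : ℝ) / 2) * Real.exp (-‖X‖ ^ 2 / (4 * t)) else 0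

/-- The heat extension `u(X,t) = ∫ Γ(X−Y,t) f(Y) dY`. -/
def heatExt {n : ℕ} (f : Rn n → ℂ) : Rn1 n → ℂ :=
  fun x => ∫ Y : Rn n, (heatKer n (x.1 - Y) x.2 : ℂ) * f Y

open Filter Topology Set

/-- Converse Hölder inequality, tested on bounded functions supported in an exhausting sequence. -/
theorem eLpNorm_le_of_forall_integral_mul_le {α : Type*} [MeasurableSpace α] {μ : Measure α}
    {p q : ℝ} (hpq : p.HolderConjugate q) {S : ℕ → Set α} (hSm : ∀ n, MeasurableSet (S n))
    (hSf : ∀ n, μ (S n) < ∞) (hS : Monotone S) (hSu : ⋃ n, S n = univ)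
    {F : α → ℂ} (hF : Measurable F) {C : ℝ≥0∞}
    (h : ∀ (n : ℕ) (g : α → ℂ), Measurable g → (∀ x ∉ S n, g x = 0) → (∃ M : ℝ, ∀ x, ‖g x‖ ≤ M) →
      ‖∫ x, F x * g x ∂μ‖ₑ ≤ C * eLpNorm g (ENNReal.ofReal q) μ) :
    eLpNorm F (ENNReal.ofReal p) μ ≤ C := by
  have hp0 : 0 < p := hpq.pos
  have hq0 : 0 < q := hpq.symm.pos
  have hp1 : 0 < p - 1 := hpq.sub_one_pos
  have hpp : ENNReal.ofReal p ≠ 0 := by simpa using hp0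
  have hqq : ENNReal.ofReal q ≠ 0 := by simpa using hq0
  set A : ℕ → Set α := fun n => S n ∩ {x | ‖F x‖ ≤ n} with hA
  have hAm : ∀ n, MeasurableSet (A n) := fun n =>
    (hSm n).inter (measurableSet_le hF.norm measurable_const)
  have key : ∀ n, eLpNorm ((A n).indicator F) (ENNReal.ofReal p) μ ≤ C := by
    intro n
    set I : ℝ≥0∞ := ∫⁻ x in A n, ‖F x‖ₑ ^ p ∂μ with hI
    have hAf : μ (A n) < ∞ := lt_of_le_of_lt (measure_mono inter_subset_left) (hSf n)
    have hIf : I ≠ ∞ := by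
      have : I ≤ ∫⁻ x in A n, ENNReal.ofReal ((n : ℝ) ^ p) ∂μ := by
        refine setLIntegral_mono measurable_const fun x hx => ?_
        rw [← ofReal_norm, ENNReal.ofReal_rpow_of_nonneg (norm_nonneg _) hp0.le]
        exact ENNReal.ofReal_le_ofReal (Real.rpow_le_rpow (norm_nonneg _) hx.2 hp0.le)
      refine ne_top_of_le_ne_top ?_ this
      rw [setLIntegral_const]
      exact ENNReal.mul_ne_top ENNReal.ofReal_ne_top hAf.ne
    set g : α → ℂ := (A n).indicator
      (fun x => (starRingEnd ℂ) (F x) * ((‖F x‖ ^ (p - 2) : ℝ) : ℂ)) with hg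
    have hgm : Measurable g := by
      refine Measurable.indicator ?_ (hAm n)
      exact (Complex.continuous_conj.measurable.comp hF).mul
        (Complex.measurable_ofReal.comp (hF.norm.pow_const _))
    have hgn : ∀ x ∈ A n, ‖g x‖ = ‖F x‖ ^ (p - 1) := by
      intro x hx
      rw [hg, indicator_of_mem hx, norm_mul, RCLike.norm_conj, Complex.norm_real, Real.norm_eq_abs,
        abs_of_nonneg (Real.rpow_nonneg (norm_nonneg _) _)]
      rcases (norm_nonneg (F x)).eq_or_lt with h0 | h0
      · rw [← h0, zero_mul, Real.zero_rpow hp1.ne']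
      · rw [← Real.rpow_one_add' h0.le (by linarith)]
        congr 1; ring
    have hFg : ∀ x, F x * g x = (((A n).indicator (fun x => ‖F x‖ ^ p) x : ℝ) : ℂ) := by
      intro x
      by_cases hx : x ∈ A n
      · rw [hg, indicator_of_mem hx, indicator_of_mem hx, ← mul_assoc, Complex.mul_conj,
          Complex.normSq_eq_norm_sq, ← Complex.ofReal_mul]
        congr 1
        rcases (norm_nonneg (F x)).eq_or_lt with h0 | h0
        · rw [← h0, Real.zero_rpow hp0.ne']; simp
        · rw [← Real.rpow_two, ← Real.rpow_add h0]; congr 1; ring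
      · simp [hg, indicator_of_notMem hx]
    have hfint : ‖∫ x, F x * g x ∂μ‖ₑ = I := by
      simp_rw [hFg]
      rw [integral_complex_ofReal, ← ofReal_norm, Complex.norm_real,
        integral_indicator (hAm n), Real.norm_eq_abs, abs_of_nonneg
          (integral_nonneg fun x => Real.rpow_nonneg (norm_nonneg _) _),
        integral_eq_lintegral_of_nonneg_ae
          (Eventually.of_forall fun x => Real.rpow_nonneg (norm_nonneg _) _)
          (hF.norm.pow_const _).aestronglyMeasurable]
      have : ∫⁻ x in A n, ENNReal.ofReal (‖F x‖ ^ p) ∂μ = I := by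
        refine lintegral_congr fun x => ?_
        rw [← ofReal_norm, ENNReal.ofReal_rpow_of_nonneg (norm_nonneg _) hp0.le]
      rw [this, ENNReal.ofReal_toReal hIf]
    have hgq : eLpNorm g (ENNReal.ofReal q) μ = I ^ (1 / q) := by
      rw [eLpNorm_eq_lintegral_rpow_enorm_toReal hqq ENNReal.ofReal_ne_top,
        ENNReal.toReal_ofReal hq0.le]
      congr 1
      rw [hI, ← lintegral_indicator (hAm n)]
      refine lintegral_congr fun x => ?_
      by_cases hx : x ∈ A n
      · rw [indicator_of_mem hx, ← ofReal_norm, ← ofReal_norm, hgn x hx,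
          ENNReal.ofReal_rpow_of_nonneg (by positivity) hq0.le,
          ENNReal.ofReal_rpow_of_nonneg (norm_nonneg _) hp0.le, ← Real.rpow_mul (norm_nonneg _),
          hpq.sub_one_mul_conj]
      · simp [hg, indicator_of_notMem hx, hq0]
    have hIp : eLpNorm ((A n).indicator F) (ENNReal.ofReal p) μ = I ^ (1 / p) := by
      rw [eLpNorm_indicator_eq_eLpNorm_restrict (hAm n),
        eLpNorm_eq_lintegral_rpow_enorm_toReal hpp ENNReal.ofReal_ne_top,
        ENNReal.toReal_ofReal hp0.le]
    have hmain : I ≤ C * I ^ (1 / q) := by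
      rw [← hgq, ← hfint]
      refine h n g hgm (fun x hx => ?_) ⟨(n : ℝ) ^ (p - 1), fun x => ?_⟩
      · rw [hg, indicator_of_notMem fun hx' => hx hx'.1]
      · by_cases hx : x ∈ A n
        · rw [hgn x hx]; exact Real.rpow_le_rpow (norm_nonneg _) hx.2 hp1.le
        · rw [hg, indicator_of_notMem hx, norm_zero]; positivity
    rw [hIp]
    rcases eq_or_ne I 0 with h0 | h0
    · rw [h0, ENNReal.zero_rpow_of_pos (by positivity)]; exact bot_le
    · have hsplit : I = I ^ (1 / p) * I ^ (1 / q) := by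
        rw [← ENNReal.rpow_add _ _ h0 hIf, one_div, one_div, hpq.inv_add_inv_eq_one,
          ENNReal.rpow_one]
      have h1 : I ^ (1 / q) ≠ 0 := by simp [h0, hIf]
      have h2 : I ^ (1 / q) ≠ ∞ := by simp [h0, hIf]
      rw [← ENNReal.mul_le_mul_iff_left h1 h2, ← hsplit]
      exact hmain
  refine Lp.eLpNorm_le_of_ae_tendsto (u := atTop) (Eventually.of_forall key)
    (fun n => (hF.indicator (hAm n)).aestronglyMeasurable) (Eventually.of_forall fun x => ?_)
  refine tendsto_const_nhds.congr' ?_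
  obtain ⟨m, hm⟩ := mem_iUnion.1 (hSu ▸ mem_univ x)
  filter_upwards [eventually_ge_atTop m, eventually_ge_atTop ⌈‖F x‖⌉₊] with n hn hn'
  rw [indicator_of_mem]
  exact ⟨hS hn hm, Nat.ceil_le.1 hn'⟩

theorem lintegral_enorm_mul_le {α : Type*} [MeasurableSpace α] {μ : Measure α}
    {p q : ℝ} (hpq : p.HolderConjugate q) {f g : α → ℂ} (hf : AEStronglyMeasurable f μ)
    (hg : AEStronglyMeasurable g μ) :
    ∫⁻ x, ‖f x‖ₑ * ‖g x‖ₑ ∂μ ≤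
      eLpNorm f (ENNReal.ofReal p) μ * eLpNorm g (ENNReal.ofReal q) μ := by
  rw [eLpNorm_eq_lintegral_rpow_enorm_toReal (by simpa using hpq.pos) ENNReal.ofReal_ne_top,
    eLpNorm_eq_lintegral_rpow_enorm_toReal (by simpa using hpq.symm.pos) ENNReal.ofReal_ne_top,
    ENNReal.toReal_ofReal hpq.pos.le, ENNReal.toReal_ofReal hpq.symm.pos.le]
  exact ENNReal.lintegral_mul_le_Lp_mul_Lq μ hpq hf.enorm hg.enorm

theorem memLp_of_bound_of_support {α : Type*} [MeasurableSpace α] {μ : Measure α} {g : α → ℂ}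
    {S : Set α} {M : ℝ} (hg : Measurable g) (hgS : ∀ x ∉ S, g x = 0) (hM : ∀ x, ‖g x‖ ≤ M)
    (hS : MeasurableSet S) (hSf : μ S < ∞) (p : ℝ≥0∞) : MemLp g p μ := by
  have : g = S.indicator g := by
    ext x
    by_cases hx : x ∈ S
    · rw [indicator_of_mem hx]
    · rw [indicator_of_notMem hx, hgS x hx]
  rw [this, memLp_indicator_iff_restrict hS]
  have : IsFiniteMeasure (μ.restrict S) := ⟨by simpa using hSf⟩
  exact MemLp.of_bound hg.aestronglyMeasurable M (Eventually.of_forall hM)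

/-- Minkowski's integral inequality. -/
theorem eLpNorm_integral_le_lintegral_eLpNorm {α β : Type*} [MeasurableSpace α]
    [MeasurableSpace β] {μ : Measure α} {ν : Measure β} [SigmaFinite μ] [SFinite ν]
    {p : ℝ} (hp : 1 < p) {ψ : β → α → ℂ} (hψ : Measurable (Function.uncurry ψ)) :
    eLpNorm (fun x => ∫ s, ψ s x ∂ν) (ENNReal.ofReal p) μ
      ≤ ∫⁻ s, eLpNorm (ψ s) (ENNReal.ofReal p) μ ∂ν := by
  have hpq := Real.HolderConjugate.conjExponent hp
  have hF : Measurable fun x => ∫ s, ψ s x ∂ν :=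
    (show Measurable (Function.uncurry fun x s => ψ s x) from
      hψ.comp measurable_swap).stronglyMeasurable.integral_prod_right.measurable
  refine eLpNorm_le_of_forall_integral_mul_le hpq (measurableSet_spanningSets μ)
    (measure_spanningSets_lt_top μ) (monotone_spanningSets μ) (iUnion_spanningSets μ) hF ?_
  intro n g hg hgS ⟨M, hM⟩
  calc ‖∫ x, (∫ s, ψ s x ∂ν) * g x ∂μ‖ₑ
      ≤ ∫⁻ x, ‖(∫ s, ψ s x ∂ν) * g x‖ₑ ∂μ := enorm_integral_le_lintegral_enorm _
    _ ≤ ∫⁻ x, (∫⁻ s, ‖ψ s x‖ₑ * ‖g x‖ₑ ∂ν) ∂μ := by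
        refine lintegral_mono fun x => ?_
        rw [enorm_mul, lintegral_mul_const _ (by fun_prop)]
        gcongr
        exact enorm_integral_le_lintegral_enorm _
    _ = ∫⁻ s, (∫⁻ x, ‖ψ s x‖ₑ * ‖g x‖ₑ ∂μ) ∂ν := by
        rw [lintegral_lintegral_swap]
        exact (((hψ.comp measurable_swap).enorm).mul (hg.comp measurable_fst).enorm).aemeasurable
    _ ≤ ∫⁻ s, eLpNorm (ψ s) (ENNReal.ofReal p) μ * eLpNorm g (ENNReal.ofReal _) μ ∂ν := by
        refine lintegral_mono fun s => lintegral_enorm_mul_le hpq ?_ hg.aestronglyMeasurable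
        exact (hψ.comp measurable_prodMk_left).aestronglyMeasurable
    _ ≤ _ := by
        refine (lintegral_mul_const' _ _ ?_).le
        refine (memLp_of_bound_of_support hg hgS hM (measurableSet_spanningSets μ n)
          (measure_spanningSets_lt_top μ n) _).2.ne

/-- The power series of `1 - √(1 - X)`. -/
def sibuya : PowerSeries ℝ :=
  PowerSeries.X * PowerSeries.mk fun n => (catalan n : ℝ) / (2 * 4 ^ n)

theorem two_mul_sibuya : 2 * sibuya = PowerSeries.X + sibuya ^ 2 := by
  have key : 2 * (PowerSeries.mk fun n => (catalan n : ℝ) / (2 * 4 ^ n)) =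
      1 + PowerSeries.X * (PowerSeries.mk fun n => (catalan n : ℝ) / (2 * 4 ^ n)) ^ 2 := by
    ext n
    have h2 : (2 : PowerSeries ℝ) = PowerSeries.C 2 := (map_ofNat PowerSeries.C 2).symm
    rw [h2, PowerSeries.coeff_C_mul, map_add, PowerSeries.coeff_mk]
    cases n with
    | zero => simp
    | succ n =>
      rw [PowerSeries.coeff_succ_X_mul, sq, PowerSeries.coeff_mul, PowerSeries.coeff_one,
        if_neg (Nat.succ_ne_zero n), catalan_succ', zero_add]
      push_cast
      rw [Finset.sum_div, Finset.mul_sum]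
      refine Finset.sum_congr rfl fun ij hij => ?_
      rw [Finset.HasAntidiagonal.mem_antidiagonal] at hij
      simp only [PowerSeries.coeff_mk]
      rw [← hij, pow_succ, pow_add]
      field_simp
      ring
  rw [sibuya, ← mul_assoc, mul_comm 2, mul_assoc, key]
  ring

/-- Coefficients of `(1 - √(1 - X)) ^ k`. -/
def exitCoeff (k n : ℕ) : ℝ := PowerSeries.coeff n (sibuya ^ k)

theorem exitCoeff_zero_left (n : ℕ) : exitCoeff 0 n = if n = 0 then 1 else 0 := by
  rw [exitCoeff, pow_zero, PowerSeries.coeff_one]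

theorem exitCoeff_add (k l n : ℕ) :
    exitCoeff (k + l) n = ∑ ij ∈ Finset.HasAntidiagonal.antidiagonal n, exitCoeff k ij.1 * exitCoeff l ij.2 := by
  simp only [exitCoeff, pow_add, PowerSeries.coeff_mul]

theorem exitCoeff_one_zero : exitCoeff 1 0 = 0 := by
  simp [exitCoeff, sibuya]

theorem exitCoeff_one_succ (n : ℕ) : exitCoeff 1 (n + 1) = (catalan n : ℝ) / (2 * 4 ^ n) := by
  rw [exitCoeff, pow_one, sibuya, PowerSeries.coeff_succ_X_mul, PowerSeries.coeff_mk]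

theorem exitCoeff_nonneg (k n : ℕ) : 0 ≤ exitCoeff k n := by
  induction k generalizing n with
  | zero => rw [exitCoeff_zero_left]; split_ifs <;> norm_num
  | succ k ih =>
    rw [exitCoeff_add]
    refine Finset.sum_nonneg fun ij _ => mul_nonneg (ih _) ?_
    cases ij.2 with
    | zero => rw [exitCoeff_one_zero]
    | succ m => rw [exitCoeff_one_succ]; positivity

theorem exitCoeff_recurrence_zero (k : ℕ) : 2 * exitCoeff (k + 1) 0 = exitCoeff (k + 2) 0 := by
  have h : 2 * sibuya ^ (k + 1) = PowerSeries.X * sibuya ^ k + sibuya ^ (k + 2) := by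
    linear_combination sibuya ^ k * two_mul_sibuya
  have := congrArg (PowerSeries.coeff 0) h
  rw [map_add, PowerSeries.coeff_zero_X_mul, zero_add, ← map_ofNat PowerSeries.C 2,
    PowerSeries.coeff_C_mul] at this
  exact this

theorem exitCoeff_recurrence_succ (k n : ℕ) :
    2 * exitCoeff (k + 1) (n + 1) = exitCoeff k n + exitCoeff (k + 2) (n + 1) := by
  have h : 2 * sibuya ^ (k + 1) = PowerSeries.X * sibuya ^ k + sibuya ^ (k + 2) := by
    linear_combination sibuya ^ k * two_mul_sibuya
  have := congrArg (PowerSeries.coeff (n + 1)) h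
  rw [map_add, PowerSeries.coeff_succ_X_mul, ← map_ofNat PowerSeries.C 2,
    PowerSeries.coeff_C_mul] at this
  exact this

theorem sum_range_exitCoeff_one (N : ℕ) :
    ∑ n ∈ Finset.range (N + 1), exitCoeff 1 n = 1 - (N.centralBinom : ℝ) / 4 ^ N := by
  induction N with
  | zero => simp [exitCoeff_one_zero]
  | succ N ih =>
    have h1 : ((N : ℝ) + 1) * catalan N = N.centralBinom := by
      exact_mod_cast succ_mul_catalan_eq_centralBinom N
    have h2 : ((N : ℝ) + 1) * (N + 1).centralBinom = 2 * (2 * N + 1) * N.centralBinom := by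
      exact_mod_cast Nat.succ_mul_centralBinom_succ N
    have h3 : ((N : ℝ) + 1) ≠ 0 := by positivity
    have h4 : ((N + 1).centralBinom : ℝ) = 2 * (2 * N + 1) * catalan N := by
      apply mul_left_cancel₀ h3
      rw [h2, ← h1]; ring
    rw [Finset.sum_range_succ, ih, exitCoeff_one_succ, h4, ← h1, pow_succ]
    field_simp
    ring

theorem summable_exitCoeff_one : Summable (exitCoeff 1) := by
  refine summable_of_sum_range_le (c := 1) (exitCoeff_nonneg 1) fun n => ?_
  refine (Finset.sum_le_sum_of_subset_of_nonneg (Finset.range_subset_range.2 n.le_succ)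
    fun i _ _ => exitCoeff_nonneg 1 i).trans ?_
  rw [sum_range_exitCoeff_one]
  have : (0 : ℝ) ≤ (n.centralBinom : ℝ) / 4 ^ n := by positivity
  linarith

theorem hasSum_exitCoeff_one_mul_pow {s : ℝ} (h0 : 0 ≤ s) (h1 : s ≤ 1) :
    HasSum (fun n => exitCoeff 1 n * s ^ n) (1 - √(1 - s)) := by
  have hnn : ∀ n, 0 ≤ exitCoeff 1 n * s ^ n := fun n =>
    mul_nonneg (exitCoeff_nonneg 1 n) (pow_nonneg h0 n)
  have hle : ∀ n, exitCoeff 1 n * s ^ n ≤ exitCoeff 1 n := fun n =>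
    mul_le_of_le_one_right (exitCoeff_nonneg 1 n) (pow_le_one₀ h0 h1)
  have hs : Summable fun n => exitCoeff 1 n * s ^ n :=
    Summable.of_nonneg_of_le hnn hle summable_exitCoeff_one
  set y := ∑' n, exitCoeff 1 n * s ^ n with hy
  have hy1 : y ≤ 1 := by
    refine hs.tsum_le_of_sum_range_le fun n => ?_
    refine (Finset.sum_le_sum fun i _ => hle i).trans ?_
    refine (Finset.sum_le_sum_of_subset_of_nonneg (Finset.range_subset_range.2 n.le_succ)
      fun i _ _ => exitCoeff_nonneg 1 i).trans ?_
    rw [sum_range_exitCoeff_one]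
    have : (0 : ℝ) ≤ (n.centralBinom : ℝ) / 4 ^ n := by positivity
    linarith
  have hsn : Summable fun n => ‖exitCoeff 1 n * s ^ n‖ := by
    simpa only [Real.norm_eq_abs, abs_of_nonneg (hnn _)] using hs
  have hsq : HasSum (fun n => exitCoeff 2 n * s ^ n) (y * y) := by
    have h := (summable_norm_sum_mul_antidiagonal_of_summable_norm hsn hsn).of_norm.hasSum
    rw [← tsum_mul_tsum_eq_tsum_sum_antidiagonal_of_summable_norm hsn hsn] at h
    refine h.congr_fun fun n => ?_
    rw [exitCoeff_add 1 1, Finset.sum_mul]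
    refine Finset.sum_congr rfl fun ij hij => ?_
    rw [← Finset.HasAntidiagonal.mem_antidiagonal.1 hij, pow_add]
    ring
  have hX : HasSum (fun n => exitCoeff 0 n * s ^ n * s) s := by
    have : HasSum (fun n => exitCoeff 0 n * s ^ n * s) (exitCoeff 0 0 * s ^ 0 * s) :=
      hasSum_single 0 fun n hn => by simp [exitCoeff_zero_left, hn]
    simpa [exitCoeff_zero_left] using this
  have heq : 2 * y = s + y * y := by
    have hL := (hasSum_nat_add_iff' 1).2 (hs.hasSum.mul_left 2)
    have hR := hX.add ((hasSum_nat_add_iff' 1).2 hsq)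
    have := hL.unique (hR.congr_fun fun n => ?_)
    · have h20 : exitCoeff 2 0 = 0 := by rw [← exitCoeff_recurrence_zero 0]; simp [exitCoeff_one_zero]
      simpa [exitCoeff_one_zero, h20] using this
    · have := exitCoeff_recurrence_succ 0 n
      simp only [zero_add] at this
      rw [pow_succ]
      linear_combination (s ^ n * s) * this
  have : √(1 - s) = 1 - y := by
    rw [Real.sqrt_eq_iff_mul_self_eq (by linarith) (by linarith)]
    linarith
  rw [this]
  simpa using hs.hasSum

theorem hasSum_exitCoeff_mul_pow (k : ℕ) {s : ℝ} (h0 : 0 ≤ s) (h1 : s ≤ 1) :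
    HasSum (fun n => exitCoeff k n * s ^ n) ((1 - √(1 - s)) ^ k) := by
  induction k with
  | zero =>
    have : HasSum (fun n => exitCoeff 0 n * s ^ n) (exitCoeff 0 0 * s ^ 0) :=
      hasSum_single 0 fun n hn => by simp [exitCoeff_zero_left, hn]
    simpa [exitCoeff_zero_left] using this
  | succ k ih =>
    have hb := hasSum_exitCoeff_one_mul_pow h0 h1
    have hn : ∀ l n, ‖exitCoeff l n * s ^ n‖ = exitCoeff l n * s ^ n := fun l n => by
      rw [Real.norm_eq_abs, abs_of_nonneg (mul_nonneg (exitCoeff_nonneg l n) (pow_nonneg h0 n))]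
    have hs1 : Summable fun n => ‖exitCoeff k n * s ^ n‖ := by simpa only [hn] using ih.summable
    have hs2 : Summable fun n => ‖exitCoeff 1 n * s ^ n‖ := by simpa only [hn] using hb.summable
    have h := (summable_norm_sum_mul_antidiagonal_of_summable_norm hs1 hs2).of_norm.hasSum
    rw [← tsum_mul_tsum_eq_tsum_sum_antidiagonal_of_summable_norm hs1 hs2, ih.tsum_eq,
      hb.tsum_eq, ← pow_succ] at h
    refine h.congr_fun fun n => ?_
    rw [exitCoeff_add k 1, Finset.sum_mul]
    refine Finset.sum_congr rfl fun ij hij => ?_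
    rw [← Finset.HasAntidiagonal.mem_antidiagonal.1 hij, pow_add]
    ring

theorem hasSum_exitCoeff (k : ℕ) : HasSum (exitCoeff k) 1 := by
  simpa using hasSum_exitCoeff_mul_pow k zero_le_one le_rfl

/-- A quantitative tangent line inequality for convex functions on `[0, 1]`. -/
theorem add_deriv_add_le_of_second_deriv {φ φ₁ φ₂ : ℝ → ℝ} {m : ℝ}
    (hc : ContinuousOn φ (Icc 0 1)) (h1 : ∀ s ∈ Ico (0 : ℝ) 1, HasDerivAt φ (φ₁ s) s)
    (h2 : ∀ s ∈ Ico (0 : ℝ) 1, HasDerivAt φ₁ (φ₂ s) s) (hnn : ∀ s ∈ Ico (0 : ℝ) 1, 0 ≤ φ₂ s)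
    (hge : ∀ s ∈ Icc (0 : ℝ) (1 / 2), m ≤ φ₂ s) :
    φ 0 + φ₁ 0 + m / 4 ≤ φ 1 := by
  have hsub : Icc (0 : ℝ) (1 / 2) ⊆ Ico 0 1 := fun s hs => ⟨hs.1, by linarith [hs.2]⟩
  have mono : ∀ s ∈ Ico (0 : ℝ) 1, ∀ t ∈ Ico (0 : ℝ) 1, s ≤ t → φ₁ s ≤ φ₁ t := by
    intro s hs t ht hst
    have := (convex_Ico (0 : ℝ) 1).mul_sub_le_image_sub_of_le_deriv (f := φ₁) (C := 0)
      (fun x hx => (h2 x hx).continuousAt.continuousWithinAt)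
      (fun x hx => (h2 x (interior_subset hx)).differentiableAt.differentiableWithinAt)
      (fun x hx => by
        rw [(h2 x (interior_subset hx)).deriv]; exact hnn x (interior_subset hx)) s hs t ht hst
    linarith
  have hhalf : φ₁ 0 + m / 2 ≤ φ₁ (1 / 2) := by
    have := (convex_Icc (0 : ℝ) (1 / 2)).mul_sub_le_image_sub_of_le_deriv (f := φ₁) (C := m)
      (fun x hx => (h2 x (hsub hx)).continuousAt.continuousWithinAt)
      (fun x hx => (h2 x (hsub (interior_subset hx))).differentiableAt.differentiableWithinAt)
      (fun x hx => by
        rw [(h2 x (hsub (interior_subset hx))).deriv]; exact hge x (interior_subset hx))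
      0 (by norm_num) (1 / 2) (by norm_num) (by norm_num)
    linarith
  have A := (convex_Icc (0 : ℝ) (1 / 2)).mul_sub_le_image_sub_of_le_deriv (f := φ) (C := φ₁ 0)
      (fun x hx => (h1 x (hsub hx)).continuousAt.continuousWithinAt)
      (fun x hx => (h1 x (hsub (interior_subset hx))).differentiableAt.differentiableWithinAt)
      (fun x hx => by
        have hx := hsub (interior_subset hx)
        rw [(h1 x hx).deriv]; exact mono 0 (by norm_num) x hx hx.1)
      0 (by norm_num) (1 / 2) (by norm_num) (by norm_num)
  have hsub' : interior (Icc (1 / 2 : ℝ) 1) ⊆ Ico 0 1 := by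
    rw [interior_Icc]; exact fun s hs => ⟨by linarith [hs.1], hs.2⟩
  have B := (convex_Icc (1 / 2 : ℝ) 1).mul_sub_le_image_sub_of_le_deriv (f := φ)
      (C := φ₁ 0 + m / 2)
      (hc.mono (Icc_subset_Icc_left (by norm_num)))
      (fun x hx => (h1 x (hsub' hx)).differentiableAt.differentiableWithinAt)
      (fun x hx => by
        rw [(h1 x (hsub' hx)).deriv]
        exact hhalf.trans (mono _ (by norm_num) x (hsub' hx) (interior_subset hx).1))
      (1 / 2) (by norm_num) 1 (by norm_num) (by norm_num)
  linarith

/-- The Bellman function `u ^ p + v ^ q + δ u² (u ^ p + v ^ q) ^ (2 / q - 1)`. -/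
def bellman (p q u v : ℝ) : ℝ :=
  (u ^ p + v ^ q) + 1 / (8 * p) * (u ^ 2 * (u ^ p + v ^ q) ^ (2 / q - 1))

section Bellman

variable {p q : ℝ}

theorem two_div_sub_one_nonneg (hpq : p.HolderConjugate q) (hp : 2 ≤ p) : 0 ≤ 2 / q - 1 := by
  have := hpq.inv_add_inv_eq_one
  have h2 : p⁻¹ ≤ 2⁻¹ := inv_anti₀ (by norm_num) hp
  rw [div_eq_mul_inv]
  linarith

theorem sq_le_rpow_two_div (hp : 2 ≤ p) {u v : ℝ} (hu : 0 ≤ u) (hv : 0 ≤ v) :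
    u ^ 2 ≤ (u ^ p + v ^ q) ^ (2 / p) := by
  have hp0 : 0 < p := by linarith
  calc u ^ 2 = (u ^ p) ^ (2 / p) := by
        rw [← Real.rpow_mul hu, mul_div_cancel₀ _ hp0.ne', Real.rpow_two]
    _ ≤ _ := Real.rpow_le_rpow (by positivity)
        (le_add_of_nonneg_right (Real.rpow_nonneg hv _)) (by positivity)

theorem bellman_nonneg (hpq : p.HolderConjugate q) {u v : ℝ} (hu : 0 ≤ u)
    (hv : 0 ≤ v) : 0 ≤ bellman p q u v := by
  have := hpq.pos
  rw [bellman]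
  positivity

theorem bellman_le (hpq : p.HolderConjugate q) (hp : 2 ≤ p) {u v : ℝ} (hu : 0 ≤ u)
    (hv : 0 ≤ v) : bellman p q u v ≤ 2 * (u ^ p + v ^ q) := by
  have hr := two_div_sub_one_nonneg hpq hp
  have hW : 0 ≤ u ^ p + v ^ q := by positivity
  have h1 : u ^ 2 * (u ^ p + v ^ q) ^ (2 / q - 1) ≤ u ^ p + v ^ q := by
    calc _ ≤ (u ^ p + v ^ q) ^ (2 / p) * (u ^ p + v ^ q) ^ (2 / q - 1) := by
          gcongr; exact sq_le_rpow_two_div hp hu hv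
      _ = _ := by
          have : 2 / p + (2 / q - 1) = 1 := by
            have := hpq.inv_add_inv_eq_one
            rw [div_eq_mul_inv, div_eq_mul_inv]; linarith
          rw [← Real.rpow_add' hW (by rw [this]; norm_num), this, Real.rpow_one]
  have h2 : 1 / (8 * p) ≤ 1 := by
    rw [div_le_one (by linarith)]; linarith
  have h3 : 1 / (8 * p) * (u ^ 2 * (u ^ p + v ^ q) ^ (2 / q - 1)) ≤
      1 * (u ^ p + v ^ q) := by
    gcongr
  rw [bellman]; linarith

theorem add_sq_le_mul_of_sq_eq {x y A B α β : ℝ} (hq : 0 ≤ q) (hqp : q ≤ p) (hA : 0 ≤ A)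
    (hB : 0 ≤ B) (hα : 0 ≤ α) (hβ : 0 ≤ β) (hU : x ^ 2 = q * A * α) (hV : y ^ 2 = p * B * β) :
    (x + y) ^ 2 ≤ p * (A + B) * (α + β) := by
  have hp : 0 ≤ p := hq.trans hqp
  have hxy : 2 * (x * y) ≤ p * A * β + q * B * α := by
    refine (le_abs_self _).trans (abs_le_of_sq_le_sq ?_ (by positivity))
    have : (2 * (x * y)) ^ 2 = 4 * ((p * A * β) * (q * B * α)) := by
      calc _ = 4 * (x ^ 2 * y ^ 2) := by ring
        _ = _ := by rw [hU, hV]; ring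
    rw [this]
    linarith [sq_nonneg (p * A * β - q * B * α)]
  have h1 : q * (A * α) ≤ p * (A * α) := by gcongr
  have h2 : q * (B * α) ≤ p * (B * α) := by gcongr
  linarith

/-- The lower bound for the second derivative of `bellman` along a line, where `w`, `w₁`, `w₂` are
the value and first two derivatives of `u ^ p + v ^ q`. -/
theorem bellman_second_deriv_ge (hpq : p.HolderConjugate q) (hp : 2 ≤ p) {u v a b w w₁ w₂ : ℝ}
    (hu : 0 < u) (hv : 0 < v) (hw : w = u ^ p + v ^ q)
    (hw₁ : w₁ = p * u ^ (p - 1) * a + q * v ^ (q - 1) * b)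
    (hw₂ : w₂ = p * (p - 1) * u ^ (p - 2) * a ^ 2 + q * (q - 1) * v ^ (q - 2) * b ^ 2) :
    min (1 / (8 * p)) (q * (q - 1) / 2) *
        (w ^ (2 / q - 1) * a ^ 2 + w ^ (-(2 / q - 1)) * b ^ 2) ≤
      w₂ + 1 / (8 * p) * (2 * a ^ 2 * w ^ (2 / q - 1) +
        4 * a * u * ((2 / q - 1) * w ^ (2 / q - 1 - 1) * w₁) +
        u ^ 2 * ((2 / q - 1) * ((2 / q - 1 - 1) * w ^ (2 / q - 1 - 1 - 1) * w₁ * w₁ +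
          w ^ (2 / q - 1 - 1) * w₂))) := by
  have hr := two_div_sub_one_nonneg hpq hp
  have hp0 := hpq.pos
  have hq0 := hpq.symm.pos
  have hq1 : 0 < q - 1 := hpq.symm.sub_one_pos
  have hp1 : 0 < p - 1 := hpq.sub_one_pos
  have hsum := hpq.inv_add_inv_eq_one
  set r := 2 / q - 1 with hrdef
  have hr1 : r ≤ 1 := by
    have : q⁻¹ ≤ 1 := by have := inv_nonneg.2 hp0.le; linarith
    rw [hrdef, div_eq_mul_inv]; linarith
  have hw0 : 0 < w := by rw [hw]; positivity
  have hw₂0 : 0 ≤ w₂ := by rw [hw₂]; positivity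
  have hCS : w₁ ^ 2 ≤ p * w * w₂ := by
    have hU : (p * u ^ (p - 1) * a) ^ 2 = q * u ^ p * (p * (p - 1) * u ^ (p - 2) * a ^ 2) := by
      have e1 : u ^ p * u ^ (p - 2) = (u ^ (p - 1)) ^ 2 := by
        rw [← Real.rpow_add hu, ← Real.rpow_natCast, ← Real.rpow_mul hu.le]; congr 1; push_cast; ring
      have e2 : q * (p - 1) = p := by rw [mul_comm]; exact hpq.sub_one_mul_conj
      calc _ = p * p * (u ^ (p - 1)) ^ 2 * a ^ 2 := by ring
        _ = (q * (p - 1)) * p * (u ^ p * u ^ (p - 2)) * a ^ 2 := by rw [e1, e2]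
        _ = _ := by ring
    have hV : (q * v ^ (q - 1) * b) ^ 2 = p * v ^ q * (q * (q - 1) * v ^ (q - 2) * b ^ 2) := by
      have e1 : v ^ q * v ^ (q - 2) = (v ^ (q - 1)) ^ 2 := by
        rw [← Real.rpow_add hv, ← Real.rpow_natCast, ← Real.rpow_mul hv.le]; congr 1; push_cast; ring
      have e2 : p * (q - 1) = q := by rw [mul_comm]; exact hpq.symm.sub_one_mul_conj
      calc _ = q * q * (v ^ (q - 1)) ^ 2 * b ^ 2 := by ring
        _ = (p * (q - 1)) * q * (v ^ q * v ^ (q - 2)) * b ^ 2 := by rw [e1, e2]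
        _ = _ := by ring
    have hqp : q ≤ p := by
      have h2 : 1 ≤ 2 / q := by linarith
      rw [le_div_iff₀ hq0] at h2
      linarith
    rw [hw₁, hw₂, hw]
    exact add_sq_le_mul_of_sq_eq hq0.le hqp (by positivity) (by positivity) (by positivity)
      (by positivity) hU hV
  have hu2 : u ^ 2 * w ^ (r - 1) ≤ 1 := by
    have h := sq_le_rpow_two_div (q := q) hp hu.le hv.le
    rw [← hw] at h
    calc u ^ 2 * w ^ (r - 1) ≤ w ^ (2 / p) * w ^ (r - 1) := by gcongr
      _ = 1 := by
        rw [← Real.rpow_add hw0]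
        have : 2 / p + (r - 1) = 0 := by
          rw [hrdef, div_eq_mul_inv, div_eq_mul_inv]; linarith
        rw [this, Real.rpow_zero]
  have hvq : w ^ (-r) ≤ v ^ (q - 2) := by
    have : v ^ (q - 2) = (v ^ q) ^ (-r) := by
      rw [← Real.rpow_mul hv.le]; congr 1; rw [hrdef]; field_simp; ring
    rw [this]
    exact Real.rpow_le_rpow_of_nonpos (by positivity)
      (by rw [hw]; exact le_add_of_nonneg_left (by positivity)) (by linarith)
  have e1 : w ^ (r - 1) = w ^ (r - 1 - 1) * w := by
    rw [← Real.rpow_add_one hw0.ne']; congr 1; ring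
  have e2 : w ^ r = w ^ (r - 1 - 1) * w ^ 2 := by
    rw [← Real.rpow_natCast, ← Real.rpow_add hw0]; congr 1; push_cast; ring
  have hX : 0 < w ^ (r - 1 - 1) := by positivity
  set X := w ^ (r - 1 - 1) with hXdef
  rw [e1] at hu2 ⊢
  have hG : a ^ 2 * w ^ r - 4 * p * w₂ ≤ 2 * a ^ 2 * w ^ r + 4 * a * u * (r * (X * w) * w₁) +
      u ^ 2 * (r * ((r - 1) * X * w₁ * w₁ + X * w * w₂)) := by
    have h1 : 0 ≤ X * (a * w + 2 * r * u * w₁) ^ 2 := by positivity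
    have h2 : u ^ 2 * X * w₁ ^ 2 ≤ p * w₂ := by
      calc u ^ 2 * X * w₁ ^ 2 ≤ u ^ 2 * X * (p * w * w₂) := by gcongr
        _ = (u ^ 2 * (X * w)) * (p * w₂) := by ring
        _ ≤ 1 * (p * w₂) := by gcongr
        _ = _ := one_mul _
    have h3 : 0 ≤ u ^ 2 * (r * (X * w * w₂)) := by positivity
    have h4 : (4 * r ^ 2 + r * (1 - r)) * (u ^ 2 * X * w₁ ^ 2) ≤ 4 * (p * w₂) := by
      have : 4 * r ^ 2 + r * (1 - r) ≤ 4 := by nlinarith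
      have h0 : 0 ≤ u ^ 2 * X * w₁ ^ 2 := by positivity
      nlinarith
    rw [e2]
    linarith
  have hδ : 1 / (8 * p) * (4 * p * w₂) = w₂ / 2 := by field_simp; ring
  have hδ0 : 0 ≤ 1 / (8 * p) := by positivity
  have hG' := mul_le_mul_of_nonneg_left hG hδ0
  have hlow : q * (q - 1) / 2 * (w ^ (-r) * b ^ 2) ≤ w₂ / 2 := by
    have : q * (q - 1) * (w ^ (-r) * b ^ 2) ≤ q * (q - 1) * (v ^ (q - 2) * b ^ 2) := by gcongr
    have h0 : 0 ≤ p * (p - 1) * u ^ (p - 2) * a ^ 2 := by positivity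
    rw [hw₂]; linarith
  have m1 : min (1 / (8 * p)) (q * (q - 1) / 2) * (w ^ r * a ^ 2) ≤
      1 / (8 * p) * (w ^ r * a ^ 2) := by gcongr; exact min_le_left _ _
  have m2 : min (1 / (8 * p)) (q * (q - 1) / 2) * (w ^ (-r) * b ^ 2) ≤
      q * (q - 1) / 2 * (w ^ (-r) * b ^ 2) := by gcongr; exact min_le_right _ _
  linarith

/-- Tangent line inequality for `bellman`, with comparable end points. -/
theorem bellman_tangent (hpq : p.HolderConjugate q) (hp : 2 ≤ p) :
    ∃ c : ℝ, 0 < c ∧ ∀ u v : ℝ, 0 < u → 0 < v → ∃ θ L M : ℝ, 0 < θ ∧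
      ∀ u₁ v₁ : ℝ, 0 ≤ u₁ → 0 ≤ v₁ → u₁ ≤ 8 * u → v₁ ≤ 8 * v →
        bellman p q u v + L * (u₁ - u) + M * (v₁ - v) +
          c * (θ * (u₁ - u) ^ 2 + θ⁻¹ * (v₁ - v) ^ 2) ≤ bellman p q u₁ v₁ := by
  have hp0 := hpq.pos
  have hq0 := hpq.symm.pos
  have hq1 : 0 < q - 1 := hpq.symm.sub_one_pos
  have hr := two_div_sub_one_nonneg hpq hp
  have hqp : q ≤ p := by
    have h2 : 1 ≤ 2 / q := by linarith
    rw [le_div_iff₀ hq0] at h2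
    linarith
  set r := 2 / q - 1 with hrdef
  set κ := min (1 / (8 * p)) (q * (q - 1) / 2) with hκ
  have hκ0 : 0 < κ := lt_min (by positivity) (by positivity)
  set D : ℝ := (8 : ℝ) ^ p with hD
  have hD0 : 0 < D := by positivity
  refine ⟨κ * D ^ (-r) / 4, by positivity, fun u v hu hv => ?_⟩
  set w := u ^ p + v ^ q with hw
  have hw0 : 0 < w := by positivity
  refine ⟨w ^ r, p * u ^ (p - 1) + 1 / (8 * p) * (2 * u * w ^ r +
      u ^ 2 * (r * w ^ (r - 1) * (p * u ^ (p - 1)))),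
    q * v ^ (q - 1) + 1 / (8 * p) * (u ^ 2 * (r * w ^ (r - 1) * (q * v ^ (q - 1)))),
    by positivity, fun u₁ v₁ hu₁ hv₁ hu8 hv8 => ?_⟩
  set a := u₁ - u with ha
  set b := v₁ - v with hb
  have hUpos : ∀ s ∈ Ico (0 : ℝ) 1, 0 < u + s * a := fun s hs => by
    have : u + s * a = (1 - s) * u + s * u₁ := by rw [ha]; ring
    rw [this]
    have := mul_pos (sub_pos.2 hs.2) hu
    have := mul_nonneg hs.1 hu₁
    linarith
  have hVpos : ∀ s ∈ Ico (0 : ℝ) 1, 0 < v + s * b := fun s hs => by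
    have : v + s * b = (1 - s) * v + s * v₁ := by rw [hb]; ring
    rw [this]
    have := mul_pos (sub_pos.2 hs.2) hv
    have := mul_nonneg hs.1 hv₁
    linarith
  have hUd : ∀ s, HasDerivAt (fun s => u + s * a) a s := fun s => by
    simpa using ((hasDerivAt_id s).mul_const a).const_add u
  have hVd : ∀ s, HasDerivAt (fun s => v + s * b) b s := fun s => by
    simpa using ((hasDerivAt_id s).mul_const b).const_add v
  set W : ℝ → ℝ := fun s => (u + s * a) ^ p + (v + s * b) ^ q with hWdef
  set W₁ : ℝ → ℝ := fun s => p * (u + s * a) ^ (p - 1) * a + q * (v + s * b) ^ (q - 1) * b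
    with hW₁def
  set W₂ : ℝ → ℝ := fun s => p * (p - 1) * (u + s * a) ^ (p - 2) * a ^ 2 +
    q * (q - 1) * (v + s * b) ^ (q - 2) * b ^ 2 with hW₂def
  have hWpos : ∀ s ∈ Ico (0 : ℝ) 1, 0 < W s := fun s hs => by
    have := hUpos s hs
    have := hVpos s hs
    simp only [hWdef]
    positivity
  have hWd : ∀ s ∈ Ico (0 : ℝ) 1, HasDerivAt W (W₁ s) s := fun s hs => by
    have h := ((hUd s).rpow_const (p := p) (Or.inl (hUpos s hs).ne')).add
      ((hVd s).rpow_const (p := q) (Or.inl (hVpos s hs).ne'))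
    refine h.congr_deriv ?_
    simp only [hW₁def]; ring
  have hW₁d : ∀ s ∈ Ico (0 : ℝ) 1, HasDerivAt W₁ (W₂ s) s := fun s hs => by
    have h := ((((hUd s).rpow_const (p := p - 1) (Or.inl (hUpos s hs).ne')).const_mul p).mul_const
      a).add ((((hVd s).rpow_const (p := q - 1) (Or.inl (hVpos s hs).ne')).const_mul q).mul_const b)
    refine h.congr_deriv ?_
    simp only [hW₂def]
    rw [show p - 1 - 1 = p - 2 by ring, show q - 1 - 1 = q - 2 by ring]
    ring
  have hWr : ∀ (t : ℝ), ∀ s ∈ Ico (0 : ℝ) 1,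
      HasDerivAt (fun s => W s ^ t) (t * W s ^ (t - 1) * W₁ s) s := fun t s hs => by
    refine ((hWd s hs).rpow_const (p := t) (Or.inl (hWpos s hs).ne')).congr_deriv ?_
    ring
  set m := κ * D ^ (-r) * (w ^ r * a ^ 2 + (w ^ r)⁻¹ * b ^ 2) with hm
  have hbound : ∀ s ∈ Ico (0 : ℝ) 1, _ := fun s hs =>
    bellman_second_deriv_ge (a := a) (b := b) hpq hp (hUpos s hs) (hVpos s hs) (w := W s)
      (w₁ := W₁ s) (w₂ := W₂ s) rfl rfl rfl
  have main := add_deriv_add_le_of_second_deriv (m := m)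
    (φ := fun s => bellman p q (u + s * a) (v + s * b))
    (φ₁ := fun s => W₁ s + 1 / (8 * p) * (2 * (u + s * a) * a * W s ^ r +
      (u + s * a) ^ 2 * (r * W s ^ (r - 1) * W₁ s)))
    (φ₂ := fun s => W₂ s + 1 / (8 * p) * (2 * a ^ 2 * W s ^ r +
      4 * a * (u + s * a) * (r * W s ^ (r - 1) * W₁ s) +
        (u + s * a) ^ 2 * (r * ((r - 1) * W s ^ (r - 1 - 1) * W₁ s * W₁ s +
          W s ^ (r - 1) * W₂ s))))
    ?_ ?_ ?_ ?_ ?_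
  · simp only [zero_mul, add_zero, one_mul, hW₁def, hWdef] at main
    rw [show u + a = u₁ by rw [ha]; ring, show v + b = v₁ by rw [hb]; ring, ← hw] at main
    refine le_trans (le_of_eq ?_) main
    rw [hm]; ring
  · refine Continuous.continuousOn ?_
    have hUc : Continuous fun s : ℝ => u + s * a := by fun_prop
    have hVc : Continuous fun s : ℝ => v + s * b := by fun_prop
    have hWc : Continuous W := (hUc.rpow_const fun _ => Or.inr hp0.le).add
      (hVc.rpow_const fun _ => Or.inr hq0.le)
    exact hWc.add (continuous_const.mul ((hUc.pow 2).mul (hWc.rpow_const fun _ => Or.inr hr)))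
  · intro s hs
    have h := (hWd s hs).add ((((hUd s).pow 2).mul (hWr r s hs)).const_mul (1 / (8 * p)))
    refine h.congr_deriv ?_
    simp only [Pi.pow_apply]
    push_cast
    ring
  · intro s hs
    have hw2 := ((hWr (r - 1) s hs).mul (hW₁d s hs)).const_mul r
    have h := (hW₁d s hs).add ((((((hUd s).const_mul 2).mul_const a).mul (hWr r s hs)).add
      (((hUd s).pow 2).mul hw2)).const_mul (1 / (8 * p)))
    refine (h.congr_deriv ?_).congr_of_eventuallyEq (Eventually.of_forall fun x => ?_)
    · simp only [Pi.mul_apply, Pi.pow_apply]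
      push_cast
      ring
    · simp only [Pi.mul_apply, Pi.pow_apply, Pi.add_apply]
      ring
  · intro s hs
    have := hWpos s hs
    exact le_trans (by positivity) (hbound s hs)
  · intro s hs
    have hs' : s ∈ Ico (0 : ℝ) 1 := ⟨hs.1, by linarith [hs.2]⟩
    refine le_trans ?_ (hbound s hs')
    have hWs := hWpos s hs'
    have hup : W s ≤ D * w := by
      have h1 : (u + s * a) ^ p ≤ D * u ^ p := by
        rw [hD, ← Real.mul_rpow (by norm_num) hu.le]
        refine Real.rpow_le_rpow (hUpos s hs').le ?_ hp0.le
        rw [ha]; nlinarith [hs.1, hs.2]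
      have h2 : (v + s * b) ^ q ≤ D * v ^ q := by
        calc (v + s * b) ^ q ≤ (8 * v) ^ q := by
              refine Real.rpow_le_rpow (hVpos s hs').le ?_ hq0.le
              rw [hb]; nlinarith [hs.1, hs.2]
          _ = 8 ^ q * v ^ q := Real.mul_rpow (by norm_num) hv.le
          _ ≤ D * v ^ q := by
              gcongr; exact Real.rpow_le_rpow_of_exponent_le (by norm_num) hqp
      simp only [hWdef]; rw [hw]; linarith
    have hlo : w ≤ D * W s := by
      have h1 : u ^ p ≤ D * (u + s * a) ^ p := by
        rw [hD, ← Real.mul_rpow (by norm_num) (hUpos s hs').le]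
        refine Real.rpow_le_rpow hu.le ?_ hp0.le
        rw [ha]; nlinarith [hs.1, hs.2, mul_nonneg hs.1 hu₁]
      have h2 : v ^ q ≤ D * (v + s * b) ^ q := by
        calc v ^ q ≤ (8 * (v + s * b)) ^ q := by
              refine Real.rpow_le_rpow hv.le ?_ hq0.le
              rw [hb]; nlinarith [hs.1, hs.2, mul_nonneg hs.1 hv₁]
          _ = 8 ^ q * (v + s * b) ^ q := Real.mul_rpow (by norm_num) (hVpos s hs').le
          _ ≤ D * (v + s * b) ^ q := by
              have := hVpos s hs'
              gcongr; exact Real.rpow_le_rpow_of_exponent_le (by norm_num) hqp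
      simp only [hWdef]; rw [hw]; linarith
    have k1 : D ^ (-r) * w ^ r ≤ W s ^ r := by
      rw [Real.rpow_neg hD0.le, inv_mul_le_iff₀ (by positivity), ← Real.mul_rpow hD0.le hWs.le]
      exact Real.rpow_le_rpow hw0.le hlo hr
    have k2 : D ^ (-r) * (w ^ r)⁻¹ ≤ W s ^ (-r) := by
      rw [← Real.rpow_neg hw0.le, ← Real.mul_rpow hD0.le hw0.le]
      exact Real.rpow_le_rpow_of_nonpos hWs hup (by linarith)
    calc m = κ * (D ^ (-r) * w ^ r * a ^ 2 + D ^ (-r) * (w ^ r)⁻¹ * b ^ 2) := by rw [hm]; ring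
      _ ≤ _ := by gcongr

end Bellman

theorem continuous_bellman {p q : ℝ} (hpq : p.HolderConjugate q) (hp : 2 ≤ p) :
    Continuous fun z : ℝ × ℝ => bellman p q z.1 z.2 := by
  have hr := two_div_sub_one_nonneg hpq hp
  have hW : Continuous fun z : ℝ × ℝ => z.1 ^ p + z.2 ^ q :=
    (continuous_fst.rpow_const fun _ => Or.inr hpq.nonneg).add
      (continuous_snd.rpow_const fun _ => Or.inr hpq.symm.nonneg)
  exact hW.add (continuous_const.mul ((continuous_fst.pow 2).mul
    (hW.rpow_const fun _ => Or.inr hr)))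

theorem abs_mul_abs_le_of_pos {θ : ℝ} (hθ : 0 < θ) (x y : ℝ) :
    |x| * |y| ≤ (θ * x ^ 2 + θ⁻¹ * y ^ 2) / 2 := by
  have h := sq_nonneg (√θ * |x| - (√θ)⁻¹ * |y|)
  have h1 : √θ * (√θ)⁻¹ = 1 := mul_inv_cancel₀ (Real.sqrt_pos.2 hθ).ne'
  have h2 : √θ ^ 2 = θ := Real.sq_sqrt hθ.le
  have h3 : (√θ * |x| - (√θ)⁻¹ * |y|) ^ 2 = √θ ^ 2 * |x| ^ 2 + (√θ ^ 2)⁻¹ * |y| ^ 2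
      - 2 * (√θ * (√θ)⁻¹) * (|x| * |y|) := by rw [← inv_pow]; ring
  rw [h3, h1, h2, sq_abs, sq_abs] at h
  linarith

theorem sub_sq_le_two_mul (x y z : ℝ) : (x - y) ^ 2 ≤ 2 * ((x - z) ^ 2 + (y - z) ^ 2) := by
  have := sq_nonneg (x + y - 2 * z)
  linarith [show 2 * ((x - z) ^ 2 + (y - z) ^ 2) - (x - y) ^ 2 = (x + y - 2 * z) ^ 2 by ring]

theorem abs_mul_abs_add_le_weighted {θ : ℝ} (hθ : 0 < θ) (u v u₁ u₂ u₃ u₄ v₁ v₂ v₃ v₄ : ℝ) :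
    |u₃ - u₄| * |v₁ - v₂| + |u₁ - u₂| * |v₃ - v₄| ≤
      16 * (1 / 2 * (θ * (u₁ - u) ^ 2 + θ⁻¹ * (v₁ - v) ^ 2) +
        1 / 4 * (θ * (u₂ - u) ^ 2 + θ⁻¹ * (v₂ - v) ^ 2) +
        1 / 8 * (θ * (u₃ - u) ^ 2 + θ⁻¹ * (v₃ - v) ^ 2) +
        1 / 8 * (θ * (u₄ - u) ^ 2 + θ⁻¹ * (v₄ - v) ^ 2)) := by
  have hA := abs_mul_abs_le_of_pos hθ (u₃ - u₄) (v₁ - v₂)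
  have hB := abs_mul_abs_le_of_pos hθ (u₁ - u₂) (v₃ - v₄)
  have hθ' : 0 < θ⁻¹ := inv_pos.2 hθ
  have k1 := mul_le_mul_of_nonneg_left (sub_sq_le_two_mul u₃ u₄ u) hθ.le
  have k2 := mul_le_mul_of_nonneg_left (sub_sq_le_two_mul u₁ u₂ u) hθ.le
  have k3 := mul_le_mul_of_nonneg_left (sub_sq_le_two_mul v₃ v₄ v) hθ'.le
  have k4 := mul_le_mul_of_nonneg_left (sub_sq_le_two_mul v₁ v₂ v) hθ'.le
  have n1 : 0 ≤ θ * (u₁ - u) ^ 2 := by positivity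
  have n2 : 0 ≤ θ * (u₂ - u) ^ 2 := by positivity
  have n3 : 0 ≤ θ * (u₃ - u) ^ 2 := by positivity
  have n4 : 0 ≤ θ * (u₄ - u) ^ 2 := by positivity
  have m1 : 0 ≤ θ⁻¹ * (v₁ - v) ^ 2 := by positivity
  have m2 : 0 ≤ θ⁻¹ * (v₂ - v) ^ 2 := by positivity
  have m3 : 0 ≤ θ⁻¹ * (v₃ - v) ^ 2 := by positivity
  have m4 : 0 ≤ θ⁻¹ * (v₄ - v) ^ 2 := by positivity
  generalize (u₁ - u) ^ 2 = U1 at *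
  generalize (u₂ - u) ^ 2 = U2 at *
  generalize (u₃ - u) ^ 2 = U3 at *
  generalize (u₄ - u) ^ 2 = U4 at *
  generalize (v₁ - v) ^ 2 = V1 at *
  generalize (v₂ - v) ^ 2 = V2 at *
  generalize (v₃ - v) ^ 2 = V3 at *
  generalize (v₄ - v) ^ 2 = V4 at *
  generalize (u₃ - u₄) ^ 2 = X1 at *
  generalize (v₁ - v₂) ^ 2 = X2 at *
  generalize (u₁ - u₂) ^ 2 = X3 at *
  generalize (v₃ - v₄) ^ 2 = X4 at *
  linarith

theorem bellman_gap_of_pos {p q : ℝ} (hpq : p.HolderConjugate q) (hp : 2 ≤ p) :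
    ∃ c : ℝ, 0 < c ∧ ∀ u₁ u₂ u₃ u₄ v₁ v₂ v₃ v₄ : ℝ, 0 < u₁ → 0 < u₂ → 0 < u₃ → 0 < u₄ →
      0 < v₁ → 0 < v₂ → 0 < v₃ → 0 < v₄ →
      bellman p q (1 / 2 * u₁ + 1 / 4 * u₂ + 1 / 8 * u₃ + 1 / 8 * u₄)
          (1 / 2 * v₁ + 1 / 4 * v₂ + 1 / 8 * v₃ + 1 / 8 * v₄) +
        c * (|u₃ - u₄| * |v₁ - v₂| + |u₁ - u₂| * |v₃ - v₄|) ≤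
      1 / 2 * bellman p q u₁ v₁ + 1 / 4 * bellman p q u₂ v₂ + 1 / 8 * bellman p q u₃ v₃ +
        1 / 8 * bellman p q u₄ v₄ := by
  obtain ⟨c, hc, H⟩ := bellman_tangent hpq hp
  refine ⟨c / 16, by positivity, ?_⟩
  intro u₁ u₂ u₃ u₄ v₁ v₂ v₃ v₄ hu₁ hu₂ hu₃ hu₄ hv₁ hv₂ hv₃ hv₄
  obtain ⟨u, hu⟩ : ∃ u, u = 1 / 2 * u₁ + 1 / 4 * u₂ + 1 / 8 * u₃ + 1 / 8 * u₄ := ⟨_, rfl⟩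
  obtain ⟨v, hv⟩ : ∃ v, v = 1 / 2 * v₁ + 1 / 4 * v₂ + 1 / 8 * v₃ + 1 / 8 * v₄ := ⟨_, rfl⟩
  obtain ⟨θ, L, M, hθ, h⟩ := H u v (by rw [hu]; positivity) (by rw [hv]; positivity)
  have h1 := h u₁ v₁ hu₁.le hv₁.le (by linarith) (by linarith)
  have h2 := h u₂ v₂ hu₂.le hv₂.le (by linarith) (by linarith)
  have h3 := h u₃ v₃ hu₃.le hv₃.le (by linarith) (by linarith)
  have h4 := h u₄ v₄ hu₄.le hv₄.le (by linarith) (by linarith)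
  have hsum := mul_le_mul_of_nonneg_left
    (abs_mul_abs_add_le_weighted hθ u v u₁ u₂ u₃ u₄ v₁ v₂ v₃ v₄) (by positivity : 0 ≤ c / 16)
  have hL : L * (1 / 2 * (u₁ - u) + 1 / 4 * (u₂ - u) + 1 / 8 * (u₃ - u) + 1 / 8 * (u₄ - u))
      = 0 := by rw [hu]; ring
  have hM : M * (1 / 2 * (v₁ - v) + 1 / 4 * (v₂ - v) + 1 / 8 * (v₃ - v) + 1 / 8 * (v₄ - v))
      = 0 := by rw [hv]; ring
  rw [← hu, ← hv]
  clear hu hv h H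
  generalize θ * (u₁ - u) ^ 2 + θ⁻¹ * (v₁ - v) ^ 2 = Y1 at *
  generalize θ * (u₂ - u) ^ 2 + θ⁻¹ * (v₂ - v) ^ 2 = Y2 at *
  generalize θ * (u₃ - u) ^ 2 + θ⁻¹ * (v₃ - v) ^ 2 = Y3 at *
  generalize θ * (u₄ - u) ^ 2 + θ⁻¹ * (v₄ - v) ^ 2 = Y4 at *
  generalize u₁ - u = a1 at *
  generalize u₂ - u = a2 at *
  generalize u₃ - u = a3 at *
  generalize u₄ - u = a4 at *
  generalize v₁ - v = b1 at *
  generalize v₂ - v = b2 at *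
  generalize v₃ - v = b3 at *
  generalize v₄ - v = b4 at *
  generalize |u₃ - u₄| * |v₁ - v₂| + |u₁ - u₂| * |v₃ - v₄| = G at *
  linarith

/-- Strict convexity of `bellman` for one step of the random walk with weights
`1/2, 1/4, 1/8, 1/8`. -/
theorem bellman_gap {p q : ℝ} (hpq : p.HolderConjugate q) (hp : 2 ≤ p) :
    ∃ c : ℝ, 0 < c ∧ ∀ u₁ u₂ u₃ u₄ v₁ v₂ v₃ v₄ : ℝ, 0 ≤ u₁ → 0 ≤ u₂ → 0 ≤ u₃ → 0 ≤ u₄ →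
      0 ≤ v₁ → 0 ≤ v₂ → 0 ≤ v₃ → 0 ≤ v₄ →
      bellman p q (1 / 2 * u₁ + 1 / 4 * u₂ + 1 / 8 * u₃ + 1 / 8 * u₄)
          (1 / 2 * v₁ + 1 / 4 * v₂ + 1 / 8 * v₃ + 1 / 8 * v₄) +
        c * (|u₃ - u₄| * |v₁ - v₂| + |u₁ - u₂| * |v₃ - v₄|) ≤
      1 / 2 * bellman p q u₁ v₁ + 1 / 4 * bellman p q u₂ v₂ + 1 / 8 * bellman p q u₃ v₃ +
        1 / 8 * bellman p q u₄ v₄ := by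
  obtain ⟨c, hc, pos⟩ := bellman_gap_of_pos hpq hp
  refine ⟨c, hc, ?_⟩
  intro u₁ u₂ u₃ u₄ v₁ v₂ v₃ v₄ hu₁ hu₂ hu₃ hu₄ hv₁ hv₂ hv₃ hv₄
  have hB := continuous_bellman hpq hp
  have hBc : ∀ f g : ℝ → ℝ, Continuous f → Continuous g →
      Continuous fun ε => bellman p q (f ε) (g ε) := fun f g hf hg => hB.comp (hf.prodMk hg)
  have hlim := ContinuousWithinAt.closure_le (s := Ioi (0 : ℝ)) (x := (0 : ℝ))
    (f := fun ε => bellman p q (1 / 2 * (u₁ + ε) + 1 / 4 * (u₂ + ε) + 1 / 8 * (u₃ + ε)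
        + 1 / 8 * (u₄ + ε)) (1 / 2 * (v₁ + ε) + 1 / 4 * (v₂ + ε) + 1 / 8 * (v₃ + ε)
        + 1 / 8 * (v₄ + ε)) + c * (|u₃ - u₄| * |v₁ - v₂| + |u₁ - u₂| * |v₃ - v₄|))
    (g := fun ε => 1 / 2 * bellman p q (u₁ + ε) (v₁ + ε) + 1 / 4 * bellman p q (u₂ + ε) (v₂ + ε)
      + 1 / 8 * bellman p q (u₃ + ε) (v₃ + ε) + 1 / 8 * bellman p q (u₄ + ε) (v₄ + ε))
    (by simp) ?_ ?_ ?_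
  · simpa only [add_zero] using hlim
  · refine Continuous.continuousWithinAt ?_
    exact (hBc _ _ (by fun_prop) (by fun_prop)).add continuous_const
  · refine Continuous.continuousWithinAt ?_
    exact (((continuous_const.mul (hBc _ _ (by fun_prop) (by fun_prop))).add
      (continuous_const.mul (hBc _ _ (by fun_prop) (by fun_prop)))).add
      (continuous_const.mul (hBc _ _ (by fun_prop) (by fun_prop)))).add
      (continuous_const.mul (hBc _ _ (by fun_prop) (by fun_prop)))
  · intro ε hε
    have hε : 0 < ε := hε
    have := pos (u₁ + ε) (u₂ + ε) (u₃ + ε) (u₄ + ε) (v₁ + ε) (v₂ + ε) (v₃ + ε) (v₄ + ε)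
      (by positivity) (by positivity) (by positivity) (by positivity) (by positivity)
      (by positivity) (by positivity) (by positivity)
    simpa only [add_sub_add_right_eq_sub] using this

theorem sum_mul_le_of_midpoint_convex {I J : ℕ → ℝ} {R : ℝ} (hI : ∀ m, 0 ≤ I m)
    (hR : ∀ m, I m ≤ R) (hJ : ∀ m, 0 ≤ J m)
    (h : ∀ m, I (m + 1) + J m ≤ 1 / 2 * I (m + 2) + 1 / 2 * I m) (N : ℕ) :
    ∑ m ∈ Finset.range N, (m + 1 : ℝ) * J m ≤ R := by
  have hd : ∀ m, I (m + 1) ≤ I m := by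
    by_contra! hcon
    obtain ⟨m, hm⟩ := hcon
    have step : ∀ k : ℕ, I (m + 1) - I m ≤ I (m + k + 1) - I (m + k) := by
      intro k
      induction k with
      | zero => simp
      | succ k ih =>
        have h1 := h (m + k)
        have h2 := hJ (m + k)
        rw [← add_assoc]
        linarith
    have grow : ∀ k : ℕ, I m + k * (I (m + 1) - I m) ≤ I (m + k) := by
      intro k
      induction k with
      | zero => simp
      | succ k ih =>
        have := step k
        push_cast
        rw [← add_assoc]
        linarith
    obtain ⟨k, hk⟩ := exists_nat_gt (R / (I (m + 1) - I m))
    rw [div_lt_iff₀ (sub_pos.2 hm)] at hk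
    linarith [grow k, hR (m + k), hI m]
  have key : ∀ N : ℕ, ∑ m ∈ Finset.range N, (m + 1 : ℝ) * J m ≤
      1 / 2 * (I 0 - (N + 1) * I N + N * I (N + 1)) := by
    intro N
    induction N with
    | zero => simp
    | succ N ih =>
      rw [Finset.sum_range_succ]
      have := mul_le_mul_of_nonneg_left (h N) (by positivity : (0 : ℝ) ≤ N + 1)
      push_cast
      rw [show N + 1 + 1 = N + 2 from rfl]
      linarith
  have h1 := mul_le_mul_of_nonneg_left (hd N) (by positivity : (0 : ℝ) ≤ N)
  linarith [key N, hI 0, hI N, hR 0]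

section RandomWalk

variable {E : Type*} [AddCommGroup E] [MeasurableSpace E]

/-- One step of the lazy random walk which moves by `± e` with probability `1/4` each. -/
def walkStep (e : E) (ν : Measure E) : Measure E :=
  (2⁻¹ : ℝ≥0∞) • ν + ((4⁻¹ : ℝ≥0∞) • ν.map (· + e) + (4⁻¹ : ℝ≥0∞) • ν.map (· + -e))

/-- The law of the lazy random walk after `n` steps. -/
def walkLaw (e : E) : ℕ → Measure E
  | 0 => Measure.dirac 0
  | n + 1 => walkStep e (walkLaw e n)

/-- The law of the lazy random walk stopped at an independent time with
distribution `exitCoeff k`. -/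
def exitLaw (e : E) (k : ℕ) : Measure E :=
  Measure.sum fun n => ENNReal.ofReal (exitCoeff k n) • walkLaw e n

variable (e : E)

variable [MeasurableAdd₂ E]

theorem inv_two_add_inv_four_add_inv_four : (2⁻¹ : ℝ≥0∞) + (4⁻¹ + 4⁻¹) = 1 := by
  rw [← ENNReal.toReal_eq_toReal_iff' (by simp) (by simp)]
  rw [ENNReal.toReal_add (by simp) (by simp), ENNReal.toReal_add (by simp) (by simp)]
  norm_num

instance isProbabilityMeasure_walkStep (ν : Measure E) [IsProbabilityMeasure ν] :
    IsProbabilityMeasure (walkStep e ν) := ⟨by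
  have h1 : ν.map (· + e) univ = 1 :=
    (Measure.isProbabilityMeasure_map (measurable_add_const e).aemeasurable).measure_univ
  have h2 : ν.map (· + -e) univ = 1 :=
    (Measure.isProbabilityMeasure_map (measurable_add_const (-e)).aemeasurable).measure_univ
  simp only [walkStep, Measure.add_apply, Measure.smul_apply, h1, h2, measure_univ, smul_eq_mul,
    mul_one]
  exact inv_two_add_inv_four_add_inv_four⟩

instance isProbabilityMeasure_walkLaw (n : ℕ) : IsProbabilityMeasure (walkLaw e n) := by
  induction n with
  | zero => exact Measure.dirac.isProbabilityMeasure
  | succ n ih => exact isProbabilityMeasure_walkStep e _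

instance isProbabilityMeasure_exitLaw (k : ℕ) : IsProbabilityMeasure (exitLaw e k) := ⟨by
  rw [exitLaw, Measure.sum_apply _ MeasurableSet.univ]
  simp only [Measure.smul_apply, measure_univ, smul_eq_mul, mul_one]
  rw [← ENNReal.ofReal_tsum_of_nonneg (exitCoeff_nonneg k) (hasSum_exitCoeff k).summable,
    (hasSum_exitCoeff k).tsum_eq, ENNReal.ofReal_one]⟩

theorem walkStep_exitLaw_apply (k : ℕ) {A : Set E} (hA : MeasurableSet A) :
    walkStep e (exitLaw e k) A = ∑' n, ENNReal.ofReal (exitCoeff k n) * walkLaw e (n + 1) A := by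
  have h1 := measurable_add_const e hA
  have h2 := measurable_add_const (-e) hA
  simp only [walkLaw, walkStep, exitLaw, Measure.add_apply, Measure.smul_apply, smul_eq_mul,
    Measure.map_apply (measurable_add_const e) hA, Measure.map_apply (measurable_add_const (-e)) hA,
    Measure.sum_apply _ hA, Measure.sum_apply _ h1, Measure.sum_apply _ h2]
  rw [← ENNReal.tsum_mul_left, ← ENNReal.tsum_mul_left, ← ENNReal.tsum_mul_left,
    ← ENNReal.tsum_add, ← ENNReal.tsum_add]
  refine tsum_congr fun n => ?_
  ring

theorem exitLaw_harmonic (k : ℕ) :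
    exitLaw e (k + 1) + exitLaw e (k + 1) = exitLaw e (k + 2) + walkStep e (exitLaw e k) := by
  ext A hA
  rw [Measure.add_apply, Measure.add_apply, walkStep_exitLaw_apply e k hA]
  simp only [exitLaw, Measure.sum_apply _ hA, Measure.smul_apply, smul_eq_mul]
  rw [← ENNReal.tsum_add, tsum_eq_zero_add'
      (f := fun n => ENNReal.ofReal (exitCoeff (k + 1) n) * walkLaw e n A +
        ENNReal.ofReal (exitCoeff (k + 1) n) * walkLaw e n A) ENNReal.summable,
    tsum_eq_zero_add' (f := fun n => ENNReal.ofReal (exitCoeff (k + 2) n) * walkLaw e n A)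
      ENNReal.summable, add_assoc (ENNReal.ofReal (exitCoeff (k + 2) 0) * _),
    ← ENNReal.tsum_add]
  congr 1
  · rw [← add_mul, ← ENNReal.ofReal_add (exitCoeff_nonneg _ _) (exitCoeff_nonneg _ _), ← two_mul,
      exitCoeff_recurrence_zero]
  · refine tsum_congr fun n => ?_
    rw [← add_mul, ← add_mul, ← ENNReal.ofReal_add (exitCoeff_nonneg _ _) (exitCoeff_nonneg _ _),
      ← ENNReal.ofReal_add (exitCoeff_nonneg _ _) (exitCoeff_nonneg _ _), ← two_mul,
      exitCoeff_recurrence_succ, add_comm]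

variable {V : Type*} [NormedAddCommGroup V] [NormedSpace ℝ V]

theorem integral_walkStep (ν : Measure E) [IsProbabilityMeasure ν] {f : E → V} {M : ℝ}
    (hf : StronglyMeasurable f) (hM : ∀ x, ‖f x‖ ≤ M) :
    ∫ y, f y ∂walkStep e ν =
      (1 / 2 : ℝ) • ∫ y, f y ∂ν + ((1 / 4 : ℝ) • ∫ y, f (y + e) ∂ν +
        (1 / 4 : ℝ) • ∫ y, f (y + -e) ∂ν) := by
  have hfint : ∀ (ρ : Measure E) [IsFiniteMeasure ρ], Integrable f ρ := fun ρ _ =>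
    Integrable.of_bound hf.aestronglyMeasurable M (.of_forall hM)
  have h2 : (2⁻¹ : ℝ≥0∞) ≠ ⊤ := by simp
  have h4 : (4⁻¹ : ℝ≥0∞) ≠ ⊤ := by simp
  rw [walkStep, integral_add_measure ((hfint ν).smul_measure h2)
    (((hfint _).smul_measure h4).add_measure ((hfint _).smul_measure h4)),
    integral_add_measure ((hfint _).smul_measure h4) ((hfint _).smul_measure h4),
    integral_smul_measure, integral_smul_measure, integral_smul_measure,
    integral_map (measurable_add_const e).aemeasurable hf.aestronglyMeasurable,
    integral_map (measurable_add_const (-e)).aemeasurable hf.aestronglyMeasurable]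
  norm_num

theorem integral_exitLaw_harmonic (k : ℕ) {f : E → V} {M : ℝ}
    (hf : StronglyMeasurable f) (hM : ∀ x, ‖f x‖ ≤ M) :
    ∫ y, f y ∂exitLaw e (k + 1) =
      (1 / 2 : ℝ) • ∫ y, f y ∂exitLaw e (k + 2) + ((1 / 4 : ℝ) • ∫ y, f y ∂exitLaw e k +
        ((1 / 8 : ℝ) • ∫ y, f (y + e) ∂exitLaw e k +
          (1 / 8 : ℝ) • ∫ y, f (y + -e) ∂exitLaw e k)) := by
  have hfint : ∀ (ρ : Measure E) [IsFiniteMeasure ρ], Integrable f ρ := fun ρ _ =>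
    Integrable.of_bound hf.aestronglyMeasurable M (.of_forall hM)
  have h : ∫ y, f y ∂(exitLaw e (k + 1) + exitLaw e (k + 1)) =
      ∫ y, f y ∂(exitLaw e (k + 2) + walkStep e (exitLaw e k)) := by rw [exitLaw_harmonic]
  rw [integral_add_measure (hfint _) (hfint _), integral_add_measure (hfint _) (hfint _),
    integral_walkStep e _ hf hM] at h
  have h' := congrArg ((1 / 2 : ℝ) • ·) h
  simp only [← two_smul ℝ (∫ y, f y ∂exitLaw e (k + 1)), smul_smul, smul_add] at h'
  norm_num at h' ⊢
  exact h'

theorem integral_walkLaw_char {χ : E → ℂ} {s : ℝ} (hχ : Measurable χ) (hM : ∀ x, ‖χ x‖ ≤ 1)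
    (h0 : χ 0 = 1) (hadd : ∀ x y, χ (x + y) = χ x * χ y)
    (hs : (s : ℂ) = 1 / 2 + (χ e + χ (-e)) / 4) (n : ℕ) :
    ∫ y, χ y ∂walkLaw e n = s ^ n := by
  induction n with
  | zero => simp [walkLaw, integral_dirac' _ _ hχ.stronglyMeasurable, h0]
  | succ n ih =>
    rw [walkLaw, integral_walkStep e _ hχ.stronglyMeasurable hM]
    simp only [hadd]
    rw [integral_mul_const, integral_mul_const, ih, pow_succ, hs, real_smul, real_smul, real_smul]
    push_cast
    ring

theorem integral_exitLaw_char {χ : E → ℂ} {s : ℝ} (hχ : Measurable χ) (hM : ∀ x, ‖χ x‖ ≤ 1)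
    (h0 : χ 0 = 1) (hadd : ∀ x y, χ (x + y) = χ x * χ y)
    (hs : (s : ℂ) = 1 / 2 + (χ e + χ (-e)) / 4) (hs0 : 0 ≤ s) (hs1 : s ≤ 1) (k : ℕ) :
    ∫ y, χ y ∂exitLaw e k = ((1 - √(1 - s)) ^ k : ℝ) := by
  have hfint : Integrable χ (exitLaw e k) :=
    Integrable.of_bound hχ.aestronglyMeasurable 1 (.of_forall hM)
  have h := hasSum_integral_measure (μ := fun n => ENNReal.ofReal (exitCoeff k n) • walkLaw e n)
    (f := χ) hfint
  have h2 := Complex.hasSum_ofReal.2 (hasSum_exitCoeff_mul_pow k hs0 hs1)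
  refine h.unique ?_
  have h3 : ∀ n, ∫ y, χ y ∂(ENNReal.ofReal (exitCoeff k n) • walkLaw e n) =
      ((exitCoeff k n * s ^ n : ℝ) : ℂ) := fun n => ?_
  · simpa only [h3] using h2
  rw [integral_smul_measure, integral_walkLaw_char e hχ hM h0 hadd hs,
    ENNReal.toReal_ofReal (exitCoeff_nonneg k n), real_smul]
  push_cast
  rfl

variable [MeasurableNeg E]

theorem map_neg_walkStep (ν : Measure E) (hν : ν.map Neg.neg = ν) :
    (walkStep e ν).map Neg.neg = walkStep e ν := by
  have h1 : (ν.map (· + e)).map Neg.neg = ν.map (· + -e) := by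
    rw [Measure.map_map measurable_neg (measurable_add_const e)]
    conv_rhs => rw [← hν, Measure.map_map (measurable_add_const (-e)) measurable_neg]
    congr 1
    ext x
    simp [add_comm]
  have h2 : (ν.map (· + -e)).map Neg.neg = ν.map (· + e) := by
    rw [Measure.map_map measurable_neg (measurable_add_const (-e))]
    conv_rhs => rw [← hν, Measure.map_map (measurable_add_const e) measurable_neg]
    congr 1
    ext x
    simp [add_comm]
  rw [walkStep, Measure.map_add _ _ measurable_neg, Measure.map_add _ _ measurable_neg,
    Measure.map_smul, Measure.map_smul, Measure.map_smul, h1, h2, hν,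
    add_comm ((4⁻¹ : ℝ≥0∞) • ν.map (· + e))]

theorem map_neg_walkLaw (n : ℕ) : (walkLaw e n).map Neg.neg = walkLaw e n := by
  induction n with
  | zero => simp [walkLaw, Measure.map_dirac' measurable_neg]
  | succ n ih => exact map_neg_walkStep e _ ih

theorem map_neg_exitLaw (k : ℕ) : (exitLaw e k).map Neg.neg = exitLaw e k := by
  ext A hA
  rw [Measure.map_apply measurable_neg hA, exitLaw, Measure.sum_apply _ hA,
    Measure.sum_apply _ (measurable_neg hA)]
  refine tsum_congr fun n => ?_
  rw [Measure.smul_apply, Measure.smul_apply, ← Measure.map_apply measurable_neg hA,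
    map_neg_walkLaw]

end RandomWalk


/-- A bounded measurable function. -/
def BddMeasurable {E V : Type*} [MeasurableSpace E] [NormedAddCommGroup V] [MeasurableSpace V]
    (f : E → V) : Prop :=
  Measurable f ∧ ∃ M : ℝ, ∀ x, ‖f x‖ ≤ M

/-- The average of `f` over the translates given by `exitLaw e k`. -/
def exitAvg {E V : Type*} [AddCommGroup E] [MeasurableSpace E] [NormedAddCommGroup V]
    [NormedSpace ℝ V] (e : E) (k : ℕ) (f : E → V) (x : E) : V :=
  ∫ y, f (x + y) ∂exitLaw e k

section ExitAvg

variable {E : Type*} [AddCommGroup E] [MeasurableSpace E] [MeasurableAdd₂ E]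
  {𝕜 : Type*} [RCLike 𝕜] {e : E} {k : ℕ} {f g : E → 𝕜}

theorem BddMeasurable.integrable_translate (hf : BddMeasurable f) (x : E) (ν : Measure E)
    [IsFiniteMeasure ν] : Integrable (fun y => f (x + y)) ν := by
  obtain ⟨hm, M, hM⟩ := hf
  exact Integrable.of_bound (hm.comp (measurable_const_add x)).aestronglyMeasurable M
    (.of_forall fun y => hM _)

theorem measurable_exitAvg (hf : Measurable f) : Measurable (exitAvg e k f) :=
  ((hf.comp measurable_add).stronglyMeasurable.integral_prod_right').measurable

theorem norm_exitAvg_le {M : ℝ} (hM : ∀ x, ‖f x‖ ≤ M) (x : E) : ‖exitAvg e k f x‖ ≤ M := by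
  simpa [exitAvg] using
    norm_integral_le_of_norm_le_const (μ := exitLaw e k) (.of_forall fun y => hM (x + y))

theorem BddMeasurable.exitAvg (hf : BddMeasurable f) : BddMeasurable (exitAvg e k f) :=
  ⟨measurable_exitAvg hf.1, hf.2.imp fun _ hM => norm_exitAvg_le hM⟩

omit [AddCommGroup E] [MeasurableAdd₂ E] in
theorem BddMeasurable.add (hf : BddMeasurable f) (hg : BddMeasurable g) :
    BddMeasurable fun x => f x + g x := by
  obtain ⟨M, hM⟩ := hf.2
  obtain ⟨M', hM'⟩ := hg.2
  exact ⟨hf.1.add hg.1, M + M', fun x => (norm_add_le _ _).trans (add_le_add (hM x) (hM' x))⟩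

omit [AddCommGroup E] [MeasurableAdd₂ E] in
theorem BddMeasurable.const_mul (hf : BddMeasurable f) (c : 𝕜) :
    BddMeasurable fun x => c * f x := by
  obtain ⟨M, hM⟩ := hf.2
  refine ⟨hf.1.const_mul c, ‖c‖ * M, fun x => ?_⟩
  rw [norm_mul]
  exact mul_le_mul_of_nonneg_left (hM x) (norm_nonneg c)

omit [MeasurableAdd₂ E] in
theorem exitAvg_const_mul (c : 𝕜) (x : E) :
    exitAvg e k (fun x => c * f x) x = c * exitAvg e k f x :=
  integral_const_mul _ _

omit [MeasurableAdd₂ E] in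
theorem exitAvg_ofReal (f : E → ℝ) (x : E) :
    exitAvg e k (fun x => (f x : ℂ)) x = ((exitAvg e k f x : ℝ) : ℂ) :=
  integral_ofReal

omit [MeasurableAdd₂ E] in
theorem exitAvg_nonneg {f : E → ℝ} (hf : ∀ x, 0 ≤ f x) (x : E) : 0 ≤ exitAvg e k f x :=
  integral_nonneg fun _ => hf _

theorem exitAvg_harmonic (hf : BddMeasurable f) (x : E) :
    exitAvg e (k + 1) f x =
      (1 / 2 : ℝ) • exitAvg e (k + 2) f x + ((1 / 4 : ℝ) • exitAvg e k f x +
        ((1 / 8 : ℝ) • exitAvg e k f (x + e) + (1 / 8 : ℝ) • exitAvg e k f (x + -e))) := by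
  obtain ⟨hm, M, hM⟩ := hf
  have := integral_exitLaw_harmonic e k (f := fun y => f (x + y))
    (hm.comp (measurable_const_add x)).stronglyMeasurable fun y => hM _
  simp only [exitAvg, this, add_assoc, add_comm e, add_comm (-e)]

variable {μ : Measure E} [SigmaFinite μ] [μ.IsAddRightInvariant]

omit [SigmaFinite μ] in
theorem eLpNorm_translate {f : E → ℂ} (hf : AEStronglyMeasurable f μ) (v : E) (p : ℝ≥0∞) :
    eLpNorm (fun x => f (x + v)) p μ = eLpNorm f p μ :=
  eLpNorm_comp_measurePreserving hf (measurePreserving_add_right μ v)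

theorem eLpNorm_exitAvg_le {p : ℝ} (hp : 1 < p) {f : E → ℂ} (hf : Measurable f) :
    eLpNorm (exitAvg e k f) (ENNReal.ofReal p) μ ≤ eLpNorm f (ENNReal.ofReal p) μ := by
  refine (eLpNorm_integral_le_lintegral_eLpNorm (ψ := fun y x => f (x + y)) hp
    (hf.comp (measurable_snd.add measurable_fst))).trans ?_
  simp [eLpNorm_translate hf.aestronglyMeasurable]

theorem eLpNorm_exitAvg_le_of_real {p : ℝ} (hp : 1 < p) {f : E → ℝ} (hf : Measurable f) :
    eLpNorm (exitAvg e k f) (ENNReal.ofReal p) μ ≤ eLpNorm f (ENNReal.ofReal p) μ := by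
  have h := eLpNorm_exitAvg_le (e := e) (k := k) (μ := μ) hp
    (measurable_ofReal.comp hf : Measurable fun x => (f x : ℂ))
  have h1 : exitAvg e k (fun x => (f x : ℂ)) = fun x => ((exitAvg e k f x : ℝ) : ℂ) :=
    funext (exitAvg_ofReal f)
  have h2 : ∀ u : E → ℝ, eLpNorm (fun x => (u x : ℂ)) (ENNReal.ofReal p) μ =
      eLpNorm u (ENNReal.ofReal p) μ := fun u =>
    eLpNorm_congr_norm_ae (.of_forall fun x => by simp)
  change eLpNorm (exitAvg e k fun x => (f x : ℂ)) _ _ ≤ eLpNorm (fun x => (f x : ℂ)) _ _ at h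
  rwa [h1, h2, h2] at h

theorem integral_exitAvg_mul [MeasurableNeg E] {f g : E → ℂ} (hf : BddMeasurable f)
    (hg : Integrable g μ) (hgm : Measurable g) :
    ∫ x, exitAvg e k f x * g x ∂μ = ∫ x, f x * exitAvg e k g x ∂μ := by
  obtain ⟨hm, M, hM⟩ := hf
  have hi : Integrable (Function.uncurry fun x y => f (x + y) * g x) (μ.prod (exitLaw e k)) := by
    refine Integrable.bdd_mul (c := M) ?_ (hm.comp measurable_add).aestronglyMeasurable
      (.of_forall fun _ => hM _)
    exact hg.comp_fst _
  have h1 : ∀ y, ∫ x, f (x + y) * g x ∂μ = ∫ x, f x * g (x + -y) ∂μ := fun y => by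
    rw [← integral_add_right_eq_self (fun x => f x * g (x + -y)) y]
    simp
  have hi' : Integrable (Function.uncurry fun x y => f x * g (x + -y)) (μ.prod (exitLaw e k)) := by
    refine Integrable.bdd_mul (c := M) ?_ (hm.comp measurable_fst).aestronglyMeasurable
      (.of_forall fun _ => hM _)
    have hgm' : AEStronglyMeasurable (fun z : E × E => g (z.1 + -z.2)) (μ.prod (exitLaw e k)) :=
      (hgm.comp (measurable_fst.add measurable_snd.neg)).aestronglyMeasurable
    rw [integrable_prod_iff' hgm']
    refine ⟨.of_forall fun y => hg.comp_add_right (-y), ?_⟩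
    have : ∀ y, ∫ x, ‖g (x + -y)‖ ∂μ = ∫ x, ‖g x‖ ∂μ := fun y =>
      integral_add_right_eq_self (fun x => ‖g x‖) (-y)
    simp only [this]
    exact integrable_const _
  simp only [exitAvg, ← integral_mul_const, ← integral_const_mul]
  rw [integral_integral_swap hi]
  simp only [h1]
  rw [← integral_integral_swap hi']
  refine integral_congr_ae (.of_forall fun x => ?_)
  simp only
  conv_rhs => rw [← map_neg_exitLaw e k]
  rw [integral_map measurable_neg.aemeasurable]
  exact ((hgm.comp (measurable_const_add x)).const_mul (f x)).aestronglyMeasurable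

end ExitAvg

section BellmanSum

/-- The symmetric difference `f (x + e) - f (x - e)`. -/
def symDiffStep {E V : Type*} [AddCommGroup E] [AddCommGroup V] (e : E) (f : E → V) (x : E) : V :=
  f (x + e) - f (x + -e)

variable {E : Type*} [AddCommGroup E] [MeasurableSpace E] [MeasurableAdd₂ E] {e : E}
  {μ : Measure E} [SigmaFinite μ] [μ.IsAddRightInvariant]

/-- The pairing which controls the multipliers associated with the random walk. -/
def walkPairing {𝕜 : Type*} [RCLike 𝕜] (μ : Measure E) (e : E) (m : ℕ) (f g : E → 𝕜) : ℝ≥0∞ :=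
  ∫⁻ x, ‖symDiffStep e (exitAvg e m f) x‖ₑ * ‖exitAvg e (m + 2) g x - exitAvg e m g x‖ₑ ∂μ

theorem BddMeasurable.measurable_symDiffStep {𝕜 : Type*} [RCLike 𝕜] {f : E → 𝕜}
    (hf : BddMeasurable f) (e : E) : Measurable (symDiffStep e f) :=
  (hf.1.comp (measurable_add_const e)).sub (hf.1.comp (measurable_add_const (-e)))

theorem lintegral_ofReal_rpow_exitAvg_le {p : ℝ} (hp : 1 < p) {f : E → ℝ} (hf : Measurable f)
    (h0 : ∀ x, 0 ≤ f x) (h : eLpNorm f (ENNReal.ofReal p) μ ≤ 1) (k : ℕ) :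
    ∫⁻ x, ENNReal.ofReal (exitAvg e k f x ^ p) ∂μ ≤ 1 := by
  have hp0 : 0 < p := zero_lt_one.trans hp
  have h1 := (eLpNorm_exitAvg_le_of_real (e := e) (k := k) hp hf).trans h
  rw [eLpNorm_eq_lintegral_rpow_enorm_toReal (by simpa using hp0) ENNReal.ofReal_ne_top,
    ENNReal.toReal_ofReal hp0.le] at h1
  have h2 : ∀ x, ENNReal.ofReal (exitAvg e k f x ^ p) = ‖exitAvg e k f x‖ₑ ^ p := fun x => by
    rw [Real.enorm_of_nonneg (exitAvg_nonneg h0 x),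
      ENNReal.ofReal_rpow_of_nonneg (exitAvg_nonneg h0 x) hp0.le]
  simp only [h2]
  rw [one_div] at h1
  simpa using (ENNReal.rpow_inv_le_iff hp0).1 h1

theorem exists_sum_walkPairing_le_of_two_le {p q : ℝ} (hpq : p.HolderConjugate q) (hp : 2 ≤ p) :
    ∃ K : ℝ≥0, ∀ (e : E) (f g : E → ℝ), BddMeasurable f → BddMeasurable g → (∀ x, 0 ≤ f x) →
      (∀ x, 0 ≤ g x) → eLpNorm f (ENNReal.ofReal p) μ ≤ 1 →
      eLpNorm g (ENNReal.ofReal q) μ ≤ 1 → ∀ N : ℕ,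
      ∑ m ∈ Finset.range N, (m + 1 : ℝ≥0∞) * (walkPairing μ e m f g + walkPairing μ e m g f)
        ≤ K := by
  obtain ⟨c, hc, H⟩ := bellman_gap hpq hp
  refine ⟨(4 / c).toNNReal, fun e f g hf hg hf0 hg0 hfp hgq N => ?_⟩
  have hBm := (continuous_bellman hpq hp).measurable
  have hBQ : ∀ j, Measurable fun x => bellman p q (exitAvg e j f x) (exitAvg e j g x) := fun j =>
    hBm.comp ((measurable_exitAvg hf.1).prodMk (measurable_exitAvg hg.1))
  have hB0 : ∀ j x, 0 ≤ bellman p q (exitAvg e j f x) (exitAvg e j g x) := fun j x =>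
    bellman_nonneg hpq (exitAvg_nonneg hf0 x) (exitAvg_nonneg hg0 x)
  set I : ℕ → ℝ≥0∞ := fun j =>
    ∫⁻ x, ENNReal.ofReal (bellman p q (exitAvg e j f x) (exitAvg e j g x)) ∂μ with hI
  set J : ℕ → ℝ≥0∞ := fun m => walkPairing μ e m f g + walkPairing μ e m g f with hJ
  have hI4 : ∀ j, I j ≤ 4 := fun j => by
    calc I j ≤ ∫⁻ x, (2 * ENNReal.ofReal (exitAvg e j f x ^ p) +
          2 * ENNReal.ofReal (exitAvg e j g x ^ q)) ∂μ := by
          refine lintegral_mono fun x => ?_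
          have ha : 0 ≤ exitAvg e j f x ^ p := rpow_nonneg (exitAvg_nonneg hf0 x) p
          have hb : 0 ≤ exitAvg e j g x ^ q := rpow_nonneg (exitAvg_nonneg hg0 x) q
          refine (ENNReal.ofReal_le_ofReal
            (bellman_le hpq hp (exitAvg_nonneg hf0 x) (exitAvg_nonneg hg0 x))).trans_eq ?_
          rw [ENNReal.ofReal_mul zero_le_two, ENNReal.ofReal_add ha hb, mul_add,
            ENNReal.ofReal_ofNat]
      _ = 2 * ∫⁻ x, ENNReal.ofReal (exitAvg e j f x ^ p) ∂μ +
          2 * ∫⁻ x, ENNReal.ofReal (exitAvg e j g x ^ q) ∂μ := by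
          have hm1 : Measurable fun x => ENNReal.ofReal (exitAvg e j f x ^ p) :=
            ((measurable_exitAvg hf.1).pow_const p).ennreal_ofReal
          have hm2 : Measurable fun x => ENNReal.ofReal (exitAvg e j g x ^ q) :=
            ((measurable_exitAvg hg.1).pow_const q).ennreal_ofReal
          rw [lintegral_add_left (hm1.const_mul 2), lintegral_const_mul _ hm1,
            lintegral_const_mul _ hm2]
      _ ≤ 2 * 1 + 2 * 1 := by
          gcongr
          · exact lintegral_ofReal_rpow_exitAvg_le hpq.lt hf.1 hf0 hfp j
          · exact lintegral_ofReal_rpow_exitAvg_le hpq.symm.lt hg.1 hg0 hgq j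
      _ = 4 := by norm_num
  have hItop : ∀ j, I j ≠ ∞ := fun j => ne_top_of_le_ne_top (by simp) (hI4 j)
  have step : ∀ m, I (m + 1) + ENNReal.ofReal c * J m ≤
      ENNReal.ofReal (1 / 2) * I (m + 2) + ENNReal.ofReal (1 / 2) * I m := fun m => by
    have htr : ∀ v, ∫⁻ x, ENNReal.ofReal (bellman p q (exitAvg e m f (x + v))
        (exitAvg e m g (x + v))) ∂μ = I m := fun v =>
      lintegral_add_right_eq_self
        (fun x => ENNReal.ofReal (bellman p q (exitAvg e m f x) (exitAvg e m g x))) v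
    have hmD : ∀ u w : E → ℝ, BddMeasurable u → BddMeasurable w → Measurable fun x =>
        ‖symDiffStep e (exitAvg e m u) x‖ₑ * ‖exitAvg e (m + 2) w x - exitAvg e m w x‖ₑ :=
      fun u w hu hw => (hu.exitAvg.measurable_symDiffStep e).enorm.mul
        ((measurable_exitAvg hw.1).sub (measurable_exitAvg hw.1)).enorm
    have hmT : ∀ v, Measurable fun x => ENNReal.ofReal (bellman p q (exitAvg e m f (x + v))
        (exitAvg e m g (x + v))) := fun v =>
      ((hBQ m).comp (measurable_add_const v)).ennreal_ofReal
    have h4 : ENNReal.ofReal (1 / 4) + (ENNReal.ofReal (1 / 8) + ENNReal.ofReal (1 / 8)) =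
        ENNReal.ofReal (1 / 2) := by
      rw [← ENNReal.ofReal_add (by norm_num) (by norm_num),
        ← ENNReal.ofReal_add (by norm_num) (by norm_num)]
      norm_num
    have hL : I (m + 1) + ENNReal.ofReal c * J m = ∫⁻ x,
        (ENNReal.ofReal (bellman p q (exitAvg e (m + 1) f x) (exitAvg e (m + 1) g x)) +
          ENNReal.ofReal c * (‖symDiffStep e (exitAvg e m f) x‖ₑ *
            ‖exitAvg e (m + 2) g x - exitAvg e m g x‖ₑ + ‖symDiffStep e (exitAvg e m g) x‖ₑ *
            ‖exitAvg e (m + 2) f x - exitAvg e m f x‖ₑ)) ∂μ := by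
      rw [lintegral_add_left (hBQ (m + 1)).ennreal_ofReal,
        lintegral_const_mul' _ _ ENNReal.ofReal_ne_top, lintegral_add_left (hmD f g hf hg)]
      rfl
    have hR : ENNReal.ofReal (1 / 2) * I (m + 2) + ENNReal.ofReal (1 / 2) * I m = ∫⁻ x,
        (ENNReal.ofReal (1 / 2) * ENNReal.ofReal
            (bellman p q (exitAvg e (m + 2) f x) (exitAvg e (m + 2) g x)) +
          (ENNReal.ofReal (1 / 4) * ENNReal.ofReal
            (bellman p q (exitAvg e m f x) (exitAvg e m g x)) +
          (ENNReal.ofReal (1 / 8) * ENNReal.ofReal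
            (bellman p q (exitAvg e m f (x + e)) (exitAvg e m g (x + e))) +
          ENNReal.ofReal (1 / 8) * ENNReal.ofReal
            (bellman p q (exitAvg e m f (x + -e)) (exitAvg e m g (x + -e)))))) ∂μ := by
      rw [lintegral_add_left ((hBQ (m + 2)).ennreal_ofReal.const_mul _),
        lintegral_add_left ((hBQ m).ennreal_ofReal.const_mul _),
        lintegral_add_left ((hmT e).const_mul _), lintegral_const_mul _ (hmT e),
        lintegral_const_mul _ (hmT (-e)), lintegral_const_mul _ (hBQ m).ennreal_ofReal,
        lintegral_const_mul _ (hBQ (m + 2)).ennreal_ofReal, htr, htr, ← h4]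
      ring
    rw [hL, hR]
    refine lintegral_mono fun x => ?_
    have hx := H (exitAvg e (m + 2) f x) (exitAvg e m f x) (exitAvg e m f (x + e))
      (exitAvg e m f (x + -e)) (exitAvg e (m + 2) g x) (exitAvg e m g x) (exitAvg e m g (x + e))
      (exitAvg e m g (x + -e)) (exitAvg_nonneg hf0 _) (exitAvg_nonneg hf0 _)
      (exitAvg_nonneg hf0 _) (exitAvg_nonneg hf0 _) (exitAvg_nonneg hg0 _)
      (exitAvg_nonneg hg0 _) (exitAvg_nonneg hg0 _) (exitAvg_nonneg hg0 _)
    have hf1 := exitAvg_harmonic (e := e) (k := m) hf x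
    have hg1 := exitAvg_harmonic (e := e) (k := m) hg x
    simp only [smul_eq_mul, ← add_assoc] at hf1 hg1
    rw [← hf1, ← hg1] at hx
    have b1 := hB0 (m + 1) x
    have b2 := hB0 (m + 2) x
    have b3 := hB0 m x
    have b4 := hB0 m (x + e)
    have b5 := hB0 m (x + -e)
    simp only [symDiffStep, enorm_eq_ofReal_abs]
    rw [← ENNReal.ofReal_mul (abs_nonneg _), ← ENNReal.ofReal_mul (abs_nonneg _),
      ← ENNReal.ofReal_add (by positivity) (by positivity), ← ENNReal.ofReal_mul hc.le,
      ← ENNReal.ofReal_add b1 (by positivity), ← ENNReal.ofReal_mul (by norm_num),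
      ← ENNReal.ofReal_mul (by norm_num), ← ENNReal.ofReal_mul (by norm_num),
      ← ENNReal.ofReal_mul (by norm_num), ← ENNReal.ofReal_add (by positivity) (by positivity),
      ← ENNReal.ofReal_add (by positivity) (by positivity),
      ← ENNReal.ofReal_add (by positivity) (by positivity)]
    refine ENNReal.ofReal_le_ofReal ?_
    rw [abs_sub_comm (exitAvg e (m + 2) g x), abs_sub_comm (exitAvg e (m + 2) f x)] at hx ⊢
    linarith
  have hcJ : ∀ m, ENNReal.ofReal c * J m ≠ ∞ := fun m =>
    ne_top_of_le_ne_top (ENNReal.add_ne_top.2 ⟨ENNReal.mul_ne_top (by simp) (hItop _),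
      ENNReal.mul_ne_top (by simp) (hItop _)⟩) (le_add_self.trans (step m))
  have hJtop : ∀ m, J m ≠ ∞ := fun m h => hcJ m (by
    rw [h, ENNReal.mul_top (by simpa using hc)])
  have hmain := sum_mul_le_of_midpoint_convex (I := fun j => (I j).toReal)
    (J := fun m => c * (J m).toReal) (R := 4) (fun _ => ENNReal.toReal_nonneg)
    (fun j => ENNReal.toReal_le_of_le_ofReal (by norm_num) (by simpa using hI4 j))
    (fun m => by positivity) (fun m => by
      have := ENNReal.toReal_mono (ENNReal.add_ne_top.2
        ⟨ENNReal.mul_ne_top (by simp) (hItop _), ENNReal.mul_ne_top (by simp) (hItop _)⟩) (step m)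
      rw [ENNReal.toReal_add (hItop _) (hcJ _), ENNReal.toReal_add
        (ENNReal.mul_ne_top (by simp) (hItop _)) (ENNReal.mul_ne_top (by simp) (hItop _)),
        ENNReal.toReal_mul, ENNReal.toReal_mul, ENNReal.toReal_mul, ENNReal.toReal_ofReal hc.le,
        ENNReal.toReal_ofReal (by norm_num)] at this
      exact this) N
  have hsum : ∑ m ∈ Finset.range N, (m + 1 : ℝ≥0∞) * J m =
      ENNReal.ofReal (∑ m ∈ Finset.range N, (m + 1 : ℝ) * (J m).toReal) := by
    rw [ENNReal.ofReal_sum_of_nonneg fun m _ => by positivity]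
    refine Finset.sum_congr rfl fun m _ => ?_
    rw [ENNReal.ofReal_mul (by positivity), ENNReal.ofReal_toReal (hJtop m),
      ENNReal.ofReal_add (by positivity) zero_le_one, ENNReal.ofReal_natCast, ENNReal.ofReal_one]
  rw [hsum]
  refine ENNReal.ofReal_le_ofReal ?_
  rw [le_div_iff₀ hc, Finset.sum_mul]
  refine (Finset.sum_congr rfl fun m _ => ?_).trans_le hmain
  ring

end BellmanSum

section ComplexBellmanSum

variable {E : Type*} [AddCommGroup E] [MeasurableSpace E] [MeasurableAdd₂ E]
  {μ : Measure E} [SigmaFinite μ] [μ.IsAddRightInvariant] {e : E}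

theorem exists_sum_walkPairing_le_of_nonneg {p q : ℝ} (hpq : p.HolderConjugate q) :
    ∃ K : ℝ≥0, ∀ (e : E) (f g : E → ℝ), BddMeasurable f → BddMeasurable g → (∀ x, 0 ≤ f x) →
      (∀ x, 0 ≤ g x) → eLpNorm f (ENNReal.ofReal p) μ ≤ 1 →
      eLpNorm g (ENNReal.ofReal q) μ ≤ 1 → ∀ N : ℕ,
      ∑ m ∈ Finset.range N, (m + 1 : ℝ≥0∞) * walkPairing μ e m f g ≤ K := by
  rcases le_total 2 p with hp | hp
  · obtain ⟨K, hK⟩ := exists_sum_walkPairing_le_of_two_le (μ := μ) hpq hp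
    refine ⟨K, fun e f g hf hg hf0 hg0 hfp hgq N =>
      (Finset.sum_le_sum fun m _ => ?_).trans (hK e f g hf hg hf0 hg0 hfp hgq N)⟩
    gcongr
    exact le_self_add
  · have hq : 2 ≤ q := by
      have h1 := hpq.inv_add_inv_eq_one
      have h2 : 2⁻¹ ≤ p⁻¹ := inv_anti₀ hpq.pos hp
      have h3 : q⁻¹ ≤ 2⁻¹ := by linarith
      exact (inv_le_inv₀ hpq.symm.pos two_pos).1 h3
    obtain ⟨K, hK⟩ := exists_sum_walkPairing_le_of_two_le (μ := μ) hpq.symm hq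
    refine ⟨K, fun e f g hf hg hf0 hg0 hfp hgq N =>
      (Finset.sum_le_sum fun m _ => ?_).trans (hK e g f hg hf hg0 hf0 hgq hfp N)⟩
    gcongr
    exact le_add_self

/-- The positive part of `f` in the direction `I ^ i`. -/
def quadrantPart (i : ℕ) (f : E → ℂ) (x : E) : ℝ := max (((-I) ^ i * f x).re) 0

omit [AddCommGroup E] [MeasurableSpace E] [MeasurableAdd₂ E] in
theorem sum_quadrantPart (f : E → ℂ) (x : E) :
    f x = ∑ i ∈ Finset.range 4, I ^ i * (quadrantPart i f x : ℂ) := by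
  have h3 : (-I) ^ 3 = I := by rw [neg_pow, I_pow_three]; norm_num
  have h2 : (-I) ^ 2 = -1 := by rw [neg_sq, I_sq]
  have hmax : ∀ r : ℝ, max r 0 - max (-r) 0 = r := fun r => by
    rcases le_total 0 r with h | h
    · rw [max_eq_left h, max_eq_right (by linarith)]; ring
    · rw [max_eq_right h, max_eq_left (by linarith)]; ring
  have hre := hmax (f x).re
  have him := hmax (f x).im
  simp only [quadrantPart, Finset.sum_range_succ, Finset.sum_range_zero, h2, h3, I_sq,
    I_pow_three, pow_zero, pow_one]
  apply Complex.ext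
  · simp
    linarith
  · simp
    linarith

omit [AddCommGroup E] [MeasurableSpace E] [MeasurableAdd₂ E] in
theorem quadrantPart_nonneg (i : ℕ) (f : E → ℂ) (x : E) : 0 ≤ quadrantPart i f x :=
  le_max_right _ _

omit [AddCommGroup E] [MeasurableSpace E] [MeasurableAdd₂ E] in
theorem quadrantPart_le_norm (i : ℕ) (f : E → ℂ) (x : E) : quadrantPart i f x ≤ ‖f x‖ := by
  refine max_le ((re_le_norm _).trans_eq ?_) (norm_nonneg _)
  simp

omit [AddCommGroup E] [MeasurableAdd₂ E] in
theorem BddMeasurable.quadrantPart {f : E → ℂ} (hf : BddMeasurable f) (i : ℕ) :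
    BddMeasurable (quadrantPart i f) := by
  obtain ⟨hm, M, hM⟩ := hf
  refine ⟨(measurable_re.comp (hm.const_mul _)).max measurable_const, M, fun x => ?_⟩
  rw [Real.norm_of_nonneg (quadrantPart_nonneg i f x)]
  exact (quadrantPart_le_norm i f x).trans (hM x)

omit [SigmaFinite μ] [μ.IsAddRightInvariant] in
omit [AddCommGroup E] [MeasurableAdd₂ E] in
theorem eLpNorm_quadrantPart_le (i : ℕ) (f : E → ℂ) (p : ℝ≥0∞) :
    eLpNorm (quadrantPart i f) p μ ≤ eLpNorm f p μ :=
  eLpNorm_mono fun x => by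
    rw [Real.norm_of_nonneg (quadrantPart_nonneg i f x)]
    exact quadrantPart_le_norm i f x

theorem exitAvg_eq_sum_quadrantPart {f : E → ℂ} (hf : BddMeasurable f) (k : ℕ) (x : E) :
    exitAvg e k f x =
      ∑ i ∈ Finset.range 4, I ^ i * ((exitAvg e k (quadrantPart i f) x : ℝ) : ℂ) := by
  have : f = fun x => ∑ i ∈ Finset.range 4, I ^ i * (quadrantPart i f x : ℂ) :=
    funext (sum_quadrantPart f)
  conv_lhs => rw [this]
  rw [exitAvg, integral_finsetSum]
  · refine Finset.sum_congr rfl fun i _ => ?_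
    rw [integral_const_mul, ← exitAvg_ofReal]
    rfl
  · intro i _
    exact (((hf.quadrantPart i).integrable_translate x _).ofReal).const_mul _

theorem enorm_sum_I_pow_mul_le (a : ℕ → ℝ) :
    ‖∑ i ∈ Finset.range 4, I ^ i * (a i : ℂ)‖ₑ ≤ ∑ i ∈ Finset.range 4, ‖a i‖ₑ := by
  refine (enorm_sum_le _ _).trans (Finset.sum_le_sum fun i _ => ?_)
  rw [enorm_mul, enorm_pow]
  simp [← ofReal_norm]

omit [SigmaFinite μ] [μ.IsAddRightInvariant] in
theorem walkPairing_le_sum {f g : E → ℂ} (hf : BddMeasurable f) (hg : BddMeasurable g) (m : ℕ) :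
    walkPairing μ e m f g ≤ ∑ i ∈ Finset.range 4, ∑ j ∈ Finset.range 4,
      walkPairing μ e m (quadrantPart i f) (quadrantPart j g) := by
  have hmeas : ∀ i j, Measurable fun x =>
      ‖symDiffStep e (exitAvg e m (quadrantPart i f)) x‖ₑ *
        ‖exitAvg e (m + 2) (quadrantPart j g) x - exitAvg e m (quadrantPart j g) x‖ₑ :=
    fun i j => ((hf.quadrantPart i).exitAvg.measurable_symDiffStep e).enorm.mul
      ((measurable_exitAvg (hg.quadrantPart j).1).sub
        (measurable_exitAvg (hg.quadrantPart j).1)).enorm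
  simp only [walkPairing]
  simp_rw [← lintegral_finsetSum _ fun j _ => hmeas _ j]
  rw [← lintegral_finsetSum _ fun i _ => Finset.measurable_sum _ fun j _ => hmeas i j]
  refine lintegral_mono fun x => ?_
  rw [← Finset.sum_mul_sum]
  refine mul_le_mul' ?_ ?_
  · rw [symDiffStep, exitAvg_eq_sum_quadrantPart hf, exitAvg_eq_sum_quadrantPart hf,
      ← Finset.sum_sub_distrib]
    simp only [← mul_sub, ← ofReal_sub]
    exact enorm_sum_I_pow_mul_le _
  · rw [exitAvg_eq_sum_quadrantPart hg, exitAvg_eq_sum_quadrantPart hg,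
      ← Finset.sum_sub_distrib]
    simp only [← mul_sub, ← ofReal_sub]
    exact enorm_sum_I_pow_mul_le _

theorem exists_sum_walkPairing_le_of_le_one {p q : ℝ} (hpq : p.HolderConjugate q) :
    ∃ K : ℝ≥0, ∀ (e : E) (f g : E → ℂ), BddMeasurable f → BddMeasurable g →
      eLpNorm f (ENNReal.ofReal p) μ ≤ 1 → eLpNorm g (ENNReal.ofReal q) μ ≤ 1 → ∀ N : ℕ,
      ∑ m ∈ Finset.range N, (m + 1 : ℝ≥0∞) * walkPairing μ e m f g ≤ K := by
  obtain ⟨K, hK⟩ := exists_sum_walkPairing_le_of_nonneg (μ := μ) hpq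
  refine ⟨16 * K, fun e f g hf hg hfp hgq N => ?_⟩
  calc _ ≤ ∑ m ∈ Finset.range N, ∑ i ∈ Finset.range 4, ∑ j ∈ Finset.range 4,
        (m + 1 : ℝ≥0∞) * walkPairing μ e m (quadrantPart i f) (quadrantPart j g) := by
        refine Finset.sum_le_sum fun m _ => ?_
        simp only [← Finset.mul_sum]
        gcongr
        exact walkPairing_le_sum hf hg m
    _ = ∑ i ∈ Finset.range 4, ∑ j ∈ Finset.range 4, ∑ m ∈ Finset.range N,
        (m + 1 : ℝ≥0∞) * walkPairing μ e m (quadrantPart i f) (quadrantPart j g) := by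
        rw [Finset.sum_comm]
        exact Finset.sum_congr rfl fun i _ => Finset.sum_comm
    _ ≤ ∑ i ∈ Finset.range 4, ∑ j ∈ Finset.range 4, (K : ℝ≥0∞) :=
        Finset.sum_le_sum fun i _ => Finset.sum_le_sum fun j _ =>
          hK e _ _ (hf.quadrantPart i) (hg.quadrantPart j) (quadrantPart_nonneg i f)
            (quadrantPart_nonneg j g) ((eLpNorm_quadrantPart_le i f _).trans hfp)
            ((eLpNorm_quadrantPart_le j g _).trans hgq) N
    _ = _ := by
        simp only [Finset.sum_const, Finset.card_range, nsmul_eq_mul, ENNReal.coe_mul]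
        push_cast
        ring

omit [SigmaFinite μ] [μ.IsAddRightInvariant] in
omit [MeasurableAdd₂ E] in
theorem walkPairing_const_mul (m : ℕ) (f g : E → ℂ) (s t : ℂ) :
    walkPairing μ e m (fun x => s * f x) (fun x => t * g x) =
      ‖s‖ₑ * ‖t‖ₑ * walkPairing μ e m f g := by
  rw [walkPairing, walkPairing,
    ← lintegral_const_mul' _ _ (ENNReal.mul_ne_top enorm_ne_top enorm_ne_top)]
  refine lintegral_congr fun x => ?_
  simp only [symDiffStep, exitAvg_const_mul, ← mul_sub, enorm_mul]
  ring

/-- Summed random walk square function estimate. -/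
theorem exists_sum_walkPairing_le {p q : ℝ} (hpq : p.HolderConjugate q) :
    ∃ K : ℝ≥0, ∀ (e : E) (f g : E → ℂ), BddMeasurable f → BddMeasurable g →
      MemLp f (ENNReal.ofReal p) μ → MemLp g (ENNReal.ofReal q) μ → ∀ N : ℕ,
      ∑ m ∈ Finset.range N, (m + 1 : ℝ≥0∞) * walkPairing μ e m f g ≤
        K * (eLpNorm f (ENNReal.ofReal p) μ * eLpNorm g (ENNReal.ofReal q) μ) := by
  obtain ⟨K, hK⟩ := exists_sum_walkPairing_le_of_le_one (μ := μ) hpq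
  refine ⟨K, fun e f g hf hg hfp hgq N => ?_⟩
  lift eLpNorm f (ENNReal.ofReal p) μ to ℝ≥0 using hfp.2.ne with a ha
  lift eLpNorm g (ENNReal.ofReal q) μ to ℝ≥0 using hgq.2.ne with b hb
  have key : ∀ ε : ℝ≥0, 0 < ε → ∑ m ∈ Finset.range N, (m + 1 : ℝ≥0∞) * walkPairing μ e m f g ≤
      ((K * ((a + ε) * (b + ε)) : ℝ≥0) : ℝ≥0∞) := fun ε hε => by
    have hnorm : ∀ c : ℝ≥0, ‖(((c⁻¹ : ℝ≥0) : ℝ) : ℂ)‖ₑ = ((c⁻¹ : ℝ≥0) : ℝ≥0∞) := fun c => by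
      rw [← ofReal_norm, Complex.norm_real, Real.norm_of_nonneg (NNReal.coe_nonneg _),
        ENNReal.ofReal_coe_nnreal]
    have hsc : ∀ (c r : ℝ≥0) (h : E → ℂ) (d : ℝ≥0), (d : ℝ≥0∞) = eLpNorm h (ENNReal.ofReal r) μ →
        c = d + ε →
        eLpNorm (fun x => (((c⁻¹ : ℝ≥0) : ℝ) : ℂ) * h x) (ENNReal.ofReal r) μ ≤ 1 := by
      intro c r h d hd hc
      have hc0 : 0 < c := by rw [hc]; positivity
      change eLpNorm ((((c⁻¹ : ℝ≥0) : ℝ) : ℂ) • h) _ _ ≤ _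
      rw [eLpNorm_const_smul, ← hd, hnorm, ← ENNReal.coe_mul, ← ENNReal.coe_one,
        ENNReal.coe_le_coe, inv_mul_le_one₀ hc0, hc]
      exact le_self_add
    have h1 := hK e _ _ (hf.const_mul ((((a + ε)⁻¹ : ℝ≥0) : ℝ) : ℂ))
      (hg.const_mul ((((b + ε)⁻¹ : ℝ≥0) : ℝ) : ℂ))
      (by simpa only [Real.coe_toNNReal _ hpq.nonneg] using
        hsc (a + ε) p.toNNReal f a (by rw [Real.coe_toNNReal _ hpq.nonneg, ha]) rfl)
      (by simpa only [Real.coe_toNNReal _ hpq.symm.nonneg] using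
        hsc (b + ε) q.toNNReal g b (by rw [Real.coe_toNNReal _ hpq.symm.nonneg, hb]) rfl) N
    simp only [walkPairing_const_mul, hnorm, mul_left_comm (_ + 1 : ℝ≥0∞)] at h1
    rw [← Finset.mul_sum, ← ENNReal.coe_mul, ← mul_inv] at h1
    have hne : (a + ε) * (b + ε) ≠ 0 := by positivity
    rw [ENNReal.coe_inv hne, mul_comm, ← div_eq_mul_inv, ENNReal.div_le_iff
      (by simpa using hne) ENNReal.coe_ne_top] at h1
    rwa [ENNReal.coe_mul]
  have hcont : Continuous fun ε : ℝ≥0 => ((K * ((a + ε) * (b + ε)) : ℝ≥0) : ℝ≥0∞) :=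
    ENNReal.continuous_coe.comp (by fun_prop)
  have h0 : (0 : ℝ≥0) ∈ closure (Ioi 0) := by rw [closure_Ioi]; exact self_mem_Ici
  have := ContinuousWithinAt.closure_le h0 continuousWithinAt_const
    hcont.continuousWithinAt (fun ε hε => key ε hε)
  simpa using this

end ComplexBellmanSum

section Multiplier

variable {n : ℕ}

/-- The Euclidean pairing on `ℝ^{n+1}`. -/
def pairing (q x : Rn1 n) : ℝ := (∑ k, q.1 k * x.1 k) + q.2 * x.2

/-- The character `x ↦ e^{2πi q·x}`. -/
def character (q x : Rn1 n) : ℂ := cexp ((2 * (π : ℂ) * I) * (pairing q x : ℂ))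

theorem IFT1_eq (A : Rn1 n → ℂ) (x : Rn1 n) : IFT1 A x = ∫ q, character q x * A q := rfl

theorem continuous_pairing : Continuous fun z : Rn1 n × Rn1 n => pairing z.1 z.2 := by
  unfold pairing
  fun_prop

theorem continuous_character : Continuous fun z : Rn1 n × Rn1 n => character z.1 z.2 := by
  unfold character
  exact Complex.continuous_exp.comp (continuous_const.mul
    (Complex.continuous_ofReal.comp continuous_pairing))

theorem pairing_add (q x y : Rn1 n) : pairing q (x + y) = pairing q x + pairing q y := by
  simp only [pairing, Prod.fst_add, Prod.snd_add, PiLp.add_apply, mul_add, Finset.sum_add_distrib]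
  ring

theorem pairing_neg (q x : Rn1 n) : pairing q (-x) = -pairing q x := by
  simp only [pairing, Prod.fst_neg, Prod.snd_neg, PiLp.neg_apply, mul_neg, Finset.sum_neg_distrib]
  ring

theorem pairing_smul (q x : Rn1 n) (h : ℝ) : pairing q (h • x) = h * pairing q x := by
  simp only [pairing, Prod.smul_fst, Prod.smul_snd, PiLp.smul_apply, smul_eq_mul, mul_add,
    Finset.mul_sum]
  congr 1
  · exact Finset.sum_congr rfl fun k _ => by ring
  · ring

theorem character_add (q x y : Rn1 n) : character q (x + y) = character q x * character q y := by
  rw [character, pairing_add, ofReal_add, mul_add, Complex.exp_add]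
  rfl

theorem character_eq (q x : Rn1 n) :
    character q x = Complex.cos (2 * π * pairing q x) + Complex.sin (2 * π * pairing q x) * I := by
  rw [character, ← Complex.exp_mul_I]
  congr 1
  ring

theorem norm_character (q x : Rn1 n) : ‖character q x‖ = 1 := by
  rw [character, show (2 * (π : ℂ) * I) * (pairing q x : ℂ) =
    ((2 * π * pairing q x : ℝ) : ℂ) * I by push_cast; ring]
  exact norm_exp_ofReal_mul_I _

theorem integrable_character_mul {A : Rn1 n → ℂ} (hA : Integrable A) (x : Rn1 n) :
    Integrable fun q => character q x * A q :=
  hA.bdd_mul (c := 1) (continuous_character.comp (by fun_prop : Continuous fun q : Rn1 n =>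
    (q, x))).aestronglyMeasurable (.of_forall fun q => (norm_character q x).le)

theorem norm_IFT1_le (A : Rn1 n → ℂ) (x : Rn1 n) : ‖IFT1 A x‖ ≤ ∫ q, ‖A q‖ := by
  rw [IFT1_eq]
  refine (norm_integral_le_integral_norm _).trans_eq ?_
  simp [norm_character]

theorem continuous_IFT1 {A : Rn1 n → ℂ} (hA : Integrable A) : Continuous (IFT1 A) := by
  refine continuous_of_dominated (F := fun x q => character q x * A q) (bound := fun q => ‖A q‖)
    (fun x => (integrable_character_mul hA x).aestronglyMeasurable)
    (fun x => .of_forall fun q => by simp [norm_character]) hA.norm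
    (.of_forall fun q => ?_)
  exact (continuous_character.comp (by fun_prop : Continuous fun x : Rn1 n => (q, x))).mul
    continuous_const

theorem bddMeasurable_IFT1 {A : Rn1 n → ℂ} (hA : Integrable A) : BddMeasurable (IFT1 A) :=
  ⟨(continuous_IFT1 hA).measurable, _, norm_IFT1_le A⟩

theorem IFT1_add {A B : Rn1 n → ℂ} (hA : Integrable A) (hB : Integrable B) (x : Rn1 n) :
    IFT1 (fun q => A q + B q) x = IFT1 A x + IFT1 B x := by
  simp only [IFT1_eq, mul_add]
  exact integral_add (integrable_character_mul hA x) (integrable_character_mul hB x)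

theorem IFT1_sub {A B : Rn1 n → ℂ} (hA : Integrable A) (hB : Integrable B) (x : Rn1 n) :
    IFT1 (fun q => A q - B q) x = IFT1 A x - IFT1 B x := by
  simp only [IFT1_eq, mul_sub]
  exact integral_sub (integrable_character_mul hA x) (integrable_character_mul hB x)

theorem IFT1_const_mul (c : ℂ) (A : Rn1 n → ℂ) (x : Rn1 n) :
    IFT1 (fun q => c * A q) x = c * IFT1 A x := by
  simp only [IFT1_eq, mul_left_comm _ c]
  exact integral_const_mul _ _

theorem IFT1_finsetSum {ι : Type*} (s : Finset ι) {A : ι → Rn1 n → ℂ}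
    (hA : ∀ i ∈ s, Integrable (A i)) (x : Rn1 n) :
    IFT1 (fun q => ∑ i ∈ s, A i q) x = ∑ i ∈ s, IFT1 (A i) x := by
  simp only [IFT1_eq, Finset.mul_sum]
  exact integral_finsetSum _ fun i hi => integrable_character_mul (hA i hi) x

theorem BddMeasurable.integrable_mul {σ A : Rn1 n → ℂ} (hσ : BddMeasurable σ)
    (hA : Integrable A) : Integrable fun q => σ q * A q := by
  obtain ⟨hm, M, hM⟩ := hσ
  exact hA.bdd_mul hm.aestronglyMeasurable (.of_forall hM)

/-- The half-angle attached to the step `e` of the random walk. -/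
def stepAngle (e q : Rn1 n) : ℝ := π * pairing q e

theorem continuous_stepAngle (e : Rn1 n) : Continuous (stepAngle e) :=
  continuous_const.mul (continuous_pairing.comp (by fun_prop : Continuous fun q : Rn1 n => (q, e)))

/-- The symbol of `exitAvg e 1`. -/
def exitSymbol (e q : Rn1 n) : ℝ := 1 - |Real.sin (stepAngle e q)|

theorem exitSymbol_nonneg (e q : Rn1 n) : 0 ≤ exitSymbol e q :=
  sub_nonneg.2 (Real.abs_sin_le_one _)

theorem exitSymbol_le_one (e q : Rn1 n) : exitSymbol e q ≤ 1 :=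
  sub_le_self _ (abs_nonneg _)

theorem integral_exitLaw_character (e q : Rn1 n) (k : ℕ) :
    ∫ y, character q y ∂exitLaw e k = ((exitSymbol e q ^ k : ℝ) : ℂ) := by
  have hcos : Real.cos (stepAngle e q) ^ 2 = 1 - Real.sin (stepAngle e q) ^ 2 := by
    linarith [Real.sin_sq_add_cos_sq (stepAngle e q)]
  have h := integral_exitLaw_char e (χ := character q) (s := Real.cos (stepAngle e q) ^ 2)
    (continuous_character.comp (by fun_prop : Continuous fun x : Rn1 n => (q, x))).measurable
    (fun x => (norm_character q x).le) (by simp [character, pairing]) (character_add q) ?_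
    (sq_nonneg _) (Real.cos_sq_le_one _) k
  · rw [h, hcos, sub_sub_cancel, Real.sqrt_sq_eq_abs, exitSymbol]
  · rw [character_eq, character_eq, pairing_neg, stepAngle, Real.cos_sq]
    push_cast
    rw [mul_neg, Complex.cos_neg, Complex.sin_neg]
    ring_nf

theorem exitAvg_IFT1 (e : Rn1 n) (k : ℕ) {A : Rn1 n → ℂ} (hA : Integrable A) (x : Rn1 n) :
    exitAvg e k (IFT1 A) x = IFT1 (fun q => ((exitSymbol e q ^ k : ℝ) : ℂ) * A q) x := by
  simp only [exitAvg, IFT1_eq, character_add]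
  have hi : Integrable (Function.uncurry fun (y q : Rn1 n) => character q x * character q y * A q)
      ((exitLaw e k).prod volume) := by
    refine Integrable.bdd_mul (c := 1) (hA.comp_snd _) ?_ (.of_forall fun z => ?_)
    · exact (Continuous.mul (continuous_character.comp (by fun_prop :
        Continuous fun z : Rn1 n × Rn1 n => (z.2, x))) (continuous_character.comp (by fun_prop :
        Continuous fun z : Rn1 n × Rn1 n => (z.2, z.1)))).aestronglyMeasurable
    · simp [norm_character]
  rw [integral_integral_swap hi]
  refine integral_congr_ae (.of_forall fun q => ?_)
  simp only
  rw [integral_mul_const, integral_const_mul, integral_exitLaw_character]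
  ring

theorem symDiffStep_IFT1 (e : Rn1 n) {A : Rn1 n → ℂ} (hA : Integrable A) (x : Rn1 n) :
    symDiffStep e (IFT1 A) x =
      IFT1 (fun q => (2 * I * (Real.sin (2 * stepAngle e q) : ℂ)) * A q) x := by
  simp only [symDiffStep, IFT1_eq]
  rw [← integral_sub (integrable_character_mul hA _) (integrable_character_mul hA _)]
  refine integral_congr_ae (.of_forall fun q => ?_)
  simp only
  rw [character_add, character_add, character_eq q e, character_eq q (-e), pairing_neg, stepAngle]
  push_cast
  rw [mul_neg, Complex.cos_neg, Complex.sin_neg, mul_assoc (2 : ℂ)]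
  ring

end Multiplier

section LpMultiplier

variable {n : ℕ} {p : ℝ}

/-- `σ` is a bounded symbol whose Fourier multiplier operator has norm at most `K` on the
functions in `Lᵖ` with integrable Fourier transform. -/
def IsLpMultiplier (p : ℝ) (K : ℝ≥0) (σ : Rn1 n → ℂ) : Prop :=
  BddMeasurable σ ∧ ∀ A : Rn1 n → ℂ, Integrable A → eLpNorm (IFT1 A) (ENNReal.ofReal p) volume ≠ ∞ →
    eLpNorm (IFT1 fun q => σ q * A q) (ENNReal.ofReal p) volume ≤
      K * eLpNorm (IFT1 A) (ENNReal.ofReal p) volume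

theorem IsLpMultiplier.mono {K K' : ℝ≥0} {σ : Rn1 n → ℂ} (h : IsLpMultiplier p K σ)
    (hK : K ≤ K') : IsLpMultiplier p K' σ :=
  ⟨h.1, fun A hA hA' => (h.2 A hA hA').trans (by gcongr)⟩

theorem IsLpMultiplier.mul {K K' : ℝ≥0} {σ σ' : Rn1 n → ℂ} (h : IsLpMultiplier p K σ)
    (h' : IsLpMultiplier p K' σ') : IsLpMultiplier p (K * K') fun q => σ q * σ' q := by
  obtain ⟨M, hM⟩ := h.1.2
  obtain ⟨M', hM'⟩ := h'.1.2
  refine ⟨⟨h.1.1.mul h'.1.1, M * M', fun q => ?_⟩, fun A hA hA' => ?_⟩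
  · rw [norm_mul]
    exact mul_le_mul (hM q) (hM' q) (norm_nonneg _) ((norm_nonneg _).trans (hM q))
  · have h1 := h'.2 A hA hA'
    have h2 := h.2 _ (h'.1.integrable_mul hA)
      (ne_top_of_le_ne_top (ENNReal.mul_ne_top ENNReal.coe_ne_top hA') h1)
    simp only [mul_assoc]
    refine h2.trans ?_
    rw [ENNReal.coe_mul, mul_assoc]
    gcongr

theorem IsLpMultiplier.const_mul {K : ℝ≥0} {σ : Rn1 n → ℂ} (h : IsLpMultiplier p K σ) (c : ℂ) :
    IsLpMultiplier p (‖c‖₊ * K) fun q => c * σ q := by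
  refine ⟨h.1.const_mul c, fun A hA hA' => ?_⟩
  have : (IFT1 fun q => c * σ q * A q) = c • IFT1 fun q => σ q * A q := by
    ext x
    simp only [mul_assoc, IFT1_const_mul, Pi.smul_apply, smul_eq_mul]
  rw [this, eLpNorm_const_smul, ENNReal.coe_mul, mul_assoc]
  gcongr
  · exact le_rfl
  · exact h.2 A hA hA'

theorem IsLpMultiplier.of_tendsto {K : ℝ≥0} {M : ℝ} {σ : ℕ → Rn1 n → ℂ} {σ' : Rn1 n → ℂ}
    (h : ∀ j, IsLpMultiplier p K (σ j)) (hM : ∀ j q, ‖σ j q‖ ≤ M)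
    (hlim : ∀ q, Tendsto (fun j => σ j q) atTop (𝓝 (σ' q))) : IsLpMultiplier p K σ' := by
  refine ⟨⟨measurable_of_tendsto_metrizable (fun j => (h j).1.1) (tendsto_pi_nhds.2 hlim), M,
    fun q => le_of_tendsto (hlim q).norm (.of_forall fun j => hM j q)⟩, fun A hA hA' => ?_⟩
  refine Lp.eLpNorm_le_of_ae_tendsto (u := atTop) (f := fun j => IFT1 fun q => σ j q * A q)
    (.of_forall fun j => (h j).2 A hA hA')
    (fun j => (continuous_IFT1 ((h j).1.integrable_mul hA)).aestronglyMeasurable)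
    (.of_forall fun x => ?_)
  simp only [IFT1_eq]
  refine tendsto_integral_of_dominated_convergence (fun q => M * ‖A q‖)
    (fun j => (integrable_character_mul ((h j).1.integrable_mul hA) x).aestronglyMeasurable)
    (hA.norm.const_mul M) (fun j => .of_forall fun q => ?_) (.of_forall fun q => ?_)
  · rw [norm_mul, norm_character, one_mul, norm_mul]
    gcongr
    exact hM j q
  · exact ((hlim q).mul_const _).const_mul _

/-- The symbol of the multiplier built from the random walk with step `e` and coefficients `M`. -/
def walkSymbol (e : Rn1 n) (M : ℕ → ℂ) (N : ℕ) (q : Rn1 n) : ℂ :=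
  ∑ m ∈ Finset.range N, ((m + 1) * M m) * (((exitSymbol e q ^ (m + 2) : ℝ) : ℂ) *
    (2 * I * (Real.sin (2 * stepAngle e q) : ℂ) * (exitSymbol e q ^ m : ℝ)) -
    ((exitSymbol e q ^ m : ℝ) : ℂ) *
    (2 * I * (Real.sin (2 * stepAngle e q) : ℂ) * (exitSymbol e q ^ m : ℝ)))

theorem continuous_exitSymbol (e : Rn1 n) : Continuous (exitSymbol e) :=
  continuous_const.sub (Real.continuous_sin.comp (continuous_stepAngle e)).abs

theorem bddMeasurable_exitSymbol_pow (e : Rn1 n) (m : ℕ) :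
    BddMeasurable fun q => ((exitSymbol e q ^ m : ℝ) : ℂ) := by
  refine ⟨(Complex.continuous_ofReal.comp ((continuous_exitSymbol e).pow m)).measurable, 1,
    fun q => ?_⟩
  rw [Complex.norm_real, Real.norm_of_nonneg (pow_nonneg (exitSymbol_nonneg e q) m)]
  exact pow_le_one₀ (exitSymbol_nonneg e q) (exitSymbol_le_one e q)

theorem bddMeasurable_sin (e : Rn1 n) :
    BddMeasurable fun q => 2 * I * (Real.sin (2 * stepAngle e q) : ℂ) := by
  refine ⟨((Complex.continuous_ofReal.comp (Real.continuous_sin.comp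
    (continuous_const.mul (continuous_stepAngle e)))).const_mul (2 * I)).measurable, 2,
    fun q => ?_⟩
  rw [norm_mul, Complex.norm_real, norm_mul, Complex.norm_I, Complex.norm_ofNat, mul_one]
  exact mul_le_of_le_one_right zero_le_two (Real.abs_sin_le_one _)

theorem BddMeasurable.mul {σ σ' : Rn1 n → ℂ} (h : BddMeasurable σ) (h' : BddMeasurable σ') :
    BddMeasurable fun q => σ q * σ' q := by
  obtain ⟨M, hM⟩ := h.2
  obtain ⟨M', hM'⟩ := h'.2
  refine ⟨h.1.mul h'.1, M * M', fun q => ?_⟩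
  rw [norm_mul]
  exact mul_le_mul (hM q) (hM' q) (norm_nonneg _) ((norm_nonneg _).trans (hM q))

theorem BddMeasurable.finsetSum {ι : Type*} (s : Finset ι) {σ : ι → Rn1 n → ℂ}
    (h : ∀ i, BddMeasurable (σ i)) : BddMeasurable fun q => ∑ i ∈ s, σ i q := by
  choose M hM using fun i => (h i).2
  exact ⟨Finset.measurable_sum _ fun i _ => (h i).1, ∑ i ∈ s, M i, fun q =>
    (norm_sum_le _ _).trans (Finset.sum_le_sum fun i _ => hM i q)⟩

theorem BddMeasurable.sub {σ σ' : Rn1 n → ℂ} (h : BddMeasurable σ) (h' : BddMeasurable σ') :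
    BddMeasurable fun q => σ q - σ' q := by
  simpa [sub_eq_add_neg] using h.add (h'.const_mul (-1))

instance : (volume : Measure (Rn1 n)).IsAddRightInvariant := by
  rw [Measure.volume_eq_prod]
  infer_instance

theorem exists_isLpMultiplier_walkSymbol (hp : 1 < p) :
    ∃ K : ℝ≥0, ∀ (e : Rn1 n) (M : ℕ → ℂ) (C : ℝ≥0), (∀ m, ‖M m‖₊ ≤ C) → ∀ N,
      IsLpMultiplier p (C * K) (walkSymbol e M N) := by
  have hpq := Real.HolderConjugate.conjExponent hp
  obtain ⟨K, hK⟩ := exists_sum_walkPairing_le (μ := (volume : Measure (Rn1 n))) hpq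
  refine ⟨K, fun e M C hC N => ?_⟩
  have hz := fun m => bddMeasurable_exitSymbol_pow e m
  have hs := bddMeasurable_sin e
  refine ⟨BddMeasurable.finsetSum _ fun m =>
    (((hz (m + 2)).mul (hs.mul (hz m))).sub ((hz m).mul (hs.mul (hz m)))).const_mul _,
    fun A hA hA' => ?_⟩
  set G : ℕ → Rn1 n → ℂ := fun m => symDiffStep e (exitAvg e m (IFT1 A)) with hG
  have hA1 : ∀ m, Integrable fun q => ((exitSymbol e q ^ m : ℝ) : ℂ) * A q := fun m =>
    (hz m).integrable_mul hA
  have hA2 : ∀ m, Integrable fun q => 2 * I * (Real.sin (2 * stepAngle e q) : ℂ) *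
      (((exitSymbol e q ^ m : ℝ) : ℂ) * A q) := fun m => hs.integrable_mul (hA1 m)
  have hGeq : ∀ m, G m = IFT1 fun q => 2 * I * (Real.sin (2 * stepAngle e q) : ℂ) *
      (((exitSymbol e q ^ m : ℝ) : ℂ) * A q) := fun m => by
    have : exitAvg e m (IFT1 A) = IFT1 fun q => ((exitSymbol e q ^ m : ℝ) : ℂ) * A q :=
      funext (exitAvg_IFT1 e m hA)
    ext x
    simp only [hG, this]
    exact symDiffStep_IFT1 e (hA1 m) x
  have hA3 : ∀ k m, Integrable fun q => ((exitSymbol e q ^ k : ℝ) : ℂ) *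
      (2 * I * (Real.sin (2 * stepAngle e q) : ℂ) * (((exitSymbol e q ^ m : ℝ) : ℂ) * A q)) :=
    fun k m => (hz k).integrable_mul (hA2 m)
  have hT : ∀ x, IFT1 (fun q => walkSymbol e M N q * A q) x = ∑ m ∈ Finset.range N,
      ((m + 1) * M m) * (exitAvg e (m + 2) (G m) x - exitAvg e m (G m) x) := fun x => by
    simp only [hGeq, exitAvg_IFT1 e _ (hA2 _), ← IFT1_sub (hA3 _ _) (hA3 _ _), ← IFT1_const_mul]
    refine Eq.trans ?_ (IFT1_finsetSum (Finset.range N) (fun m _ =>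
      ((hA3 (m + 2) m).sub (hA3 m m)).const_mul ((m + 1) * M m)) x)
    congr 1
    ext q
    rw [walkSymbol, Finset.sum_mul]
    exact Finset.sum_congr rfl fun m _ => by simp only [Pi.sub_apply]; ring
  have hGb : ∀ m, BddMeasurable (G m) := fun m => by
    rw [hGeq m]; exact bddMeasurable_IFT1 (hA2 m)
  have hF := bddMeasurable_IFT1 hA
  have hFp : MemLp (IFT1 A) (ENNReal.ofReal p) volume :=
    ⟨hF.1.aestronglyMeasurable, lt_top_iff_ne_top.2 hA'⟩
  refine eLpNorm_le_of_forall_integral_mul_le hpq (measurableSet_spanningSets volume)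
    (measure_spanningSets_lt_top volume) (monotone_spanningSets volume)
    (iUnion_spanningSets volume) ?_ ?_
  · have : (IFT1 fun q => walkSymbol e M N q * A q) = fun x => ∑ m ∈ Finset.range N,
      ((m + 1) * M m) * (exitAvg e (m + 2) (G m) x - exitAvg e m (G m) x) := funext hT
    rw [this]
    exact Finset.measurable_sum _ fun m _ =>
      ((measurable_exitAvg (hGb m).1).sub (measurable_exitAvg (hGb m).1)).const_mul _
  · rintro j g hg hgS ⟨M', hM'⟩
    have hgb : BddMeasurable g := ⟨hg, M', hM'⟩
    have hgL : ∀ r, MemLp g r volume := memLp_of_bound_of_support hg hgS hM'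
      (measurableSet_spanningSets volume j) (measure_spanningSets_lt_top volume j)
    have hg1 : Integrable g := memLp_one_iff_integrable.1 (hgL 1)
    have hbi : ∀ {u w : Rn1 n → ℂ}, BddMeasurable u → Integrable w →
        Integrable fun x => u x * w x := fun hu hw => hu.integrable_mul hw
    have hQg : ∀ k, Integrable (exitAvg e k g) := fun k => by
      refine (integrable_prod_iff' (μ := volume) (ν := exitLaw e k)
        (f := fun z : Rn1 n × Rn1 n => g (z.1 + z.2)) ?_).2 ⟨?_, ?_⟩ |>.integral_prod_left
      · exact (hg.comp measurable_add).aestronglyMeasurable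
      · exact .of_forall fun y => hg1.comp_add_right y
      · have : ∀ y, ∫ x, ‖g (x + y)‖ = ∫ x, ‖g x‖ := fun y =>
          integral_add_right_eq_self (fun x => ‖g x‖) y
        simp only [this]
        exact integrable_const _
    have hdual : ∫ x, IFT1 (fun q => walkSymbol e M N q * A q) x * g x =
        ∑ m ∈ Finset.range N, ((m + 1) * M m) *
          ∫ x, G m x * (exitAvg e (m + 2) g x - exitAvg e m g x) := by
      simp only [hT, Finset.sum_mul]
      rw [integral_finsetSum]
      · refine Finset.sum_congr rfl fun m _ => ?_
        simp only [mul_assoc, sub_mul, mul_sub]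
        rw [integral_sub (hbi (hGb m) (hQg _)) (hbi (hGb m) (hQg _)),
          ← integral_exitAvg_mul (hGb m) hg1 hg, ← integral_exitAvg_mul (hGb m) hg1 hg,
          ← integral_sub (hbi (hGb m).exitAvg hg1) (hbi (hGb m).exitAvg hg1),
          ← integral_const_mul, ← integral_const_mul]
        simp only [mul_sub]
      · intro m _
        exact hbi (((hGb m).exitAvg.sub (hGb m).exitAvg).const_mul _) hg1
    rw [hdual]
    calc _ ≤ ∑ m ∈ Finset.range N, (C : ℝ≥0∞) *
          ((m + 1 : ℝ≥0∞) * walkPairing volume e m (IFT1 A) g) := by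
          refine (enorm_sum_le _ _).trans (Finset.sum_le_sum fun m _ => ?_)
          have h1 : ‖((m : ℂ) + 1)‖ₑ = (m + 1 : ℝ≥0∞) := by
            rw [← Nat.cast_succ, ← ofReal_norm, Complex.norm_natCast, ENNReal.ofReal_natCast]
            push_cast
            rfl
          have h2 : ‖∫ x, G m x * (exitAvg e (m + 2) g x - exitAvg e m g x)‖ₑ ≤
              walkPairing volume e m (IFT1 A) g := by
            refine (enorm_integral_le_lintegral_enorm _).trans_eq ?_
            simp only [enorm_mul]
            rfl
          have h3 : ‖M m‖ₑ ≤ (C : ℝ≥0∞) := ENNReal.coe_le_coe.2 (hC m)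
          rw [enorm_mul, enorm_mul, h1, mul_comm (m + 1 : ℝ≥0∞), mul_assoc]
          gcongr
      _ = C * ∑ m ∈ Finset.range N, (m + 1 : ℝ≥0∞) * walkPairing volume e m (IFT1 A) g := by
          rw [Finset.mul_sum]
      _ ≤ _ := by
          rw [ENNReal.coe_mul, mul_assoc, mul_assoc]
          gcongr
          exact hK e _ _ hF hgb hFp (hgL _) N

end LpMultiplier

section Binomial

/-- The binomial coefficients of `(1 - w)^{-(2 + iα)}`. -/
def binomCoeff (α : ℝ) (m : ℕ) : ℂ := Ring.multichoose (2 + α * I) m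

theorem binomCoeff_succ (α : ℝ) (m : ℕ) :
    (m + 1) * binomCoeff α (m + 1) = (2 + α * I + m) * binomCoeff α m := by
  have h := fun k => Ring.factorial_nsmul_multichoose_eq_ascPochhammer (2 + α * I) k
  simp only [Polynomial.ascPochhammer_smeval_eq_eval, nsmul_eq_mul] at h
  have h1 := h (m + 1)
  rw [ascPochhammer_succ_eval, ← h m, Nat.factorial_succ] at h1
  have h0 : (m.factorial : ℂ) ≠ 0 := Nat.cast_ne_zero.2 m.factorial_ne_zero
  refine mul_left_cancel₀ h0 ?_
  rw [binomCoeff, binomCoeff]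
  push_cast at h1
  linear_combination h1

theorem norm_binomCoeff_le (α : ℝ) (m : ℕ) :
    ‖binomCoeff α m‖ ≤ (m + 1) * Real.exp (α ^ 2 / 2 * (1 - 1 / (m + 1))) := by
  induction m with
  | zero => simp [binomCoeff]
  | succ m ih =>
    have hm : (0 : ℝ) < m + 1 := by positivity
    have h1 : ‖(2 + α * I + m : ℂ)‖ ≤ (m + 2) * Real.exp (α ^ 2 / 2 * (1 / (m + 2) ^ 2)) := by
      have h2 : ‖(2 + α * I + m : ℂ)‖ ≤ (m + 2) * (1 + α ^ 2 / 2 * (1 / (m + 2) ^ 2)) := by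
        rw [← abs_of_nonneg (norm_nonneg _)]
        refine abs_le_of_sq_le_sq ?_ (by positivity)
        rw [← Complex.normSq_eq_norm_sq, Complex.normSq_apply]
        simp only [add_re, re_ofNat, mul_re, ofReal_re, I_re, mul_zero, ofReal_im, I_im, sub_self,
          add_zero, natCast_re, add_im, im_ofNat, mul_im, mul_one, natCast_im, zero_add, mul_zero]
        have : ((m : ℝ) + 2) * (1 + α ^ 2 / 2 * (1 / (m + 2) ^ 2)) = m + 2 + α ^ 2 / (2 * (m + 2)) := by
          field_simp
        rw [this, add_sq]
        have h3 : 2 * ((m : ℝ) + 2) * (α ^ 2 / (2 * (m + 2))) = α ^ 2 := by field_simp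
        nlinarith [sq_nonneg (α ^ 2 / (2 * ((m : ℝ) + 2)))]
      refine h2.trans ?_
      gcongr
      rw [add_comm]
      exact Real.add_one_le_exp _
    have h4 : (m + 1) * ‖binomCoeff α (m + 1)‖ = ‖(2 + α * I + m : ℂ)‖ * ‖binomCoeff α m‖ := by
      rw [← norm_mul, ← binomCoeff_succ, norm_mul, ← Nat.cast_succ, ← Nat.cast_succ,
        Complex.norm_natCast]
    have h5 : (m + 1) * ‖binomCoeff α (m + 1)‖ ≤ (m + 1) * ((m + 2) *
        Real.exp (α ^ 2 / 2 * (1 / (m + 2) ^ 2) + α ^ 2 / 2 * (1 - 1 / (m + 1)))) := by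
      rw [h4, Real.exp_add]
      calc _ ≤ ((m + 2) * Real.exp (α ^ 2 / 2 * (1 / (m + 2) ^ 2))) *
            ((m + 1) * Real.exp (α ^ 2 / 2 * (1 - 1 / (m + 1)))) := by gcongr
        _ = _ := by ring
    refine (le_of_mul_le_mul_left h5 hm).trans ?_
    push_cast
    rw [add_assoc (m : ℝ) 1 1, one_add_one_eq_two, ← mul_add]
    gcongr
    have : 1 / ((m : ℝ) + 1) - 1 / (m + 2) = 1 / ((m + 1) * (m + 2)) := by field_simp; ring
    have h6 : 1 / ((m : ℝ) + 2) ^ 2 ≤ 1 / ((m + 1) * (m + 2)) := by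
      gcongr
      nlinarith
    linarith

theorem hasSum_binomCoeff (α : ℝ) {w : ℝ} (hw : 0 ≤ w) (hw1 : w < 1) :
    HasSum (fun m => binomCoeff α m * (w : ℂ) ^ m) (((1 - w : ℝ) : ℂ) ^ (-(2 + α * I))) := by
  have h := (Complex.one_div_one_sub_cpow_hasFPowerSeriesOnBall_zero (2 + α * I)).hasSum
    (y := (w : ℂ)) (by
      rw [← ENNReal.ofReal_one, Metric.eball_ofReal]
      simpa [abs_of_nonneg hw] using hw1)
  rw [zero_add] at h
  have h1 : ((1 - w : ℝ) : ℂ) ^ (-(2 + α * I)) = 1 / (1 - (w : ℂ)) ^ (2 + α * I) := by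
    rw [cpow_neg, one_div]
    push_cast
    rfl
  rw [h1]
  refine h.congr_fun fun m => ?_
  rw [FormalMultilinearSeries.ofScalars_apply_eq, binomCoeff, Ring.multichoose_eq, smul_eq_mul]

theorem sum_succ_mul_pow_le {w : ℝ} (hw : 0 ≤ w) (hw1 : w < 1) (N : ℕ) :
    ∑ m ∈ Finset.range N, (m + 1 : ℝ) * w ^ m ≤ 1 / (1 - w) ^ 2 := by
  have h : ∀ N : ℕ, (1 - w) ^ 2 * ∑ m ∈ Finset.range N, (m + 1 : ℝ) * w ^ m =
      1 - (N + 1) * w ^ N + N * w ^ (N + 1) := fun N => by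
    induction N with
    | zero => simp
    | succ N ih => rw [Finset.sum_range_succ, mul_add, ih]; push_cast; ring
  have h0 : 0 < 1 - w := sub_pos.2 hw1
  rw [le_div_iff₀ (by positivity), mul_comm, h]
  have h1 : w ^ (N + 1) ≤ w ^ N := pow_le_pow_of_le_one hw hw1.le (Nat.le_succ N)
  nlinarith [pow_nonneg hw N, (Nat.cast_nonneg N : (0:ℝ) ≤ N)]

end Binomial

section SignPower

variable {n : ℕ} {p : ℝ}

/-- The gap between `1` and the squared symbol of the exit average. -/
def exitGap (e q : Rn1 n) : ℝ := 1 - exitSymbol e q ^ 2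

theorem exitGap_eq (e q : Rn1 n) :
    exitGap e q = |Real.sin (stepAngle e q)| * (2 - |Real.sin (stepAngle e q)|) := by
  rw [exitGap, exitSymbol]
  ring

theorem abs_sin_le_exitGap (e q : Rn1 n) : |Real.sin (stepAngle e q)| ≤ exitGap e q := by
  rw [exitGap_eq]
  nlinarith [abs_nonneg (Real.sin (stepAngle e q)), Real.abs_sin_le_one (stepAngle e q)]

theorem walkSymbol_eq (e : Rn1 n) (α : ℝ) (N : ℕ) (q : Rn1 n) :
    walkSymbol e (fun m => binomCoeff α m / (m + 1)) N q =
      -(2 * I * (Real.sin (2 * stepAngle e q) : ℂ)) * exitGap e q *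
        ∑ m ∈ Finset.range N, binomCoeff α m * ((exitSymbol e q ^ 2 : ℝ) : ℂ) ^ m := by
  rw [walkSymbol, Finset.mul_sum]
  refine Finset.sum_congr rfl fun m _ => ?_
  have : (m + 1 : ℂ) ≠ 0 := Nat.cast_add_one_ne_zero m
  rw [mul_div_cancel₀ _ this, exitGap]
  push_cast
  ring

theorem norm_walkSymbol_le (e : Rn1 n) (α : ℝ) (N : ℕ) (q : Rn1 n) :
    ‖walkSymbol e (fun m => binomCoeff α m / (m + 1)) N q‖ ≤ 4 * Real.exp (α ^ 2 / 2) := by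
  rw [walkSymbol_eq]
  set s := Real.sin (stepAngle e q) with hs
  have h2 : |Real.sin (2 * stepAngle e q)| ≤ 2 * |s| := by
    rw [Real.sin_two_mul, abs_mul, abs_mul, abs_two, ← hs]
    exact mul_le_of_le_one_right (by positivity) (Real.abs_cos_le_one _)
  have hgap := abs_sin_le_exitGap e q
  rw [← hs] at hgap
  rcases (abs_nonneg s).eq_or_lt with h0 | h0
  · have : Real.sin (2 * stepAngle e q) = 0 := by
      rw [Real.sin_two_mul, ← hs, abs_eq_zero.1 h0.symm]; ring
    simp [this]
    positivity
  have hg : 0 < exitGap e q := h0.trans_le hgap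
  set w := exitSymbol e q ^ 2 with hw
  have hw0 : 0 ≤ w := sq_nonneg _
  have hgw : exitGap e q = 1 - w := rfl
  have h3 : ‖∑ m ∈ Finset.range N, binomCoeff α m * (w : ℂ) ^ m‖ ≤
      Real.exp (α ^ 2 / 2) * (1 / exitGap e q ^ 2) := by
    refine (norm_sum_le _ _).trans ?_
    refine (Finset.sum_le_sum fun m _ => ?_).trans (le_trans (Finset.mul_sum _ _ _).ge
      (mul_le_mul_of_nonneg_left (sum_succ_mul_pow_le hw0 (by linarith) N) (Real.exp_pos _).le))
    rw [norm_mul, norm_pow, Complex.norm_real, Real.norm_of_nonneg hw0, ← mul_assoc]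
    gcongr
    refine (norm_binomCoeff_le α m).trans ?_
    rw [mul_comm]
    gcongr
    have : (0 : ℝ) ≤ 1 / (m + 1) := by positivity
    exact mul_le_of_le_one_right (by positivity) (by linarith)
  rw [norm_mul, norm_mul, norm_neg, norm_mul, norm_mul, Complex.norm_ofNat, Complex.norm_I,
    Complex.norm_real, Complex.norm_real, Real.norm_of_nonneg hg.le, Real.norm_eq_abs, mul_one]
  calc _ ≤ 2 * (2 * exitGap e q) * exitGap e q * (Real.exp (α ^ 2 / 2) * (1 / exitGap e q ^ 2)) := by
        gcongr
        linarith
    _ = _ := by field_simp; norm_num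

/-- The pointwise limit of `walkSymbol` for binomial coefficients. -/
def exitPower (e : Rn1 n) (α : ℝ) (q : Rn1 n) : ℂ :=
  -(2 * I * (Real.sin (2 * stepAngle e q) : ℂ)) * exitGap e q *
    (exitGap e q : ℂ) ^ (-(2 + α * I))

theorem isLpMultiplier_exitPower {K : ℝ≥0}
    (hK : ∀ (e : Rn1 n) (M : ℕ → ℂ) (C : ℝ≥0), (∀ m, ‖M m‖₊ ≤ C) → ∀ N,
      IsLpMultiplier p (C * K) (walkSymbol e M N)) (e : Rn1 n) (α : ℝ) :
    IsLpMultiplier p ((Real.exp (α ^ 2 / 2)).toNNReal * K) (exitPower e α) ∧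
      ∀ q, ‖exitPower e α q‖ ≤ 4 * Real.exp (α ^ 2 / 2) := by
  have hlim : ∀ q, Tendsto (fun N => walkSymbol e (fun m => binomCoeff α m / (m + 1)) N q) atTop
      (𝓝 (exitPower e α q)) := fun q => by
    simp only [walkSymbol_eq]
    rcases (abs_nonneg (Real.sin (stepAngle e q))).eq_or_lt with h0 | h0
    · have : Real.sin (2 * stepAngle e q) = 0 := by
        rw [Real.sin_two_mul, abs_eq_zero.1 h0.symm]; ring
      simp [exitPower, this]
    · have hg : 0 < exitGap e q := h0.trans_le (abs_sin_le_exitGap e q)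
      exact (hasSum_binomCoeff α (sq_nonneg (exitSymbol e q))
        (sub_pos.1 hg)).tendsto_sum_nat.const_mul _
  refine ⟨IsLpMultiplier.of_tendsto (fun N => hK e _ _ (fun m => ?_) N)
    (fun N q => norm_walkSymbol_le e α N q) hlim,
    fun q => le_of_tendsto (hlim q).norm (.of_forall fun N => norm_walkSymbol_le e α N q)⟩
  have hm : (0 : ℝ) < m + 1 := by positivity
  rw [← NNReal.coe_le_coe, coe_nnnorm, Real.coe_toNNReal _ (Real.exp_pos _).le, norm_div,
    ← Nat.cast_succ, Complex.norm_natCast, Nat.cast_succ, div_le_iff₀ hm, mul_comm]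
  refine (norm_binomCoeff_le α m).trans ?_
  gcongr
  have : (0 : ℝ) ≤ 1 / (m + 1) := by positivity
  exact mul_le_of_le_one_right (by positivity) (by linarith)

theorem tendsto_sin_mul_div (c : ℝ) {h : ℕ → ℝ} (h0 : ∀ j, h j ≠ 0)
    (hh : Tendsto h atTop (𝓝 0)) :
    Tendsto (fun j => Real.sin (c * h j) / h j) atTop (𝓝 c) := by
  have h1 : HasDerivAt (fun t => Real.sin (c * t)) c 0 := by
    have := (Real.hasDerivAt_sin (c * 0)).comp 0 ((hasDerivAt_id (0:ℝ)).const_mul c)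
    simpa [Function.comp_def] using this
  have h2 := h1.tendsto_slope_zero
  have h3 := h2.comp (tendsto_nhdsWithin_iff.2 ⟨hh, .of_forall h0⟩)
  refine h3.congr fun j => ?_
  simp [div_eq_inv_mul]

/-- The imaginary powers of a linear form, twisted by its sign. -/
def signPow (e : Rn1 n) (α : ℝ) (q : Rn1 n) : ℂ :=
  ((pairing q e / |pairing q e| : ℝ) : ℂ) * ((|pairing q e| : ℝ) : ℂ) ^ (α * I)

theorem tendsto_exitPower (e : Rn1 n) (α : ℝ) {h : ℕ → ℝ} (h0 : ∀ j, 0 < h j)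
    (hh : Tendsto h atTop (𝓝 0)) (q : Rn1 n) :
    Tendsto (fun j => (I / 2 * ((2 * π * h j : ℝ) : ℂ) ^ (α * I)) * exitPower (h j • e) α q) atTop
      (𝓝 (signPow e (-α) q)) := by
  set x := pairing q e with hx
  have hθ : ∀ j, stepAngle (h j • e) q = (π * x) * h j := fun j => by
    rw [stepAngle, pairing_smul]; ring
  have hpi := Real.pi_pos
  rcases eq_or_ne x 0 with hx0 | hx0
  · have : ∀ j, exitPower (h j • e) α q = 0 := fun j => by
      simp [exitPower, hθ, hx0]
    simp [this, signPow, ← hx, hx0]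
  have hsin := tendsto_sin_mul_div (π * x) (fun j => (h0 j).ne') hh
  have hsin2 := tendsto_sin_mul_div (2 * (π * x)) (fun j => (h0 j).ne') hh
  have hs0 : Tendsto (fun j => |Real.sin ((π * x) * h j)|) atTop (𝓝 0) := by
    have := ((Real.continuous_sin.tendsto ((π * x) * 0)).comp (hh.const_mul (π * x))).abs
    simpa [Function.comp_def] using this
  set g : ℕ → ℝ := fun j => exitGap (h j • e) q / (2 * π * h j) with hg
  have hgap : Tendsto g atTop (𝓝 |x|) := by
    have := ((hsin.abs).mul (tendsto_const_nhds (x := (2 : ℝ)).sub hs0)).div_const (2 * π)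
    have h1 : |π * x| * (2 - 0) / (2 * π) = |x| := by
      rw [abs_mul, abs_of_pos hpi]; field_simp; ring
    rw [h1] at this
    refine this.congr fun j => ?_
    simp only [hg]
    rw [exitGap_eq, hθ, abs_div, abs_of_pos (h0 j)]
    field_simp
  have hx1 : (0 : ℝ) < |x| := abs_pos.2 hx0
  have hquot : Tendsto (fun j => (Real.sin (2 * (π * x) * h j) / h j) / (2 * π) / g j) atTop
      (𝓝 (x / |x|)) := by
    have := (hsin2.div_const (2 * π)).div hgap hx1.ne'
    have h1 : 2 * (π * x) / (2 * π) = x := by field_simp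
    rwa [h1] at this
  have hpow : Tendsto (fun j => (g j : ℂ) ^ (-(α * I))) atTop (𝓝 (((|x| : ℝ) : ℂ) ^ (-(α * I)))) :=
    ((continuousAt_cpow_const (b := -(α * I)) (ofReal_mem_slitPlane.2 hx1)).tendsto).comp
      ((Complex.continuous_ofReal.tendsto _).comp hgap)
  have hlim := ((Complex.continuous_ofReal.tendsto _).comp hquot).mul hpow
  have hval : signPow e (-α) q = ((x / |x| : ℝ) : ℂ) * ((|x| : ℝ) : ℂ) ^ (-(α * I)) := by
    rw [signPow, ← hx]
    push_cast
    rw [neg_mul]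
  rw [hval]
  refine hlim.congr' ?_
  filter_upwards [hgap.eventually_const_lt hx1] with j hj
  have hd : 0 < 2 * π * h j := by have := h0 j; positivity
  have hG : exitGap (h j • e) q = (2 * π * h j) * g j := by
    have := (h0 j).ne'
    simp only [hg]; field_simp
  have hgap0 : 0 < exitGap (h j • e) q := hG ▸ mul_pos hd hj
  have hdc : (((2 * π * h j : ℝ)) : ℂ) ≠ 0 := ofReal_ne_zero.2 hd.ne'
  have hGc : ((exitGap (h j • e) q : ℝ) : ℂ) ≠ 0 := ofReal_ne_zero.2 hgap0.ne'
  have hgc : ((g j : ℝ) : ℂ) ≠ 0 := ofReal_ne_zero.2 hj.ne'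
  have e1 : ((exitGap (h j • e) q : ℝ) : ℂ) ^ (-(2 + α * I)) =
      (((exitGap (h j • e) q : ℝ) : ℂ) ^ 2)⁻¹ *
        ((((2 * π * h j : ℝ)) : ℂ) ^ (-(α * I)) * (g j : ℂ) ^ (-(α * I))) := by
    rw [neg_add, cpow_add _ _ hGc, cpow_neg, cpow_ofNat]
    congr 1
    rw [hG, Complex.ofReal_mul]
    exact mul_cpow_ofReal_nonneg hd.le hj.le _
  have e2 : (((2 * π * h j : ℝ)) : ℂ) ^ (α * I) * (((2 * π * h j : ℝ)) : ℂ) ^ (-(α * I)) = 1 := by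
    rw [← cpow_add _ _ hdc, add_neg_cancel, cpow_zero]
  have e3 : Real.sin (2 * (π * x) * h j) / h j / (2 * π) / g j =
      Real.sin (2 * stepAngle (h j • e) q) / exitGap (h j • e) q := by
    rw [hG, hθ, ← mul_assoc 2 (π * x)]
    have := (h0 j).ne'
    field_simp
  simp only [Function.comp_apply]
  rw [e3, exitPower, e1]
  push_cast at e2 ⊢
  set P := (2 * (π : ℂ) * (h j : ℂ)) ^ (α * I)
  set Q := (2 * (π : ℂ) * (h j : ℂ)) ^ (-(α * I))
  set S := Complex.sin (2 * (stepAngle (h j • e) q : ℂ))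
  set G := ((exitGap (h j • e) q : ℝ) : ℂ)
  set R := (g j : ℂ) ^ (-(α * I))
  have : I / 2 * P * (-(2 * I * S) * G * ((G ^ 2)⁻¹ * (Q * R))) =
    -(I * I) * (P * Q) * (S / G * R) := by field_simp
  rw [this, e2, I_mul_I]
  ring

/-- Uniform multiplier bound for the signed imaginary powers. -/
theorem exists_isLpMultiplier_signPow (hp : 1 < p) :
    ∃ K : ℝ≥0, ∀ (e : Rn1 n) (α : ℝ),
      IsLpMultiplier p (K * (Real.exp (α ^ 2 / 2)).toNNReal) (signPow e α) := by
  obtain ⟨K, hK⟩ := exists_isLpMultiplier_walkSymbol (n := n) hp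
  refine ⟨K, fun e α => ?_⟩
  have hh : Tendsto (fun j : ℕ => 1 / ((j : ℝ) + 1)) atTop (𝓝 0) :=
    tendsto_one_div_add_atTop_nhds_zero_nat
  have h0 : ∀ j : ℕ, 0 < 1 / ((j : ℝ) + 1) := fun j => by positivity
  have hlim := tendsto_exitPower e (-α) h0 hh
  rw [neg_neg] at hlim
  have hc : ∀ j : ℕ, ‖I / 2 * ((2 * π * (1 / ((j : ℝ) + 1)) : ℝ) : ℂ) ^ (((-α : ℝ) : ℂ) * I)‖ =
      1 / 2 := fun j => by
    have hj : 0 < 2 * π * (1 / ((j : ℝ) + 1)) := by have := Real.pi_pos; positivity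
    rw [norm_mul, norm_cpow_eq_rpow_re_of_pos hj]
    simp
  have hP := fun j : ℕ => isLpMultiplier_exitPower hK ((1 / ((j : ℝ) + 1)) • e) (-α)
  rw [neg_sq] at hP
  refine IsLpMultiplier.of_tendsto (M := 1 / 2 * (4 * Real.exp (α ^ 2 / 2)))
    (fun j => ((hP j).1.const_mul _).mono ?_) (fun j q => ?_) hlim
  · have : ‖I / 2 * ((2 * π * (1 / ((j : ℝ) + 1)) : ℝ) : ℂ) ^ (((-α : ℝ) : ℂ) * I)‖₊ ≤ 1 := by
      rw [← NNReal.coe_le_coe, coe_nnnorm, hc j]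
      norm_num
    calc _ ≤ 1 * ((Real.exp (α ^ 2 / 2)).toNNReal * K) := by gcongr
      _ = _ := by rw [one_mul, mul_comm]
  · rw [norm_mul, hc]
    gcongr
    exact (hP j).2 q

end SignPower

section Mellin

/-- The weight whose Fourier transform is `mellinGauss`. -/
def mellinWeight (y : ℝ) : ℂ := cexp (-(y : ℂ) ^ 2 + 2 * I * y) / (1 + I * y)

/-- A function with `e^θ mellinGauss θ + e^{-θ} mellinGauss (-θ)` constant and Gaussian Fourier transform. -/
def mellinGauss (θ : ℝ) : ℂ := ∫ y : ℝ, cexp (I * y * θ) * mellinWeight y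

theorem one_le_norm_one_add_I_mul (y : ℝ) : 1 ≤ ‖(1 + I * y : ℂ)‖ := by
  have h := Complex.abs_re_le_norm (1 + I * y)
  simpa using h

theorem one_add_I_mul_ne_zero (y : ℝ) : (1 + I * y : ℂ) ≠ 0 :=
  norm_pos_iff.1 (one_pos.trans_le (one_le_norm_one_add_I_mul y))

theorem norm_mellinWeight_le (y : ℝ) : ‖mellinWeight y‖ ≤ Real.exp (-1 * y ^ 2) := by
  rw [mellinWeight, norm_div, Complex.norm_exp]
  refine (div_le_self (Real.exp_pos _).le (one_le_norm_one_add_I_mul y)).trans_eq ?_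
  congr 1
  rw [← ofReal_pow, add_re, neg_re, ofReal_re]
  simp

theorem continuous_mellinWeight : Continuous mellinWeight := by
  unfold mellinWeight
  exact Continuous.div (by fun_prop) (by fun_prop) one_add_I_mul_ne_zero

theorem norm_cexp_I_mul_mul (y θ : ℝ) : ‖cexp (I * y * θ)‖ = 1 := by
  rw [mul_assoc, mul_comm, ← ofReal_mul]
  exact norm_exp_ofReal_mul_I _

theorem norm_mellinGauss_le (θ : ℝ) : ‖mellinGauss θ‖ ≤ ∫ y : ℝ, Real.exp (-1 * y ^ 2) :=
  norm_integral_le_of_norm_le (integrable_exp_neg_mul_sq one_pos) (.of_forall fun y => by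
    rw [norm_mul, norm_cexp_I_mul_mul, one_mul]
    exact norm_mellinWeight_le y)

theorem integrable_mellinGauss (θ : ℝ) : Integrable fun y : ℝ => cexp (I * y * θ) * mellinWeight y := by
  refine (integrable_exp_neg_mul_sq one_pos).mono' (Continuous.aestronglyMeasurable
    (Continuous.mul (by fun_prop) continuous_mellinWeight)) (.of_forall fun y => ?_)
  rw [norm_mul, norm_cexp_I_mul_mul, one_mul]
  exact norm_mellinWeight_le y

theorem hasDerivAt_mellinGauss (θ : ℝ) :
    Integrable (fun y : ℝ => I * y * (cexp (I * y * θ) * mellinWeight y)) ∧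
    HasDerivAt mellinGauss (∫ y : ℝ, I * y * (cexp (I * y * θ) * mellinWeight y)) θ := by
  refine hasDerivAt_integral_of_dominated_loc_of_deriv_le (s := univ)
    (F' := fun (θ y : ℝ) => I * y * (cexp (I * y * θ) * mellinWeight y))
    (bound := fun y : ℝ => ‖y * Real.exp (-1 * y ^ 2)‖) univ_mem
    (.of_forall fun θ => (integrable_mellinGauss θ).aestronglyMeasurable) (integrable_mellinGauss θ) ?_
    (.of_forall fun y θ _ => ?_) (integrable_mul_exp_neg_mul_sq one_pos).norm
    (.of_forall fun y θ _ => ?_)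
  · exact (Continuous.mul (by fun_prop) (Continuous.mul (by fun_prop)
      continuous_mellinWeight)).aestronglyMeasurable
  · rw [norm_mul, norm_mul, norm_mul, norm_mul, Complex.norm_I, norm_cexp_I_mul_mul, one_mul,
      one_mul, Complex.norm_real, Real.norm_of_nonneg (Real.exp_pos _).le]
    gcongr
    exact norm_mellinWeight_le y
  · have h : HasDerivAt (fun t : ℝ => cexp (I * y * t)) (cexp (I * y * θ) * (I * y)) θ := by
      have := ((hasDerivAt_id (θ : ℂ)).const_mul (I * y)).cexp.comp_ofReal
      simpa using this
    refine (h.mul_const (mellinWeight y)).congr_deriv ?_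
    ring

theorem hasDerivAt_exp_mul_mellinGauss (θ : ℝ) :
    HasDerivAt (fun t : ℝ => (Real.exp t : ℂ) * mellinGauss t)
      ((Real.sqrt π * Real.exp (-θ ^ 2 / 4 - 1) : ℝ) : ℂ) θ := by
  obtain ⟨hi, hd⟩ := hasDerivAt_mellinGauss θ
  have h := (Real.hasDerivAt_exp θ).ofReal_comp.mul hd
  refine h.congr_deriv ?_
  simp only [mellinGauss]
  rw [← mul_add, ← integral_add (integrable_mellinGauss θ) hi]
  have h1 : ∀ y : ℝ, cexp (I * y * θ) * mellinWeight y +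
      I * y * (cexp (I * y * θ) * mellinWeight y) =
      cexp (I * (θ + 2 : ℝ) * y) * cexp (-1 * y ^ 2) := fun y => by
    have := one_add_I_mul_ne_zero y
    have h2 : cexp (I * (θ + 2 : ℝ) * y) * cexp (-1 * y ^ 2) =
        cexp (I * y * θ) * cexp (-(y : ℂ) ^ 2 + 2 * I * y) := by
      rw [← Complex.exp_add, ← Complex.exp_add]
      congr 1
      push_cast
      ring
    rw [h2, mellinWeight]
    field_simp
  simp only [h1]
  rw [fourierIntegral_gaussian (by simp)]
  have h3 : ((π : ℂ) / 1) ^ (1 / 2 : ℂ) = (Real.sqrt π : ℝ) := by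
    rw [div_one, Real.sqrt_eq_rpow, Complex.ofReal_cpow Real.pi_pos.le]
    norm_num
  rw [h3]
  have h4 : cexp (-((θ + 2 : ℝ) : ℂ) ^ 2 / (4 * 1)) = (Real.exp (-(θ + 2) ^ 2 / 4) : ℝ) := by
    push_cast
    rw [mul_one]
  rw [h4, ← ofReal_mul, ← ofReal_mul]
  congr 1
  rw [mul_left_comm, ← Real.exp_add]
  congr 2
  ring

theorem exists_exp_mul_mellinGauss_add : ∃ S : ℂ, S ≠ 0 ∧ ∀ θ : ℝ,
    (Real.exp θ : ℂ) * mellinGauss θ + (Real.exp (-θ) : ℂ) * mellinGauss (-θ) = S := by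
  set F : ℝ → ℂ := fun t => (Real.exp t : ℂ) * mellinGauss t with hF
  have hd := hasDerivAt_exp_mul_mellinGauss
  have hconst : ∀ θ, F θ + F (-θ) = F 0 + F (-0) := fun θ => by
    have h : ∀ t, HasDerivAt (fun t => F t + F (-t)) 0 t := fun t => by
      have := (hd t).add ((hd (-t)).scomp t (hasDerivAt_neg t))
      refine this.congr_deriv ?_
      simp
    exact is_const_of_deriv_eq_zero (fun t => (h t).differentiableAt) (fun t => (h t).deriv) θ 0
  refine ⟨F 0 + F (-0), ?_, hconst⟩
  have hre : ∀ t, HasDerivAt (fun t => (F t).re) (Real.sqrt π * Real.exp (-t ^ 2 / 4 - 1)) t :=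
    fun t => by
      have := (Complex.reCLM.hasFDerivAt.comp_hasDerivAt t (hd t))
      rwa [reCLM_apply, ofReal_re] at this
  have hmono : StrictMono fun t => (F t).re := by
    refine strictMono_of_deriv_pos fun t => ?_
    rw [(hre t).deriv]
    have := Real.sqrt_pos.2 Real.pi_pos
    positivity
  have hlim : Tendsto (fun t => (F t).re) atBot (𝓝 0) := by
    have h0 : Tendsto (fun t => Real.exp t * ∫ y : ℝ, Real.exp (-1 * y ^ 2)) atBot (𝓝 0) := by
      simpa using Real.tendsto_exp_atBot.mul_const _
    refine squeeze_zero_norm (fun t => ?_) h0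
    refine (Complex.abs_re_le_norm _).trans ?_
    rw [hF]
    simp only [norm_mul, Complex.norm_real, Real.norm_of_nonneg (Real.exp_pos t).le]
    gcongr
    exact norm_mellinGauss_le t
  have h1 : 0 ≤ (F (-1)).re := hmono.monotone.le_of_tendsto hlim (-1)
  have h2 : (F (-1)).re < (F 0).re := hmono (by norm_num)
  intro h
  have h3 := congrArg Complex.re h
  rw [neg_zero, add_re, zero_re] at h3
  linarith

theorem exists_mul_eq_mellinGauss : ∃ S : ℂ, S ≠ 0 ∧ ∀ a b : ℝ, 0 < a → 0 < b →
    ((a * b : ℝ) : ℂ) = S * ((a ^ 2 : ℝ) * mellinGauss (Real.log a - Real.log b) +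
      (b ^ 2 : ℝ) * mellinGauss (-(Real.log a - Real.log b))) := by
  obtain ⟨S, hS, h⟩ := exists_exp_mul_mellinGauss_add
  refine ⟨S⁻¹, inv_ne_zero hS, fun a b ha hb => ?_⟩
  have h1 := h (Real.log a - Real.log b)
  rw [Real.exp_neg, Real.exp_sub, Real.exp_log ha, Real.exp_log hb] at h1
  rw [eq_inv_mul_iff_mul_eq₀ hS, ← h1]
  have ha' : (a : ℂ) ≠ 0 := ofReal_ne_zero.2 ha.ne'
  have hb' : (b : ℂ) ≠ 0 := ofReal_ne_zero.2 hb.ne'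
  push_cast
  field_simp

end Mellin

section Average

variable {n : ℕ} {p : ℝ}

theorem IFT1_congr_ae {A B : Rn1 n → ℂ} (h : A =ᵐ[volume] B) : IFT1 A = IFT1 B := by
  ext x
  simp only [IFT1_eq]
  exact integral_congr_ae (h.mono fun q hq => by simp only [hq])

/-- A Gaussian average of uniformly bounded multipliers is a multiplier. -/
theorem IsLpMultiplier.mul_mellinGauss (hp : 1 < p) {K : ℝ≥0} {χ : Rn1 n → ℂ} {θ : Rn1 n → ℝ}
    (hχ : Measurable χ) (hχ1 : ∀ q, ‖χ q‖ ≤ 1) (hθ : Measurable θ)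
    (hL : ∀ y : ℝ, IsLpMultiplier p (K * (Real.exp (5 / 8 * y ^ 2)).toNNReal)
      fun q => χ q * cexp (I * y * θ q)) :
    IsLpMultiplier p (K * (∫ y : ℝ, Real.exp (-(3 / 8) * y ^ 2)).toNNReal)
      fun q => χ q * mellinGauss (θ q) := by
  have hmeas : Measurable fun z : ℝ × Rn1 n => χ z.2 * cexp (I * z.1 * θ z.2) * mellinWeight z.1 :=
    ((hχ.comp measurable_snd).mul (Complex.measurable_exp.comp
      ((Complex.measurable_ofReal.comp measurable_fst).const_mul I |>.mul
      (Complex.measurable_ofReal.comp (hθ.comp measurable_snd))))).mul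
      (continuous_mellinWeight.measurable.comp measurable_fst)
  have hnorm : ∀ (y : ℝ) q, ‖χ q * cexp (I * y * θ q) * mellinWeight y‖ ≤
      Real.exp (-1 * y ^ 2) := fun y q => by
    rw [norm_mul, norm_mul, norm_cexp_I_mul_mul, mul_one]
    exact (mul_le_of_le_one_left (norm_nonneg _) (hχ1 q)).trans (norm_mellinWeight_le y)
  have hσ : ∀ q, χ q * mellinGauss (θ q) =
      ∫ y : ℝ, χ q * cexp (I * y * θ q) * mellinWeight y := fun q => by
    simp only [mellinGauss, mul_assoc]
    rw [integral_const_mul]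
  have hbdd : BddMeasurable fun q => χ q * mellinGauss (θ q) := by
    refine ⟨?_, ∫ y : ℝ, Real.exp (-1 * y ^ 2), fun q => ?_⟩
    · simp only [hσ]
      exact (hmeas.stronglyMeasurable.integral_prod_left').measurable
    · rw [norm_mul]
      exact (mul_le_of_le_one_left (norm_nonneg _) (hχ1 q)).trans (norm_mellinGauss_le _)
  refine ⟨hbdd, fun A hA hA' => ?_⟩
  set B := hA.1.mk A with hB
  have hBm : Measurable B := hA.1.stronglyMeasurable_mk.measurable
  have hAB : A =ᵐ[volume] B := hA.1.ae_eq_mk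
  have hBi : Integrable B := hA.congr hAB
  rw [IFT1_congr_ae hAB] at hA' ⊢
  rw [IFT1_congr_ae (B := fun q => χ q * mellinGauss (θ q) * B q)
    (hAB.mono fun q hq => by simp only [hq])]
  set ψ : ℝ → Rn1 n → ℂ := fun y x =>
    ∫ q, character q x * (χ q * cexp (I * y * θ q) * mellinWeight y * B q) with hψ
  have hψm : Measurable (Function.uncurry ψ) := by
    have : Measurable fun z : (ℝ × Rn1 n) × Rn1 n => character z.2 z.1.2 *
        (χ z.2 * cexp (I * z.1.1 * θ z.2) * mellinWeight z.1.1 * B z.2) :=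
      (continuous_character.measurable.comp (by fun_prop :
        Measurable fun z : (ℝ × Rn1 n) × Rn1 n => (z.2, z.1.2))).mul
      ((hmeas.comp (by fun_prop : Measurable fun z : (ℝ × Rn1 n) × Rn1 n => (z.1.1, z.2))).mul
        (hBm.comp measurable_snd))
    exact this.stronglyMeasurable.integral_prod_right'.measurable
  have hswap : (IFT1 fun q => χ q * mellinGauss (θ q) * B q) = fun x => ∫ y, ψ y x := by
    ext x
    rw [IFT1_eq, hψ]
    simp only
    rw [integral_integral_swap]
    · refine integral_congr_ae (.of_forall fun q => ?_)
      simp only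
      rw [integral_const_mul, integral_mul_const, hσ]
    · have hdom : Integrable (fun z : ℝ × Rn1 n => Real.exp (-1 * z.1 ^ 2) * ‖B z.2‖)
          (volume.prod volume) := (integrable_exp_neg_mul_sq one_pos).mul_prod hBi.norm
      refine hdom.mono' ?_ (.of_forall fun z => ?_)
      · exact (((continuous_character.measurable.comp (by fun_prop :
          Measurable fun z : ℝ × Rn1 n => (z.2, x)))).mul
          (hmeas.mul (hBm.comp measurable_snd))).aestronglyMeasurable
      · simp only [Function.uncurry]
        rw [norm_mul, norm_character, one_mul, norm_mul]
        gcongr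
        exact hnorm z.1 z.2
  have hψL : ∀ y, eLpNorm (ψ y) (ENNReal.ofReal p) volume ≤
      ENNReal.ofReal (Real.exp (-(3 / 8) * y ^ 2)) *
        (K * eLpNorm (IFT1 B) (ENNReal.ofReal p) volume) := fun y => by
    have h1 : ψ y = mellinWeight y • IFT1 fun q => χ q * cexp (I * y * θ q) * B q := by
      ext x
      simp only [Pi.smul_apply, smul_eq_mul, hψ]
      rw [← IFT1_const_mul, IFT1_eq]
      refine integral_congr_ae (.of_forall fun q => ?_)
      simp only
      ring
    rw [h1, eLpNorm_const_smul]
    calc _ ≤ ENNReal.ofReal (Real.exp (-1 * y ^ 2)) *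
          ((K * (Real.exp (5 / 8 * y ^ 2)).toNNReal : ℝ≥0) *
            eLpNorm (IFT1 B) (ENNReal.ofReal p) volume) := by
          gcongr
          · rw [← ofReal_norm]
            exact ENNReal.ofReal_le_ofReal (norm_mellinWeight_le y)
          · exact (hL y).2 B hBi hA'
      _ = (ENNReal.ofReal (Real.exp (-1 * y ^ 2)) * ENNReal.ofReal (Real.exp (5 / 8 * y ^ 2))) *
            (K * eLpNorm (IFT1 B) (ENNReal.ofReal p) volume) := by
          rw [ENNReal.coe_mul, ENNReal.ofReal]
          simp only [ENNReal.ofReal]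
          ring
      _ = _ := by
          rw [← ENNReal.ofReal_mul (Real.exp_pos _).le, ← Real.exp_add]
          congr 3
          ring
  rw [hswap]
  refine (eLpNorm_integral_le_lintegral_eLpNorm hp hψm).trans ((lintegral_mono hψL).trans_eq ?_)
  rw [lintegral_mul_const _ (by fun_prop), ← ofReal_integral_eq_lintegral_ofReal
    (integrable_exp_neg_mul_sq (by norm_num)) (.of_forall fun y => (Real.exp_pos _).le),
    ENNReal.coe_mul]
  simp only [ENNReal.ofReal]
  ring

end Average

section HomogeneousSymbol

variable {n : ℕ} {p : ℝ}

/-- The indicator of the complement of the hyperplane orthogonal to `e`. -/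
def offHyperplane (e q : Rn1 n) : ℂ := if pairing q e = 0 then 0 else 1

theorem measurable_pairing (e : Rn1 n) : Measurable fun q : Rn1 n => pairing q e :=
  (continuous_pairing.comp (by fun_prop : Continuous fun q : Rn1 n => (q, e))).measurable

theorem measurable_offHyperplane (e : Rn1 n) : Measurable (offHyperplane e) :=
  Measurable.ite (measurableSet_eq_fun (measurable_pairing e) measurable_const)
    measurable_const measurable_const

theorem norm_offHyperplane_le (e q : Rn1 n) : ‖offHyperplane e q‖ ≤ 1 := by
  unfold offHyperplane
  split_ifs <;> simp

theorem signPow_zero_mul_signPow (e : Rn1 n) (α : ℝ) (q : Rn1 n) :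
    signPow e 0 q * signPow e α q =
      offHyperplane e q * cexp (I * α * (Real.log |pairing q e| : ℝ)) := by
  unfold signPow offHyperplane
  split_ifs with h
  · simp [h]
  · have h' : |pairing q e| ≠ 0 := abs_ne_zero.2 h
    have hs : ((pairing q e / |pairing q e| : ℝ) : ℂ) * ((pairing q e / |pairing q e| : ℝ) : ℂ) =
        1 := by
      rw [← ofReal_mul, div_mul_div_comm, ← abs_mul_abs_self (pairing q e),
        div_self (mul_ne_zero h' h'), ofReal_one]
    rw [ofReal_zero, zero_mul, Complex.cpow_zero, mul_one, ← mul_assoc, hs,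
      Complex.cpow_def_of_ne_zero (ofReal_ne_zero.2 h'), Complex.ofReal_log (abs_nonneg _)]
    congr 2
    ring

/-- The symbols `mellinGauss (c log |q·e| + c' log |q·e'|)` are multipliers with uniform bounds. -/
theorem exists_isLpMultiplier_mellinGauss (hp : 1 < p) :
    ∃ K : ℝ≥0, ∀ (e e' : Rn1 n) (c c' : ℝ), c ^ 2 + c' ^ 2 ≤ 5 / 4 →
      IsLpMultiplier p K fun q => offHyperplane e q * offHyperplane e' q *
        mellinGauss (c * Real.log |pairing q e| + c' * Real.log |pairing q e'|) := by
  obtain ⟨K, hK⟩ := exists_isLpMultiplier_signPow (n := n) hp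
  refine ⟨_, fun e e' c c' hc => IsLpMultiplier.mul_mellinGauss (K := K * K * (K * K)) hp
    ((measurable_offHyperplane e).mul (measurable_offHyperplane e')) (fun q => ?_) ?_ fun y => ?_⟩
  · rw [norm_mul]
    exact mul_le_one₀ (norm_offHyperplane_le e q) (norm_nonneg _) (norm_offHyperplane_le e' q)
  · have hlog := fun e : Rn1 n =>
      Real.measurable_log.comp (continuous_abs.measurable.comp (measurable_pairing e))
    exact ((hlog e).const_mul c).add ((hlog e').const_mul c')
  · have hK0 : ∀ e : Rn1 n, IsLpMultiplier p K (signPow e 0) := fun e => by simpa using hK e 0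
    have h := ((hK0 e).mul (hK e (c * y))).mul ((hK0 e').mul (hK e' (c' * y)))
    have heq : (fun q => offHyperplane e q * offHyperplane e' q * cexp (I * y *
        ((c * Real.log |pairing q e| + c' * Real.log |pairing q e'| : ℝ) : ℂ))) =
        fun q => signPow e 0 q * signPow e (c * y) q *
          (signPow e' 0 q * signPow e' (c' * y) q) := by
      ext q
      rw [signPow_zero_mul_signPow, signPow_zero_mul_signPow, mul_mul_mul_comm, ← Complex.exp_add]
      congr 2
      push_cast
      ring
    rw [heq]
    refine h.mono ?_
    have h2 : K * (K * (Real.exp ((c * y) ^ 2 / 2)).toNNReal) *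
        (K * (K * (Real.exp ((c' * y) ^ 2 / 2)).toNNReal)) = K * K * (K * K) *
        (Real.exp ((c * y) ^ 2 / 2) * Real.exp ((c' * y) ^ 2 / 2)).toNNReal := by
      rw [Real.toNNReal_mul (Real.exp_nonneg _)]
      ring
    rw [h2, ← Real.exp_add]
    gcongr
    nlinarith [mul_le_mul_of_nonneg_right hc (sq_nonneg y)]

end HomogeneousSymbol

section Schwartz

open scoped SchwartzMap LineDeriv FourierTransform

variable {n : ℕ}

instance : (volume : Measure (Rn1 n)).IsAddHaarMeasure := by
  rw [Measure.volume_eq_prod]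
  infer_instance

/-- A Schwartz function on the product, viewed on the inner product space `WithLp 2 (ℝⁿ × ℝ)`. -/
def toInnerProd (f : 𝓢(Rn1 n, ℂ)) : 𝓢(WithLp 2 (Rn1 n), ℂ) :=
  SchwartzMap.compCLMOfContinuousLinearEquiv ℂ (WithLp.prodContinuousLinearEquiv 2 ℝ _ _) f

theorem inner_toLp (q x : Rn1 n) :
    inner ℝ (WithLp.toLp 2 q) (WithLp.toLp 2 x) = pairing q x := by
  simp [WithLp.prod_inner_apply, PiLp.inner_apply, pairing, mul_comm]

theorem integral_withLp (h : Rn1 n → ℂ) :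
    ∫ v : WithLp 2 (Rn1 n), h v.ofLp = ∫ x, h x :=
  (WithLp.volume_preserving_ofLp (Rn n) ℝ).integral_comp
    (MeasurableEquiv.toLp 2 (Rn1 n)).symm.measurableEmbedding h

theorem FT1_eq_fourier (f : 𝓢(Rn1 n, ℂ)) (q : Rn1 n) :
    FT1 f q = 𝓕 (toInnerProd f) (WithLp.toLp 2 q) := by
  rw [SchwartzMap.fourier_coe, Real.fourier_eq', FT1, ← integral_withLp]
  refine integral_congr_ae (.of_forall fun v => ?_)
  have h : inner ℝ v (WithLp.toLp 2 q) = (∑ k, v.ofLp.1 k * q.1 k) + v.ofLp.2 * q.2 :=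
    inner_toLp v.ofLp q
  simp only [h, smul_eq_mul]
  congr 2
  push_cast
  ring

theorem integrable_FT1 (f : 𝓢(Rn1 n, ℂ)) : Integrable (FT1 f) := by
  have h : FT1 f = ⇑(𝓕 (toInnerProd f) : 𝓢(WithLp 2 (Rn1 n), ℂ)) ∘ WithLp.toLp 2 := funext fun q => FT1_eq_fourier f q
  rw [h]
  exact ((WithLp.volume_preserving_toLp (Rn n) ℝ).integrable_comp_emb
    (MeasurableEquiv.toLp 2 (Rn1 n)).measurableEmbedding).2 (SchwartzMap.integrable _)

theorem IFT1_FT1 (f : 𝓢(Rn1 n, ℂ)) : IFT1 (FT1 f) = f := by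
  ext x
  have h1 : 𝓕⁻ (𝓕 (toInnerProd f)) (WithLp.toLp 2 x) = f x := by
    rw [FourierTransform.fourierInv_fourier_eq]
    rfl
  rw [← h1, SchwartzMap.fourierInv_coe, Real.fourierInv_eq', IFT1, ← integral_withLp]
  refine integral_congr_ae (.of_forall fun v => ?_)
  have h : inner ℝ v (WithLp.toLp 2 x) = (∑ k, v.ofLp.1 k * x.1 k) + v.ofLp.2 * x.2 :=
    inner_toLp v.ofLp x
  simp only [h, smul_eq_mul, FT1_eq_fourier]
  congr 2
  push_cast
  ring

theorem FT1_lineDerivOp (f : 𝓢(Rn1 n, ℂ)) (m q : Rn1 n) :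
    FT1 (∂_{m} f : 𝓢(Rn1 n, ℂ)) q = 2 * π * I * pairing q m * FT1 f q := by
  have h : toInnerProd (∂_{m} f) = ∂_{WithLp.toLp 2 m} (toInnerProd f) :=
    (SchwartzMap.lineDerivOp_compCLMOfContinuousLinearEquiv ℂ (WithLp.toLp 2 m)
      (WithLp.prodContinuousLinearEquiv 2 ℝ (Rn n) ℝ) f).symm
  have hm : (inner ℝ · (WithLp.toLp 2 m)).HasTemperateGrowth :=
    ((innerSL ℝ).flip (WithLp.toLp 2 m)).hasTemperateGrowth
  rw [FT1_eq_fourier, FT1_eq_fourier, h, SchwartzMap.fourier_lineDerivOp_eq,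
    smul_apply, SchwartzMap.smulLeftCLM_apply_apply hm, inner_toLp, Complex.real_smul,
    smul_eq_mul, mul_assoc (2 * (π : ℂ) * I)]

theorem dX_eq_lineDerivOp (k : Fin n) (f : 𝓢(Rn1 n, ℂ)) :
    dX k f = (∂_{((EuclideanSpace.single k 1, 0) : Rn1 n)} f : 𝓢(Rn1 n, ℂ)) := rfl

theorem dT_eq_lineDerivOp (f : 𝓢(Rn1 n, ℂ)) :
    dT f = (∂_{((0, 1) : Rn1 n)} f : 𝓢(Rn1 n, ℂ)) := rfl

theorem pairing_single (k : Fin n) (q : Rn1 n) : pairing q (EuclideanSpace.single k 1, 0) = q.1 k := by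
  simp [pairing, PiLp.single_apply]

theorem pairing_zero_one (q : Rn1 n) : pairing q (0, 1) = q.2 := by
  simp [pairing]

theorem ae_pairing_ne_zero {e : Rn1 n} (he : e ≠ 0) :
    ∀ᵐ q : Rn1 n, pairing q e ≠ 0 := by
  let φ : Rn1 n →ₗ[ℝ] ℝ :=
    { toFun := fun q => pairing q e
      map_add' := fun x y => by
        simp only [pairing, Prod.fst_add, Prod.snd_add, PiLp.add_apply, add_mul,
          Finset.sum_add_distrib]
        ring
      map_smul' := fun c x => by
        simp only [pairing, Prod.smul_fst, Prod.smul_snd, PiLp.smul_apply, smul_eq_mul, mul_assoc,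
          ← Finset.mul_sum, mul_add, RingHom.id_apply] }
  have hφ : φ.ker ≠ ⊤ := fun h => he <| by
    have h0 : pairing e e = 0 := LinearMap.mem_ker.1 (h ▸ Submodule.mem_top : e ∈ φ.ker)
    rw [← inner_toLp, inner_self_eq_zero] at h0
    exact (WithLp.toLp_eq_zero 2).1 h0
  exact measure_mono_null (fun q hq => by simpa [φ] using hq) (Measure.addHaar_submodule volume _ hφ)

theorem pNorm_ne_top (p : ℝ) (f : 𝓢(Rn1 n, ℂ)) : pNorm p f ≠ ∞ :=
  (f.memLp (ENNReal.ofReal p) volume).2.ne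

end Schwartz

section Interpolation

open scoped SchwartzMap LineDeriv

variable {n : ℕ} {p : ℝ}

theorem pNorm_IFT1_le (hp : 1 ≤ p) {K : ℝ≥0} {σ σ' D : Rn1 n → ℂ} (hσ : IsLpMultiplier p K σ)
    (hσ' : IsLpMultiplier p K σ') (c c' : ℂ) (g h : 𝓢(Rn1 n, ℂ))
    (hD : ∀ᵐ q, D q = c * σ q * FT1 g q + c' * σ' q * FT1 h q) :
    pNorm p (IFT1 D) ≤ (max ‖c‖₊ ‖c'‖₊ * K : ℝ≥0) * (pNorm p g + pNorm p h) := by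
  have hcσ := (hσ.const_mul c).mono (mul_le_mul_left (le_max_left ‖c‖₊ ‖c'‖₊) K)
  have hcσ' := (hσ'.const_mul c').mono (mul_le_mul_left (le_max_right ‖c‖₊ ‖c'‖₊) K)
  have hg := hcσ.1.integrable_mul (integrable_FT1 g)
  have hh := hcσ'.1.integrable_mul (integrable_FT1 h)
  have hg' := hcσ.2 _ (integrable_FT1 g) (by rw [IFT1_FT1]; exact pNorm_ne_top p g)
  have hh' := hcσ'.2 _ (integrable_FT1 h) (by rw [IFT1_FT1]; exact pNorm_ne_top p h)
  rw [IFT1_FT1] at hg' hh'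
  rw [IFT1_congr_ae hD]
  have hsum : (IFT1 fun q => c * σ q * FT1 g q + c' * σ' q * FT1 h q) =
      (IFT1 fun q => c * σ q * FT1 g q) + IFT1 fun q => c' * σ' q * FT1 h q := by
    ext x
    exact IFT1_add hg hh x
  rw [hsum, mul_add]
  exact (eLpNorm_add_le (continuous_IFT1 hg).aestronglyMeasurable
    (continuous_IFT1 hh).aestronglyMeasurable (ENNReal.one_le_ofReal.2 hp)).trans (add_le_add hg' hh')

/-- The symbol `mellinGauss (c log |q·e| + c' log |q·e'|)`, set to zero where `(q·e)(q·e') = 0`. -/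
def logSymbol (e e' : Rn1 n) (c c' : ℝ) (q : Rn1 n) : ℂ :=
  offHyperplane e q * offHyperplane e' q *
    mellinGauss (c * Real.log |pairing q e| + c' * Real.log |pairing q e'|)

theorem logSymbol_eq {e e' q : Rn1 n} (h : pairing q e ≠ 0) (h' : pairing q e' ≠ 0) (c c' : ℝ) :
    logSymbol e e' c c' q =
      mellinGauss (c * Real.log |pairing q e| + c' * Real.log |pairing q e'|) := by
  rw [logSymbol, offHyperplane, offHyperplane, if_neg h, if_neg h', one_mul, one_mul]

theorem exists_isLpMultiplier_logSymbol (hp : 1 < p) :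
    ∃ K : ℝ≥0, ∀ (e e' : Rn1 n) (c c' : ℝ), c ^ 2 + c' ^ 2 ≤ 5 / 4 →
      IsLpMultiplier p K (logSymbol e e' c c') ∧
      IsLpMultiplier p K (fun q => signPow e 0 q * logSymbol e e' c c' q) ∧
      IsLpMultiplier p K fun q => signPow e' 0 q * (signPow e 0 q * logSymbol e e' c c' q) := by
  obtain ⟨K, hK⟩ := exists_isLpMultiplier_signPow (n := n) hp
  obtain ⟨L, hL⟩ := exists_isLpMultiplier_mellinGauss (n := n) hp
  have hK0 : ∀ e : Rn1 n, IsLpMultiplier p (K + 1) (signPow e 0) := fun e =>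
    (hK e 0).mono (by simp)
  have h1 : 1 ≤ K + 1 := le_add_self
  refine ⟨(K + 1) * ((K + 1) * L), fun e e' c c' hc => ?_⟩
  have h := hL e e' c c' hc
  refine ⟨h.mono ?_, ((hK0 e).mul h).mono ?_, (hK0 e').mul ((hK0 e).mul h)⟩
  · rw [← mul_assoc]
    exact le_mul_of_one_le_left' (one_le_mul h1 h1)
  · exact le_mul_of_one_le_left' h1

theorem signPow_zero_eq (e q : Rn1 n) :
    signPow e 0 q = ((pairing q e / |pairing q e| : ℝ) : ℂ) := by
  rw [signPow, ofReal_zero, zero_mul, Complex.cpow_zero, mul_one]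

theorem div_abs_mul_self (x : ℝ) : x / |x| * x = |x| := by
  rcases eq_or_ne x 0 with rfl | h
  · simp
  · rw [div_mul_eq_mul_div, ← abs_mul_abs_self x, mul_div_cancel_right₀ _ (abs_ne_zero.2 h)]

theorem div_abs_mul_abs (x : ℝ) : x / |x| * |x| = x := by
  rcases eq_or_ne x 0 with rfl | h
  · simp
  · exact div_mul_cancel₀ _ (abs_ne_zero.2 h)

theorem log_abs_rpow_half (x : ℝ) :
    Real.log (|x| ^ ((1 : ℝ) / 2)) = 1 / 2 * Real.log |x| := by
  rcases eq_or_ne x 0 with rfl | h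
  · simp
  · exact Real.log_rpow (abs_pos.2 h) _

theorem abs_rpow_half_sq (x : ℝ) : (|x| ^ ((1 : ℝ) / 2)) ^ 2 = |x| := by
  rw [← Real.rpow_natCast, ← Real.rpow_mul (abs_nonneg x)]
  norm_num

theorem single_prod_zero_ne_zero (k : Fin n) : ((EuclideanSpace.single k 1, 0) : Rn1 n) ≠ 0 :=
  fun h => by simpa using congrArg Prod.fst h

theorem zero_prod_one_ne_zero : ((0, 1) : Rn1 n) ≠ 0 :=
  fun h => by simpa using congrArg Prod.snd h

theorem exists_pNorm_halfDt_le (hp : 1 < p) : ∃ C : ℝ≥0, ∀ f : 𝓢(Rn1 n, ℂ),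
    pNorm p (halfDt f) ≤ C * (pNorm p f + pNorm p (dT f)) := by
  obtain ⟨S, -, hS⟩ := exists_mul_eq_mellinGauss
  obtain ⟨K, hK⟩ := exists_isLpMultiplier_logSymbol (n := n) hp
  set e : Rn1 n := (0, 1) with he
  have hpe : ∀ q : Rn1 n, pairing q e = q.2 := pairing_zero_one
  refine ⟨_, fun f => pNorm_IFT1_le hp.le (hK e e (-(1 / 2)) 0 (by norm_num)).1
    (hK e e (1 / 2) 0 (by norm_num)).2.1 S (S / (2 * π * I)) f (∂_{e} f) ?_⟩
  filter_upwards [ae_pairing_ne_zero (zero_prod_one_ne_zero (n := n))] with q hq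
  rw [logSymbol_eq hq hq, logSymbol_eq hq hq, signPow_zero_eq, FT1_lineDerivOp]
  rw [← he, hpe] at hq
  rw [hpe]
  have h := hS 1 _ one_pos (Real.rpow_pos_of_pos (abs_pos.2 hq) (1 / 2))
  rw [one_mul, Real.log_one, log_abs_rpow_half, abs_rpow_half_sq, one_pow, zero_sub, neg_neg,
    ofReal_one, one_mul] at h
  rw [zero_mul, add_zero, add_zero, neg_mul]
  have hw : S / (2 * π * I) * (2 * π * I) = S := div_mul_cancel₀ _ two_pi_I_ne_zero
  have hs : ((q.2 / |q.2| : ℝ) : ℂ) * (q.2 : ℂ) = (|q.2| : ℝ) := by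
    rw [← ofReal_mul, div_abs_mul_self]
  linear_combination FT1 f q * h - (S * mellinGauss (1 / 2 * Real.log |q.2|) * FT1 f q) * hs -
    (((q.2 / |q.2| : ℝ) : ℂ) * mellinGauss (1 / 2 * Real.log |q.2|) * q.2 * FT1 f q) * hw

theorem exists_pNorm_dX_le (hp : 1 < p) : ∃ C : ℝ≥0, ∀ (k : Fin n) (f : 𝓢(Rn1 n, ℂ)),
    pNorm p (dX k f) ≤ C * (pNorm p (dX k (dX k f)) + pNorm p f) := by
  obtain ⟨S, -, hS⟩ := exists_mul_eq_mellinGauss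
  obtain ⟨K, hK⟩ := exists_isLpMultiplier_logSymbol (n := n) hp
  refine ⟨max ‖S / (2 * π * I)‖₊ ‖S * (2 * π * I)‖₊ * K, fun k f => ?_⟩
  set e : Rn1 n := (EuclideanSpace.single k 1, 0) with he
  have hpe : ∀ q : Rn1 n, pairing q e = q.1 k := pairing_single k
  rw [dX_eq_lineDerivOp k f, dX_eq_lineDerivOp k (∂_{e} f)]
  nth_rw 1 [← IFT1_FT1 (∂_{e} f)]
  refine pNorm_IFT1_le hp.le (hK e e 1 0 (by norm_num)).2.1
    (hK e e (-1) 0 (by norm_num)).2.1 _ _ (∂_{e} (∂_{e} f)) f ?_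
  filter_upwards [ae_pairing_ne_zero (single_prod_zero_ne_zero k)] with q hq
  rw [logSymbol_eq hq hq, logSymbol_eq hq hq, signPow_zero_eq,
    FT1_lineDerivOp (∂_{e} f), FT1_lineDerivOp f]
  rw [← he, hpe] at hq
  rw [hpe]
  have h := hS _ 1 (abs_pos.2 hq) one_pos
  rw [mul_one, Real.log_one, sub_zero, one_pow, ofReal_one, one_mul, sq_abs] at h
  rw [zero_mul, add_zero, add_zero, one_mul, neg_one_mul]
  have hw : S / (2 * π * I) * (2 * π * I) = S := div_mul_cancel₀ _ two_pi_I_ne_zero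
  have hs : (q.1 k : ℂ) = ((q.1 k / |q.1 k| : ℝ) : ℂ) * (|q.1 k| : ℝ) := by
    rw [← ofReal_mul, div_abs_mul_abs]
  rw [ofReal_pow] at h
  linear_combination (2 * π * I * FT1 f q) * hs +
    (2 * π * I * FT1 f q * ((q.1 k / |q.1 k| : ℝ) : ℂ)) * h -
    (((q.1 k / |q.1 k| : ℝ) : ℂ) * mellinGauss (Real.log |q.1 k|) * (2 * π * I) * (q.1 k : ℂ) ^ 2 *
      FT1 f q) * hw

theorem exists_pNorm_halfDt_dX_le (hp : 1 < p) : ∃ C : ℝ≥0, ∀ (k : Fin n) (f : 𝓢(Rn1 n, ℂ)),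
    pNorm p (halfDt (dX k f)) ≤ C * (pNorm p (dX k (dX k f)) + pNorm p (dT f)) := by
  obtain ⟨S, -, hS⟩ := exists_mul_eq_mellinGauss
  obtain ⟨K, hK⟩ := exists_isLpMultiplier_logSymbol (n := n) hp
  refine ⟨max ‖S / (2 * π * I)‖₊ ‖S‖₊ * K, fun k f => ?_⟩
  set e : Rn1 n := (EuclideanSpace.single k 1, 0) with he
  have hpe : ∀ q : Rn1 n, pairing q e = q.1 k := pairing_single k
  have hpt : ∀ q : Rn1 n, pairing q (0, 1) = q.2 := pairing_zero_one
  rw [dX_eq_lineDerivOp k f, dX_eq_lineDerivOp k (∂_{e} f), dT_eq_lineDerivOp f, halfDt, MOp]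
  refine pNorm_IFT1_le hp.le (hK e (0, 1) 1 (-(1 / 2)) (by norm_num)).2.1
    (hK e (0, 1) (-1) (1 / 2) (by norm_num)).2.2 _ _ (∂_{e} (∂_{e} f))
    (∂_{((0, 1) : Rn1 n)} f) ?_
  filter_upwards [ae_pairing_ne_zero (single_prod_zero_ne_zero k),
    ae_pairing_ne_zero (zero_prod_one_ne_zero (n := n))] with q hq hq'
  rw [logSymbol_eq hq hq', logSymbol_eq hq hq', signPow_zero_eq, signPow_zero_eq,
    FT1_lineDerivOp (∂_{e} f), FT1_lineDerivOp f, FT1_lineDerivOp f]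
  rw [← he, hpe] at hq
  rw [hpt] at hq'
  rw [hpe, hpt]
  have h := hS _ _ (abs_pos.2 hq) (Real.rpow_pos_of_pos (abs_pos.2 hq') (1 / 2))
  rw [log_abs_rpow_half, abs_rpow_half_sq, sq_abs] at h
  rw [one_mul, neg_one_mul, neg_mul, ← sub_eq_add_neg,
    neg_add_eq_sub, ← neg_sub (Real.log |q.1 k|)]
  have hw : S / (2 * π * I) * (2 * π * I) = S := div_mul_cancel₀ _ two_pi_I_ne_zero
  have hs : (q.1 k : ℂ) = ((q.1 k / |q.1 k| : ℝ) : ℂ) * (|q.1 k| : ℝ) := by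
    rw [← ofReal_mul, div_abs_mul_abs]
  have hs' : ((q.2 / |q.2| : ℝ) : ℂ) * (q.2 : ℂ) = (|q.2| : ℝ) := by
    rw [← ofReal_mul, div_abs_mul_self]
  rw [ofReal_pow, ofReal_mul] at h
  set θ := Real.log |q.1 k| - 1 / 2 * Real.log |q.2|
  linear_combination (((|q.2| ^ ((1 : ℝ) / 2) : ℝ) : ℂ) * (2 * π * I) * FT1 f q) * hs +
    (2 * π * I * FT1 f q * ((q.1 k / |q.1 k| : ℝ) : ℂ)) * h -
    (((q.1 k / |q.1 k| : ℝ) : ℂ) * mellinGauss θ * (2 * π * I) * (q.1 k : ℂ) ^ 2 * FT1 f q) * hw -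
    (2 * π * I * FT1 f q * ((q.1 k / |q.1 k| : ℝ) : ℂ) * S * mellinGauss (-θ)) * hs'

end Interpolation

/-- `‖D_t^{1/2}f‖_p + Σ_k‖∂_{X_k}f‖_p + Σ_k‖D_t^{1/2}∂_{X_k}f‖_p ≲
‖f‖_p + ‖∂_t f‖_p + Σ_{k,l}‖∂_{X_k}∂_{X_l}f‖_p`. -/
theorem stmt6 (n : ℕ) (hn : 1 ≤ n) (p : ℝ) (hp : 1 < p) :
    ∃ C : ℝ, 0 < C ∧
      ∀ f : SchwartzMap (Rn1 n) ℂ,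
        pNorm p (halfDt ⇑f) + ∑ k : Fin n, pNorm p (dX k ⇑f)
            + ∑ k : Fin n, pNorm p (halfDt (dX k ⇑f))
          ≤ ENNReal.ofReal C *
            (pNorm p ⇑f + pNorm p (dT ⇑f)
              + ∑ k : Fin n, ∑ l : Fin n, pNorm p (dX k (dX l ⇑f))) := by
  obtain ⟨C₁, h₁⟩ := exists_pNorm_halfDt_le (n := n) hp
  obtain ⟨C₂, h₂⟩ := exists_pNorm_dX_le (n := n) hp
  obtain ⟨C₃, h₃⟩ := exists_pNorm_halfDt_dX_le (n := n) hp
  refine ⟨((C₁ + n * C₂ + n * C₃ + 1 : ℝ≥0) : ℝ), by positivity, fun f => ?_⟩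
  rw [ENNReal.ofReal_coe_nnreal]
  set T := pNorm p f + pNorm p (dT f) + ∑ k, ∑ l, pNorm p (dX k (dX l f)) with hT
  have hk : ∀ k, pNorm p (dX k (dX k f)) ≤ ∑ k, ∑ l, pNorm p (dX k (dX l f)) := fun k =>
    (Finset.single_le_sum (f := fun l => pNorm p (dX k (dX l f))) (fun _ _ => zero_le)
      (Finset.mem_univ k)).trans
    (Finset.single_le_sum (f := fun k => ∑ l, pNorm p (dX k (dX l f))) (fun _ _ => zero_le)
      (Finset.mem_univ k))
  have e₁ : pNorm p (halfDt f) ≤ C₁ * T :=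
    (h₁ f).trans (mul_le_mul_right le_self_add _)
  have e₂ : ∀ k, pNorm p (dX k f) ≤ C₂ * T := fun k =>
    (h₂ k f).trans <| mul_le_mul_right ((add_comm _ _).trans_le
      (add_le_add le_self_add (hk k))) _
  have e₃ : ∀ k, pNorm p (halfDt (dX k f)) ≤ C₃ * T := fun k =>
    (h₃ k f).trans <| mul_le_mul_right ((add_comm _ _).trans_le
      (add_le_add le_add_self (hk k))) _
  calc _ ≤ C₁ * T + ∑ _k : Fin n, C₂ * T + ∑ _k : Fin n, C₃ * T :=
        add_le_add (add_le_add e₁ (Finset.sum_le_sum fun k _ => e₂ k))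
          (Finset.sum_le_sum fun k _ => e₃ k)
    _ = (C₁ + n * C₂ + n * C₃ : ℝ≥0) * T := by
        simp only [Finset.sum_const, Finset.card_univ, Fintype.card_fin, nsmul_eq_mul]
        push_cast
        ring
    _ ≤ _ := mul_le_mul_left (ENNReal.coe_le_coe.2 le_self_add) T
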